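/- arXiv:math/0010310 — 3 statements merged into one kernel-verified Lean document; each statement's English description precedes it below -/
import Mathlib

section
/- For every n ≥ 4, there exists an injective group homomorphism from M_n, the mapping class group of the n-times punctured sphere presented as below, into GL(n·C(n−1,2), ℂ), where C(n−1,2) is the binomial coefficient (n−1) choose 2. In particular, the mapping class group of the n-times punctured sphere is linear. -/
/-- The braid relators on `m` generators: `σᵢσⱼσᵢ⁻¹σⱼ⁻¹` for `|i − j| ≥ 2` and
`σᵢσⱼσᵢ(σⱼσᵢσⱼ)⁻¹` for `|i − j| = 1`. -/
def braidRelsSet (m : ℕ) : Set (FreeGroup (Fin m)) :=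
  {r | ∃ i j : Fin m,
      (((i : ℕ) + 2 ≤ (j : ℕ) ∨ (j : ℕ) + 2 ≤ (i : ℕ)) ∧
        r = FreeGroup.of i * FreeGroup.of j * (FreeGroup.of i)⁻¹ * (FreeGroup.of j)⁻¹) ∨
      (((i : ℕ) + 1 = (j : ℕ) ∨ (j : ℕ) + 1 = (i : ℕ)) ∧
        r = FreeGroup.of i * FreeGroup.of j * FreeGroup.of i *
            (FreeGroup.of j * FreeGroup.of i * FreeGroup.of j)⁻¹)}

/-- The word `σ₁σ₂⋯σ_m` in the free group on `m` generators. -/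
def braidWord (m : ℕ) : FreeGroup (Fin m) :=
  (List.ofFn fun i : Fin m => FreeGroup.of i).prod

/-- The braid group `B_n`, presented with generators `σ₁, …, σ_{n−1}` and the
braid relations. -/
abbrev BraidGroup (n : ℕ) := PresentedGroup (braidRelsSet (n - 1))

/-- The generator `σ_{i+1}` of the braid group `B_n` (0-indexed by `i : Fin (n-1)`). -/
def braidGen (n : ℕ) (i : Fin (n - 1)) : BraidGroup n := PresentedGroup.of i

/-- The full twist `Δ² = (σ₁σ₂⋯σ_{n−1})ⁿ` in the braid group `B_n`. -/
def fullTwist (n : ℕ) : BraidGroup n :=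
  ((List.ofFn fun i : Fin (n - 1) => braidGen n i).prod) ^ n

/-- The word `σ₁⋯σ_{m-1}σ_m σ_m σ_{m-1}⋯σ₁` (i.e. `σ₁⋯σ_{n−2}σ_{n−1}²σ_{n−2}⋯σ₁`
for `m = n − 1`) in the free group on `m` generators. -/
def puncturedSphereWord (m : ℕ) : FreeGroup (Fin m) :=
  braidWord m * ((List.ofFn fun i : Fin m => FreeGroup.of i).reverse).prod

/-- The relators for the standard (Magnus) presentation of the mapping class
group of the `n`-times punctured sphere: the braid relators on `n − 1`
generators together with `σ₁⋯σ_{n−2}σ_{n−1}²σ_{n−2}⋯σ₁` and `(σ₁⋯σ_{n−1})ⁿ`. -/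
def sphereRelsSet (n : ℕ) : Set (FreeGroup (Fin (n - 1))) :=
  braidRelsSet (n - 1) ∪ {puncturedSphereWord (n - 1), (braidWord (n - 1)) ^ n}

/-- The mapping class group of the `n`-times punctured sphere, via its standard
presentation. -/
abbrev SphereMCG (n : ℕ) := PresentedGroup (sphereRelsSet n)

/-- The generator `σ_{i+1}` of `SphereMCG n`. -/
def sphereGen (n : ℕ) (i : Fin (n - 1)) : SphereMCG n := PresentedGroup.of i

set_option linter.unusedSectionVars false
namespace LK
section braidwords
variable {G : Type*} [Group G]

/-- `s 0, …, s (M-1)` satisfy the braid relations. -/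
structure BR (s : ℕ → G) (M : ℕ) : Prop where
  comm : ∀ i j, i + 2 ≤ j → j < M → s i * s j = s j * s i
  braid : ∀ i, i + 1 < M → s i * s (i+1) * s i = s (i+1) * s i * s (i+1)

/-- `s 0 * s 1 * ⋯ * s (k-1)`. -/
def del (s : ℕ → G) : ℕ → G
  | 0 => 1
  | k+1 => del s k * s k

/-- `s (k-1) * ⋯ * s 0`. -/
def rev (s : ℕ → G) : ℕ → G
  | 0 => 1
  | k+1 => s k * rev s k

/-- The half twist on `k` generators. -/
def Dl (s : ℕ → G) : ℕ → G
  | 0 => 1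
  | k+1 => Dl s k * rev s (k+1)

/-- The full twist on `k` generators. -/
def tw (s : ℕ → G) (k : ℕ) : G := del s k ^ (k+1)


theorem BR.commute {s : ℕ → G} {M : ℕ} (h : BR s M) {i j : ℕ} (hij : i + 2 ≤ j ∨ j + 2 ≤ i) (hi : i < M) (hj : j < M) :
    Commute (s i) (s j) := by
  rcases hij with h1 | h1
  · exact h.comm i j h1 hj
  · exact (h.comm j i h1 hi).symm

theorem BR.comm_del {s : ℕ → G} {M : ℕ} (h : BR s M) {k j : ℕ} (hk : k + 1 ≤ j) (hj : j < M) : Commute (s j) (del s k) := by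
  induction k with
  | zero => exact Commute.one_right _
  | succ k ih => exact (ih (by omega)).mul_right (h.commute (by omega) hj (by omega))

theorem BR.comm_rev {s : ℕ → G} {M : ℕ} (h : BR s M) {k j : ℕ} (hk : k + 1 ≤ j) (hj : j < M) : Commute (s j) (rev s k) := by
  induction k with
  | zero => exact Commute.one_right _
  | succ k ih => exact (h.commute (by omega) hj (by omega)).mul_right (ih (by omega))

theorem BR.comm_Dl {s : ℕ → G} {M : ℕ} (h : BR s M) {k j : ℕ} (hk : k + 1 ≤ j) (hj : j < M) : Commute (s j) (Dl s k) := by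
  induction k with
  | zero => exact Commute.one_right _
  | succ k ih => exact (ih (by omega)).mul_right (h.comm_rev (by omega) hj)

theorem BR.del_shift {s : ℕ → G} {M : ℕ} (h : BR s M) {k i : ℕ} (hi : i + 1 < k) (hk : k ≤ M) :
    del s k * s i = s (i+1) * del s k := by
  induction k with
  | zero => omega
  | succ k ih =>
    rcases Nat.lt_or_ge (i+1) k with h1 | h1
    · have e1 := ih h1 (by omega)
      have e2 := h.comm i k (by omega) (by omega)
      calc del s k * s k * s i = del s k * (s k * s i) := by group
        _ = del s k * (s i * s k) := by rw [e2]
        _ = del s k * s i * s k := by group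
        _ = s (i+1) * (del s k * s k) := by rw [e1]; group
    · obtain rfl : k = i + 1 := by omega
      have e1 := (h.comm_del (k := i) (j := i+1) (by omega) (by omega)).eq
      have e2 := h.braid i (by omega)
      calc del s i * s i * s (i+1) * s i = del s i * (s i * s (i+1) * s i) := by group
        _ = (del s i * s (i+1)) * s i * s (i+1) := by rw [e2]; group
        _ = s (i+1) * (del s i * s i * s (i+1)) := by rw [← e1]; group

theorem BR.rev_shift {s : ℕ → G} {M : ℕ} (h : BR s M) {k i : ℕ} (hi : i + 1 < k) (hk : k ≤ M) :
    rev s k * s (i+1) = s i * rev s k := by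
  induction k with
  | zero => omega
  | succ k ih =>
    rcases Nat.lt_or_ge (i+1) k with h1 | h1
    · have e1 := ih h1 (by omega)
      have e2 := h.comm i k (by omega) (by omega)
      calc s k * rev s k * s (i+1) = s k * (rev s k * s (i+1)) := by group
        _ = s k * s i * rev s k := by rw [e1]; group
        _ = s i * (s k * rev s k) := by rw [← e2]; group
    · obtain rfl : k = i + 1 := by omega
      have e1 := (h.comm_rev (k := i) (j := i+1) (by omega) (by omega)).eq
      have e2 := h.braid i (by omega)
      calc s (i+1) * (s i * rev s i) * s (i+1) = s (i+1) * s i * (rev s i * s (i+1)) := by group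
        _ = (s (i+1) * s i * s (i+1)) * rev s i := by rw [← e1]; group
        _ = s i * (s (i+1) * (s i * rev s i)) := by rw [← e2]; group

theorem BR.del_pow_shift {s : ℕ → G} {M : ℕ} (h : BR s M) {k i m : ℕ} (hi : i + m < k) (hk : k ≤ M) :
    del s k ^ m * s i = s (i+m) * del s k ^ m := by
  induction m with
  | zero => simp
  | succ m ih =>
    calc del s k ^ (m+1) * s i = del s k * (del s k ^ m * s i) := by rw [pow_succ']; group
      _ = (del s k * s (i+m)) * del s k ^ m := by rw [ih (by omega)]; group
      _ = s (i+m+1) * (del s k * del s k ^ m) := by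
          rw [h.del_shift (by omega) hk]; group
      _ = s (i+(m+1)) * del s k ^ (m+1) := by rw [pow_succ']; rfl

theorem BR.del_pow_rev {s : ℕ → G} {M : ℕ} (h : BR s M) {k m : ℕ} (hm : m ≤ k + 1) (hk : k + 1 ≤ M) :
    del s (k+1) ^ m * rev s (k+1-m) = del s k ^ m * rev s (k+1) := by
  induction m with
  | zero => simp
  | succ m ih =>
    have e1 := ih (by omega)
    have e2 : rev s (k+1-m) = s (k-m) * rev s (k-m) := by
      rw [show k + 1 - m = (k-m)+1 by omega]; rfl
    have e3 := h.del_pow_shift (k := k+1) (i := k-m) (m := m) (by omega) hk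
    rw [show k - m + m = k by omega] at e3
    symm
    calc del s k ^ (m+1) * rev s (k+1) = del s k * (del s k ^ m * rev s (k+1)) := by
            rw [pow_succ']; group
      _ = del s k * (del s (k+1) ^ m * s (k-m)) * rev s (k-m) := by rw [← e1, e2]; group
      _ = (del s k * s k) * del s (k+1) ^ m * rev s (k-m) := by rw [e3]; group
      _ = del s (k+1) ^ (m+1) * rev s (k-m) := by rw [pow_succ']; rfl
      _ = _ := by rw [show k + 1 - (m+1) = k - m by omega]

theorem BR.tw_succ {s : ℕ → G} {M : ℕ} (h : BR s M) {k : ℕ} (hk : k + 1 ≤ M) :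
    tw s (k+1) = tw s k * (rev s (k+1) * del s (k+1)) := by
  have e := h.del_pow_rev (k := k) (m := k+1) le_rfl hk
  simp only [Nat.sub_self, rev, mul_one] at e
  unfold tw
  rw [pow_succ, e]
  simp only [rev]; group

theorem BR.comm_D {s : ℕ → G} {M : ℕ} (h : BR s M) {k i : ℕ} (hi : i + 1 < k) (hk : k ≤ M) :
    Commute (s i) (rev s k * del s k) := by
  have e1 := h.del_shift hi hk
  have e2 := h.rev_shift hi hk
  show s i * (rev s k * del s k) = _
  rw [← mul_assoc, ← e2, mul_assoc, ← e1, mul_assoc]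

theorem BR.comm_X {s : ℕ → G} {M : ℕ} (h : BR s M) {k i : ℕ} (hi : i + 1 < k) (hk : k ≤ M) :
    Commute (s (i+1)) (del s k * rev s k) := by
  have e1 := h.del_shift hi hk
  have e2 := h.rev_shift hi hk
  show s (i+1) * (del s k * rev s k) = _
  rw [← mul_assoc, ← e1, mul_assoc, ← e2, mul_assoc]

theorem BR.comm_tw {s : ℕ → G} {M : ℕ} (h : BR s M) {k i : ℕ} (hi : i < k) (hk : k ≤ M) : Commute (s i) (tw s k) := by
  induction k generalizing i with
  | zero => omega
  | succ k ih =>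
    have low : ∀ i, i < k → Commute (s i) (tw s (k+1)) := by
      intro i hi
      rw [h.tw_succ hk]
      exact (ih hi (by omega)).mul_right (h.comm_D (by omega) hk)
    rcases Nat.lt_or_ge i k with h1 | h1
    · exact low i h1
    · obtain rfl : k = i := by omega
      rcases k with _ | k
      · simp only [tw, del, one_mul]
        exact (Commute.refl _).pow_right _
      · have e := h.del_shift (k := k+1+1) (i := k) (by omega) hk
        have e' : s (k+1) = del s (k+1+1) * s k * (del s (k+1+1))⁻¹ := by rw [e]; group
        have c : Commute (del s (k+1+1)) (tw s (k+1+1)) := (Commute.refl _).pow_right _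
        rw [e']
        exact (c.mul_left (low k (by omega))).mul_left c.inv_left

theorem BR.Dl_succ' {s : ℕ → G} {M : ℕ} (h : BR s M) {k : ℕ} (hk : k + 1 ≤ M) : Dl s (k+1) = del s (k+1) * Dl s k := by
  induction k with
  | zero => simp [Dl, del, rev]
  | succ k ih =>
    have e := (h.comm_Dl (k := k) (j := k+1) le_rfl hk).eq
    calc Dl s (k+1) * rev s (k+1+1) = del s (k+1) * (Dl s k * s (k+1)) * rev s (k+1) := by
          rw [ih (by omega)]; simp only [rev]; group
      _ = (del s (k+1) * s (k+1)) * (Dl s k * rev s (k+1)) := by rw [← e]; group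
      _ = _ := rfl

theorem BR.Dl_shift {s : ℕ → G} {M : ℕ} (h : BR s M) {k i : ℕ} (hi : i < k) (hk : k ≤ M) :
    Dl s k * s i = s (k-1-i) * Dl s k := by
  induction k generalizing i with
  | zero => omega
  | succ k ih =>
    rcases i with _ | i
    · rcases k with _ | k
      · simp [Dl, rev]
      · have e1 := ih (i := 0) (by omega) (by omega)
        have e2 := h.del_shift (k := k+1+1) (i := k) (by omega) hk
        rw [h.Dl_succ' hk, mul_assoc, e1, ← mul_assoc]
        simp only [Nat.add_sub_cancel, Nat.sub_zero]
        rw [e2, mul_assoc]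
    · have e1 := ih (i := i) (by omega) (by omega)
      have e2 := h.rev_shift (k := k+1) (i := i) (by omega) hk
      calc Dl s k * rev s (k+1) * s (i+1) = Dl s k * (rev s (k+1) * s (i+1)) := by group
        _ = (Dl s k * s i) * rev s (k+1) := by rw [e2]; group
        _ = s (k-1-i) * (Dl s k * rev s (k+1)) := by rw [e1]; group
        _ = _ := by rw [show k+1-1-(i+1) = k-1-i by omega]; rfl

theorem BR.Dl_comm_of {s : ℕ → G} {M : ℕ} (h : BR s M) {k : ℕ} {x : G} (hx : ∀ i < k, Commute (s i) x) : Commute (Dl s k) x := by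
  have hr : ∀ m ≤ k, Commute (rev s m) x := by
    intro m
    induction m with
    | zero => intro _; exact Commute.one_left _
    | succ m ih => intro hm; exact (hx m (by omega)).mul_left (ih (by omega))
  have : ∀ m ≤ k, Commute (Dl s m) x := by
    intro m
    induction m with
    | zero => intro _; exact Commute.one_left _
    | succ m ih => intro hm; exact (ih (by omega)).mul_left (hr _ hm)
  exact this k le_rfl

theorem BR.Dl_sq {s : ℕ → G} {M : ℕ} (h : BR s M) {k : ℕ} (hk : k ≤ M) : Dl s k * Dl s k = tw s k := by
  induction k with
  | zero => simp [Dl, tw, del]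
  | succ k ih =>
    have c : Commute (Dl s k) (rev s (k+1) * del s (k+1)) :=
      h.Dl_comm_of (fun i hi => h.comm_D (by omega) hk)
    calc Dl s (k+1) * Dl s (k+1) = Dl s k * rev s (k+1) * (del s (k+1) * Dl s k) := by
          conv_lhs => rw [h.Dl_succ' hk]
          rw [← h.Dl_succ' hk]; rfl
      _ = Dl s k * ((rev s (k+1) * del s (k+1)) * Dl s k) := by group
      _ = (Dl s k * Dl s k) * (rev s (k+1) * del s (k+1)) := by rw [← c.eq]; group
      _ = _ := by rw [ih (by omega), ← h.tw_succ hk]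
end braidwords
end LK

namespace LK
section ops
variable {R : Type*} [CommRing R]

/-- Transposed Lawrence-Krammer operator. -/
def TT (q t : R) (k : ℕ) (f : ℕ → ℕ → R) (i j : ℕ) : R :=
  if j ≤ i then f i j
  else if i = k then
    (if j = k + 1 then t * q ^ 2 * f k (k + 1)
      else f (k + 1) j + t * q * (q - 1) * f k (k + 1))
  else if i = k + 1 then q * f k j + (1 - q) * f (k + 1) j
  else if j = k then (1 - q) * f i k + q * f i (k + 1)
  else if j = k + 1 then f i k + t * q * (q - 1) * f k (k + 1)
  else if i < k ∧ k + 1 < j then f i j + t * (q - 1) ^ 2 * f k (k + 1)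
  else f i j

theorem TT_junk (q t : R) (k : ℕ) (f : ℕ → ℕ → R) {i j : ℕ} (h : j ≤ i) :
    TT q t k f i j = f i j := by simp [TT, h]
theorem TT_root (q t : R) (k : ℕ) (f : ℕ → ℕ → R) :
    TT q t k f k (k+1) = t * q ^ 2 * f k (k + 1) := by simp [TT]
theorem TT_k (q t : R) (k : ℕ) (f : ℕ → ℕ → R) {j : ℕ} (h : k + 1 < j) :
    TT q t k f k j = f (k + 1) j + t * q * (q - 1) * f k (k + 1) := by
  unfold TT
  rw [if_neg (by omega), if_pos rfl, if_neg (by omega)]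
theorem TT_k1 (q t : R) (k : ℕ) (f : ℕ → ℕ → R) {j : ℕ} (h : k + 1 < j) :
    TT q t k f (k+1) j = q * f k j + (1 - q) * f (k + 1) j := by
  unfold TT
  rw [if_neg (by omega), if_neg (by omega), if_pos rfl]
theorem TT_jk (q t : R) (k : ℕ) (f : ℕ → ℕ → R) {i : ℕ} (h : i < k) :
    TT q t k f i k = (1 - q) * f i k + q * f i (k + 1) := by
  unfold TT
  rw [if_neg (by omega), if_neg (by omega), if_neg (by omega), if_pos rfl]
theorem TT_jk1 (q t : R) (k : ℕ) (f : ℕ → ℕ → R) {i : ℕ} (h : i < k) :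
    TT q t k f i (k+1) = f i k + t * q * (q - 1) * f k (k + 1) := by
  unfold TT
  rw [if_neg (by omega), if_neg (by omega), if_neg (by omega), if_neg (by omega), if_pos rfl]
theorem TT_mid (q t : R) (k : ℕ) (f : ℕ → ℕ → R) {i j : ℕ} (h : i < k) (h' : k + 1 < j) :
    TT q t k f i j = f i j + t * (q - 1) ^ 2 * f k (k + 1) := by
  unfold TT
  rw [if_neg (by omega), if_neg (by omega), if_neg (by omega), if_neg (by omega),
    if_neg (by omega), if_pos ⟨h, h'⟩]
theorem TT_left (q t : R) (k : ℕ) (f : ℕ → ℕ → R) {i j : ℕ} (h : j < k) :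
    TT q t k f i j = f i j := by
  unfold TT
  split_ifs <;> first | rfl | omega
theorem TT_right (q t : R) (k : ℕ) (f : ℕ → ℕ → R) {i j : ℕ} (h : k + 1 < i) :
    TT q t k f i j = f i j := by
  unfold TT
  split_ifs <;> first | rfl | omega

theorem TT_braid (q t : R) (k : ℕ) (f : ℕ → ℕ → R) :
    TT q t k (TT q t (k+1) (TT q t k f)) = TT q t (k+1) (TT q t k (TT q t (k+1) f)) := by
  funext i j
  by_cases hij : j ≤ i
  · simp [TT_junk, hij]
  push Not at hij
  have hi : i < k ∨ i = k ∨ i = k+1 ∨ i = k+2 ∨ k+2 < i := by omega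
  have hj : j < k ∨ j = k ∨ j = k+1 ∨ j = k+2 ∨ k+2 < j := by omega
  rcases hi with hi | rfl | rfl | rfl | hi <;> rcases hj with hj | rfl | rfl | rfl | hj <;>
  first
  | omega
  | (simp (disch := omega) only [TT_root, TT_k, TT_k1, TT_jk, TT_jk1, TT_mid, TT_left, TT_right]
     try ring)

theorem TT_comm (q t : R) (k l : ℕ) (hkl : k + 2 ≤ l) (f : ℕ → ℕ → R) :
    TT q t k (TT q t l f) = TT q t l (TT q t k f) := by
  funext i j
  by_cases hij : j ≤ i
  · simp [TT_junk, hij]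
  push Not at hij
  have hi : i < k ∨ i = k ∨ i = k+1 ∨ (k + 1 < i ∧ i < l) ∨ i = l ∨ i = l + 1 ∨ l + 1 < i := by omega
  have hj : j < k ∨ j = k ∨ j = k+1 ∨ (k + 1 < j ∧ j < l) ∨ j = l ∨ j = l + 1 ∨ l + 1 < j := by omega
  rcases hi with hi | rfl | rfl | ⟨hi, hi'⟩ | rfl | rfl | hi <;>
    rcases hj with hj | rfl | rfl | ⟨hj, hj'⟩ | rfl | rfl | hj <;>
  first
  | omega
  | (simp (disch := omega) only [TT_root, TT_k, TT_k1, TT_jk, TT_jk1, TT_mid, TT_left, TT_right]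
     try ring)
end ops
end LK

set_option linter.unusedSectionVars false
namespace LK
section ops2
variable {R : Type*} [CommRing R]

theorem TT_add (q t : R) (k : ℕ) (f g : ℕ → ℕ → R) :
    TT q t k (f + g) = TT q t k f + TT q t k g := by
  funext i j
  simp only [TT, Pi.add_apply]
  split_ifs <;> ring

theorem TT_smul (q t : R) (k : ℕ) (c : R) (f : ℕ → ℕ → R) :
    TT q t k (c • f) = c • TT q t k f := by
  funext i j
  simp only [TT, Pi.smul_apply, smul_eq_mul]
  split_ifs <;> ring

theorem TT_map {S : Type*} [CommRing S] (φ : R →+* S) (q t : R) (k : ℕ) (f : ℕ → ℕ → R) :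
    (fun i j => φ (TT q t k f i j)) = TT (φ q) (φ t) k (fun i j => φ (f i j)) := by
  funext i j
  simp only [TT]
  split_ifs <;> simp

/-- Agreement on the pairs `i < j ≤ M`. -/
def Agree (M : ℕ) (f g : ℕ → ℕ → R) : Prop := ∀ i j, i < j → j ≤ M → f i j = g i j

theorem Agree.symm {M : ℕ} {f g : ℕ → ℕ → R} (h : Agree M f g) : Agree M g f :=
  fun i j a b => (h i j a b).symm
theorem Agree.trans {M : ℕ} {f g e : ℕ → ℕ → R} (h : Agree M f g) (h' : Agree M g e) :
    Agree M f e :=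
  fun i j a b => (h i j a b).trans (h' i j a b)

theorem TT_local (q t : R) {M k : ℕ} (hk : k < M) {f g : ℕ → ℕ → R} (h : Agree M f g) :
    Agree M (TT q t k f) (TT q t k g) := by
  intro i j hij hj
  have hs := h k (k+1) (by omega) (by omega)
  unfold TT
  simp only [if_neg (not_le.2 hij)]
  split_ifs with h1 h2 h3 h4 h5 h6
  · rw [hs]
  · rw [hs, h (k+1) j (by omega) hj]
  · rw [h k j (by omega) hj, h (k+1) j (by omega) hj]
  · rw [h i k (by omega) (by omega), h i (k+1) (by omega) (by omega)]
  · rw [hs, h i k (by omega) (by omega)]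
  · rw [hs, h i j hij hj]
  · rw [h i j hij hj]

/-- Operator of a word. -/
def Tw (q t : R) {M : ℕ} (w : List (Fin M)) (f : ℕ → ℕ → R) : ℕ → ℕ → R :=
  w.foldr (fun k f => TT q t k f) f

theorem Tw_append (q t : R) {M : ℕ} (w w' : List (Fin M)) (f : ℕ → ℕ → R) :
    Tw q t (w ++ w') f = Tw q t w (Tw q t w' f) := by
  simp [Tw]
theorem Tw_concat (q t : R) {M : ℕ} (w : List (Fin M)) (k : Fin M) (f : ℕ → ℕ → R) :
    Tw q t (w ++ [k]) f = Tw q t w (TT q t k f) := by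
  simp [Tw]
theorem Tw_cons (q t : R) {M : ℕ} (w : List (Fin M)) (k : Fin M) (f : ℕ → ℕ → R) :
    Tw q t (k :: w) f = TT q t k (Tw q t w f) := by
  simp [Tw]
theorem Tw_add (q t : R) {M : ℕ} (w : List (Fin M)) (f g : ℕ → ℕ → R) :
    Tw q t w (f + g) = Tw q t w f + Tw q t w g := by
  induction w with
  | nil => rfl
  | cons k w ih => simp only [Tw_cons, ih, TT_add]
theorem Tw_smul (q t : R) {M : ℕ} (w : List (Fin M)) (c : R) (f : ℕ → ℕ → R) :
    Tw q t w (c • f) = c • Tw q t w f := by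
  induction w with
  | nil => rfl
  | cons k w ih => simp only [Tw_cons, ih, TT_smul]
theorem Tw_zero (q t : R) {M : ℕ} (w : List (Fin M)) : Tw q t w (0 : ℕ → ℕ → R) = 0 := by
  have := Tw_smul q t w 0 (0 : ℕ → ℕ → R)
  simpa using this
theorem Tw_local (q t : R) {M : ℕ} (w : List (Fin M)) {f g : ℕ → ℕ → R} (h : Agree M f g) :
    Agree M (Tw q t w f) (Tw q t w g) := by
  induction w with
  | nil => exact h
  | cons k w ih => simp only [Tw_cons]; exact TT_local q t k.2 ih
theorem Tw_map {S : Type*} [CommRing S] (φ : R →+* S) (q t : R) {M : ℕ} (w : List (Fin M))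
    (f : ℕ → ℕ → R) :
    (fun i j => φ (Tw q t w f i j)) = Tw (φ q) (φ t) w (fun i j => φ (f i j)) := by
  induction w with
  | nil => rfl
  | cons k w ih => simp only [Tw_cons, ← ih, TT_map]

end ops2

section zero
/-- Vanishing at `t = 0`. -/
def Zr {M : ℕ} (w : List (Fin M)) (f : ℕ → ℕ → ℚ) : Prop := Agree M (Tw (1/2) 0 w f) 0

/-- indicator -/
def dl (a b : ℕ) : ℕ → ℕ → ℚ := fun i j => if i = a ∧ j = b then 1 else 0

theorem dl_nonneg (a b i j : ℕ) : 0 ≤ dl a b i j := by unfold dl; split_ifs <;> norm_num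
theorem dl_self (a b : ℕ) : dl a b a b = 1 := by simp [dl]

theorem TT_nonneg (k : ℕ) {f : ℕ → ℕ → ℚ} (h : ∀ i j, 0 ≤ f i j) (i j : ℕ) :
    0 ≤ TT (1/2) 0 k f i j := by
  have a := h i j
  have b := h k j
  have c := h (k+1) j
  have d := h i k
  have e := h i (k+1)
  unfold TT
  split_ifs <;> norm_num <;> first | assumption | positivity

theorem Tw_nonneg {M : ℕ} (w : List (Fin M)) {f : ℕ → ℕ → ℚ} (h : ∀ i j, 0 ≤ f i j) (i j : ℕ) :
    0 ≤ Tw (1/2) 0 w f i j := by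
  induction w generalizing i j with
  | nil => exact h i j
  | cons k w ih => simp only [Tw_cons]; exact TT_nonneg k ih i j

theorem Zr_mono {M : ℕ} (w : List (Fin M)) {f g : ℕ → ℕ → ℚ} {c : ℚ} (hc : 0 < c)
    (hg : ∀ i j, 0 ≤ g i j) (hfg : ∀ i j, c * g i j ≤ f i j) (hf : Zr w f) : Zr w g := by
  intro i j hij hj
  have h1 := hf i j hij hj
  have h2 : Tw (1/2) 0 w f = Tw (1/2) 0 w (c • g) + Tw (1/2) 0 w (f - c • g) := by
    rw [← Tw_add]; congr 1; abel
  have h3 := Tw_nonneg w (f := f - c • g) (fun i j => by simpa using hfg i j) i j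
  have h4 := Tw_nonneg w hg i j
  rw [h2, Tw_smul] at h1
  simp only [Pi.add_apply, Pi.smul_apply, smul_eq_mul, Pi.zero_apply] at h1 ⊢
  have : c * Tw (1/2) 0 w g i j = 0 := by
    have := mul_nonneg hc.le h4
    linarith
  rcases mul_eq_zero.1 this with h | h
  · exact absurd h hc.ne'
  · exact h

theorem Zr_step {M : ℕ} (w : List (Fin M)) (k : Fin M) {a b a' b' : ℕ}
    (h : Zr (w ++ [k]) (dl a b)) (h' : 1/2 ≤ TT (1/2) 0 k (dl a b) a' b') : Zr w (dl a' b') := by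
  unfold Zr at h
  rw [Tw_concat] at h
  refine Zr_mono (f := TT (1/2) 0 k (dl a b)) w (c := 1/2) (by norm_num) (dl_nonneg _ _) ?_ h
  intro i j
  by_cases hij : i = a' ∧ j = b'
  · obtain ⟨rfl, rfl⟩ := hij
    rw [dl_self]; linarith
  · rw [show dl a' b' i j = 0 by simp [dl, hij]]
    simpa using TT_nonneg k (dl_nonneg a b) i j

theorem Zr_end {M : ℕ} (w : List (Fin M)) (k : Fin M) : Zr (w ++ [k]) (dl k (k+1)) := by
  have : TT (1/2) 0 k (dl k (k+1)) = 0 := by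
    funext i j
    unfold TT dl
    simp only [Pi.zero_apply]
    split_ifs <;> first | omega | norm_num
  unfold Zr
  rw [Tw_concat, this, Tw_zero]
  intro i j _ _; rfl

theorem not_Zr_nil {M a b : ℕ} (h : a < b) (hb : b ≤ M) : ¬ Zr ([] : List (Fin M)) (dl a b) := by
  intro hz
  have := hz a b h hb
  simp [Tw, dl] at this

/- the moves at `t = 0` -/
theorem mv_far {k a b : ℕ} (h : a < b) (h1 : a ≠ k) (h2 : a ≠ k+1) (h3 : b ≠ k) (h4 : b ≠ k+1) :
    1/2 ≤ TT (1/2 : ℚ) 0 k (dl a b) a b := by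
  unfold TT
  rw [if_neg (by omega), if_neg h1, if_neg h2, if_neg h3, if_neg h4]
  split_ifs <;> norm_num [dl_self]
theorem mv1 {k a : ℕ} (h : a < k) : 1/2 ≤ TT (1/2 : ℚ) 0 k (dl a k) a k := by
  rw [TT_jk _ _ _ _ h]; norm_num [dl]
theorem mv2 {k a : ℕ} (h : a < k) : 1/2 ≤ TT (1/2 : ℚ) 0 k (dl a k) a (k+1) := by
  rw [TT_jk1 _ _ _ _ h]; norm_num [dl]
theorem mv3 {k a : ℕ} (h : a < k) : 1/2 ≤ TT (1/2 : ℚ) 0 k (dl a (k+1)) a k := by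
  rw [TT_jk _ _ _ _ h]; norm_num [dl]
theorem mv4 {k b : ℕ} (h : k + 1 < b) : 1/2 ≤ TT (1/2 : ℚ) 0 k (dl (k+1) b) (k+1) b := by
  rw [TT_k1 _ _ _ _ h]; norm_num [dl]
theorem mv5 {k b : ℕ} (h : k + 1 < b) : 1/2 ≤ TT (1/2 : ℚ) 0 k (dl (k+1) b) k b := by
  rw [TT_k _ _ _ _ h]; norm_num [dl]
theorem mv6 {k b : ℕ} (h : k + 1 < b) : 1/2 ≤ TT (1/2 : ℚ) 0 k (dl k b) (k+1) b := by
  rw [TT_k1 _ _ _ _ h]; norm_num [dl]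
end zero

section rep
/-- The representation space. -/
abbrev V (M : ℕ) := {p : Fin (M+1) × Fin (M+1) // p.1 < p.2} → ℂ

/-- Extension by zero. -/
def ext {M : ℕ} (v : V M) : ℕ → ℕ → ℂ := fun i j =>
  if h : i < j ∧ j ≤ M then v ⟨(⟨i, by omega⟩, ⟨j, by omega⟩), h.1⟩ else 0
/-- Restriction. -/
def res {M : ℕ} (f : ℕ → ℕ → ℂ) : V M := fun p => f p.1.1 p.1.2

theorem ext_res {M : ℕ} (f : ℕ → ℕ → ℂ) : Agree M (ext (res f : V M)) f := by
  intro i j h1 h2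
  simp [ext, res, h1, h2]
theorem ext_add {M : ℕ} (v w : V M) : ext (v + w) = ext v + ext w := by
  funext i j; simp only [ext, Pi.add_apply]; split_ifs <;> simp
theorem ext_smul {M : ℕ} (c : ℂ) (v : V M) : ext (c • v) = c • ext v := by
  funext i j; simp only [ext, Pi.smul_apply]; split_ifs <;> simp
theorem ext_inj {M : ℕ} {v w : V M} (h : Agree M (ext v) (ext w)) : v = w := by
  funext ⟨⟨⟨i, hi⟩, ⟨j, hj⟩⟩, hij⟩
  have hij' : i < j := hij
  have := h i j hij' (by omega)
  simpa [ext, hij', show j ≤ M by omega] using this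

/-- The operator on the finite-dimensional space. -/
noncomputable def Lk (t : ℂ) {M : ℕ} (k : ℕ) : V M →ₗ[ℂ] V M where
  toFun v := res (TT (1/2) t k (ext v))
  map_add' v w := by rw [ext_add, TT_add]; rfl
  map_smul' c v := by rw [ext_smul, TT_smul]; rfl

theorem ext_Lk (t : ℂ) {M : ℕ} (k : ℕ) (v : V M) :
    Agree M (ext (Lk t k v)) (TT (1/2) t k (ext v)) :=
  ext_res (M := M) (TT (1/2) t k (ext v))

theorem TT_inj {t : ℂ} (ht : t ≠ 0) {M k : ℕ} (hk : k < M) {f : ℕ → ℕ → ℂ}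
    (h : Agree M (TT (1/2) t k f) 0) : Agree M f 0 := by
  have h0 : f k (k+1) = 0 := by
    have := h k (k+1) (by omega) (by omega)
    rw [TT_root] at this
    simpa [ht] using this
  intro i j hij hj
  simp only [Pi.zero_apply]
  have hcase : (i = k ∧ j = k+1) ∨ (i = k ∧ k + 1 < j) ∨ (i = k+1) ∨ (i < k ∧ j = k) ∨
    (i < k ∧ j = k+1) ∨ (i < k ∧ k + 1 < j) ∨ j < k ∨ k + 1 < i := by omega
  rcases hcase with ⟨rfl, rfl⟩ | ⟨rfl, h1⟩ | rfl | ⟨h1, rfl⟩ | ⟨h1, rfl⟩ | ⟨h1, h2⟩ | h1 | h1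
  · exact h0
  · have e1 := h i j hij hj
    have e2 := h (i+1) j h1 hj
    rw [TT_k _ _ _ _ h1] at e1
    rw [TT_k1 _ _ _ _ h1] at e2
    simp only [h0, Pi.zero_apply] at e1 e2
    linear_combination 2 * e2 - e1
  · have e1 := h k j (by omega) hj
    rw [TT_k _ _ _ _ hij, h0] at e1
    simpa using e1
  · have e1 := h i (j+1) (by omega) (by omega)
    rw [TT_jk1 _ _ _ _ h1, h0] at e1
    simpa using e1
  · have e1 := h i (k+1) (by omega) (by omega)
    have e2 := h i k (by omega) (by omega)
    rw [TT_jk1 _ _ _ _ h1] at e1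
    rw [TT_jk _ _ _ _ h1] at e2
    simp only [h0, Pi.zero_apply] at e1 e2
    linear_combination 2 * e2 - e1
  · have e1 := h i j hij hj
    rw [TT_mid _ _ _ _ h1 h2, h0] at e1
    simpa using e1
  · have e1 := h i j hij hj
    rw [TT_left _ _ _ _ h1] at e1
    simpa using e1
  · have e1 := h i j hij hj
    rw [TT_right _ _ _ _ h1] at e1
    simpa using e1

theorem ext_zero {M : ℕ} : ext (0 : V M) = 0 := by funext i j; simp [ext]

theorem Lk_inj {t : ℂ} (ht : t ≠ 0) {M k : ℕ} (hk : k < M) :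
    Function.Injective (Lk t k : V M →ₗ[ℂ] V M) := by
  rw [← LinearMap.ker_eq_bot, LinearMap.ker_eq_bot']
  intro v hv
  apply ext_inj
  rw [ext_zero]
  apply TT_inj ht hk
  have := ext_Lk t k v
  rw [hv, ext_zero] at this
  exact this.symm

/-- The generator as an automorphism. -/
noncomputable def Le (t : ℂ) (ht : t ≠ 0) {M : ℕ} (k : ℕ) : V M ≃ₗ[ℂ] V M :=
  if hk : k < M then LinearEquiv.ofInjectiveEndo (Lk t k) (Lk_inj ht hk) else 1

theorem Le_apply {t : ℂ} (ht : t ≠ 0) {M k : ℕ} (hk : k < M) (v : V M) :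
    Le t ht k v = Lk t k v := by
  simp [Le, hk]

theorem ext_Le {t : ℂ} (ht : t ≠ 0) {M k : ℕ} (hk : k < M) (v : V M) :
    Agree M (ext (Le t ht k v)) (TT (1/2) t k (ext v)) := by
  rw [Le_apply ht hk]; exact ext_Lk t k v

theorem Le_BR {t : ℂ} (ht : t ≠ 0) (M : ℕ) : BR (fun k => (Le t ht k : V M ≃ₗ[ℂ] V M)) M := by
  constructor
  · intro i j hij hj
    ext1 v
    apply ext_inj
    simp only [LinearEquiv.mul_apply]
    have a := (ext_Le ht (M := M) (k := i) (by omega) (Le t ht j v)).trans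
      (TT_local _ _ (by omega) (ext_Le ht hj v))
    have b := (ext_Le ht (M := M) (k := j) (by omega) (Le t ht i v)).trans
      (TT_local _ _ (by omega) (ext_Le ht (by omega) v))
    rw [TT_comm _ _ _ _ hij] at a
    exact a.trans b.symm
  · intro i hi
    ext1 v
    apply ext_inj
    simp only [LinearEquiv.mul_apply]
    have three : ∀ a b c : ℕ, a < M → b < M → c < M →
        Agree M (ext (Le t ht a (Le t ht b (Le t ht c v))))
          (TT (1/2) t a (TT (1/2) t b (TT (1/2) t c (ext v)))) := fun a b c ha hb hc =>
      (ext_Le ht ha _).trans (TT_local _ _ ha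
        ((ext_Le ht hb _).trans (TT_local _ _ hb (ext_Le ht hc v))))
    have a := three i (i+1) i (by omega) (by omega) (by omega)
    rw [TT_braid] at a
    exact a.trans (three (i+1) i (i+1) (by omega) (by omega) (by omega)).symm
end rep
end LK

set_option linter.unusedSectionVars false
namespace LK
section group
/-- braid group on `M` generators -/
abbrev PB (M : ℕ) := PresentedGroup (braidRelsSet M)

/-- generators, extended by `1`. -/
def sB (M : ℕ) (i : ℕ) : PB M := if h : i < M then PresentedGroup.of ⟨i, h⟩ else 1

theorem sB_of {M : ℕ} (i : Fin M) : sB M i = PresentedGroup.of i := by simp [sB]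

theorem of_BR {M : ℕ} {rels : Set (FreeGroup (Fin M))} (hr : braidRelsSet M ⊆ rels) :
    BR (fun i => if h : i < M then (PresentedGroup.of ⟨i, h⟩ : PresentedGroup rels) else 1) M := by
  constructor
  · intro i j hij hj
    have hi : i < M := by omega
    simp only [hi, hj, dif_pos]
    have : (PresentedGroup.mk rels) (FreeGroup.of ⟨i, hi⟩ * FreeGroup.of ⟨j, hj⟩ *
        (FreeGroup.of ⟨i, hi⟩)⁻¹ * (FreeGroup.of ⟨j, hj⟩)⁻¹) = 1 :=
      PresentedGroup.one_of_mem (hr ⟨⟨i, hi⟩, ⟨j, hj⟩, Or.inl ⟨Or.inl hij, rfl⟩⟩)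
    simp only [map_mul, map_inv] at this
    exact eq_of_mul_inv_eq_one (by rw [← this]; simp only [PresentedGroup.of]; group)
  · intro i hj
    have hi : i < M := by omega
    simp only [hi, hj, dif_pos]
    have : (PresentedGroup.mk rels) (FreeGroup.of ⟨i, hi⟩ * FreeGroup.of ⟨i+1, hj⟩ *
        FreeGroup.of ⟨i, hi⟩ * (FreeGroup.of ⟨i+1, hj⟩ * FreeGroup.of ⟨i, hi⟩ *
          FreeGroup.of ⟨i+1, hj⟩)⁻¹) = 1 :=
      PresentedGroup.one_of_mem (hr ⟨⟨i, hi⟩, ⟨i+1, hj⟩, Or.inr ⟨Or.inl rfl, rfl⟩⟩)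
    simp only [map_mul, map_inv] at this
    exact eq_of_mul_inv_eq_one (by rw [← this]; simp only [PresentedGroup.of])

theorem sB_BR (M : ℕ) : BR (sB M) M := of_BR (M := M) (le_refl _)

theorem BR_rels {H : Type*} [Group H] {s : ℕ → H} {M : ℕ} (h : BR s M) :
    ∀ r ∈ braidRelsSet M, FreeGroup.lift (fun i : Fin M => s i) r = 1 := by
  rintro r ⟨i, j, ⟨hij, rfl⟩ | ⟨hij, rfl⟩⟩
  · have := (h.commute hij i.2 j.2).eq
    simp only [map_mul, map_inv, FreeGroup.lift_apply_of]
    rw [this]; group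
  · simp only [map_mul, map_inv, FreeGroup.lift_apply_of]
    rcases hij with hij | hij
    · have := h.braid i (by omega)
      rw [← hij, this]; group
    · have := h.braid j (by omega)
      rw [← hij, this]; group

/-- The homomorphism from the braid group. -/
def bhom {H : Type*} [Group H] {s : ℕ → H} {M : ℕ} (h : BR s M) : PB M →* H :=
  PresentedGroup.toGroup (BR_rels h)

theorem bhom_of {H : Type*} [Group H] {s : ℕ → H} {M : ℕ} (h : BR s M) (i : Fin M) :
    bhom h (PresentedGroup.of i) = s i := PresentedGroup.toGroup.of _

theorem bhom_sB {H : Type*} [Group H] {s : ℕ → H} {M : ℕ} (h : BR s M) {i : ℕ} (hi : i < M) :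
    bhom h (sB M i) = s i := by
  rw [sB_of ⟨i, hi⟩, bhom_of]

theorem map_del {H K : Type*} [Group H] [Group K] (φ : H →* K) {s : ℕ → H} {s' : ℕ → K} {M : ℕ}
    (hs : ∀ i < M, φ (s i) = s' i) {k : ℕ} (hk : k ≤ M) : φ (del s k) = del s' k := by
  induction k with
  | zero => exact map_one φ
  | succ k ih => simp only [del, map_mul, ih (by omega), hs k (by omega)]
theorem map_rev {H K : Type*} [Group H] [Group K] (φ : H →* K) {s : ℕ → H} {s' : ℕ → K} {M : ℕ}
    (hs : ∀ i < M, φ (s i) = s' i) {k : ℕ} (hk : k ≤ M) : φ (rev s k) = rev s' k := by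
  induction k with
  | zero => exact map_one φ
  | succ k ih => simp only [rev, map_mul, ih (by omega), hs k (by omega)]

/-- Value of a positive word. -/
def wd {M : ℕ} (w : List (Fin M)) : PB M := (w.map PresentedGroup.of).prod
theorem wd_append {M : ℕ} (w w' : List (Fin M)) : wd (w ++ w') = wd w * wd w' := by simp [wd]
theorem wd_concat {M : ℕ} (w : List (Fin M)) (k : Fin M) :
    wd (w ++ [k]) = wd w * sB M k := by simp [wd, sB_of]
theorem wd_cons {M : ℕ} (w : List (Fin M)) (k : Fin M) :
    wd (k :: w) = sB M k * wd w := by simp [wd, sB_of]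
theorem wd_nil {M : ℕ} : wd ([] : List (Fin M)) = 1 := rfl

/-- The representation. -/
noncomputable def rep {t : ℂ} (ht : t ≠ 0) (M : ℕ) : PB M →* (V M ≃ₗ[ℂ] V M) := bhom (Le_BR ht M)

theorem rep_sB {t : ℂ} (ht : t ≠ 0) {M k : ℕ} (hk : k < M) : rep ht M (sB M k) = Le t ht k :=
  bhom_sB (Le_BR ht M) hk

theorem rep_word {t : ℂ} (ht : t ≠ 0) {M : ℕ} (w : List (Fin M)) (v : V M) :
    Agree M (ext (rep ht M (wd w) v)) (Tw (1/2) t w (ext v)) := by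
  induction w with
  | nil => intro i j _ _; simp [wd_nil, Tw]
  | cons k w ih =>
    rw [wd_cons, map_mul, rep_sB ht k.2, Tw_cons, LinearEquiv.mul_apply]
    exact (ext_Le ht k.2 _).trans (TT_local _ _ k.2 ih)

theorem exists_transcendental : ∃ t : ℂ, Transcendental ℚ t := by
  have h1 : Transcendental ℤ (liouvilleNumber (2 : ℕ)) := transcendental_liouvilleNumber le_rfl
  refine ⟨((liouvilleNumber (2 : ℕ) : ℝ) : ℂ), ?_⟩
  intro h
  apply h1
  rw [IsFractionRing.isAlgebraic_iff ℤ ℚ ℝ]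
  exact (isAlgebraic_algebraMap_iff (R := ℚ) (S := ℝ) (A := ℂ) (algebraMap ℝ ℂ).injective).1 h

theorem trans_ne {t : ℂ} (ht : Transcendental ℚ t) (c : ℚ) : t ≠ c := by
  rintro rfl
  exact ht (isAlgebraic_algebraMap (R := ℚ) (A := ℂ) c)

theorem transfer {t : ℂ} (ht : Transcendental ℚ t) {ht0 : t ≠ 0} {M : ℕ} {w w' : List (Fin M)}
    (h : rep ht0 M (wd w) = rep ht0 M (wd w')) (f : ℕ → ℕ → ℚ) :
    Agree M (Tw (1/2) 0 w f) (Tw (1/2) 0 w' f) := by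
  have h1 : ∀ F : ℕ → ℕ → ℂ, Agree M (Tw (1/2) t w F) (Tw (1/2) t w' F) := by
    intro F
    have a := rep_word ht0 w (res F)
    rw [h] at a
    have b := a.symm.trans (rep_word ht0 w' (res F))
    exact (Tw_local _ _ w (ext_res F)).symm.trans (b.trans (Tw_local _ _ w' (ext_res F)))
  have m1 : ∀ u : List (Fin M), ∀ i j, Tw (1/2) t u (fun i j => (algebraMap ℚ ℂ (f i j))) i j =
      Polynomial.aeval t
        (Tw (Polynomial.C (1/2)) Polynomial.X u (fun i j => Polynomial.C (f i j)) i j) := by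
    intro u i j
    have := Tw_map (Polynomial.aeval (R := ℚ) t).toRingHom (Polynomial.C (1/2)) Polynomial.X u
      (fun i j => Polynomial.C (f i j))
    have := congrFun (congrFun this i) j
    simp only [AlgHom.toRingHom_eq_coe, RingHom.coe_coe, Polynomial.aeval_C, Polynomial.aeval_X]
      at this
    rw [this]
    norm_num
  have m2 : ∀ u : List (Fin M), ∀ i j, Tw (1/2) 0 u f i j =
      Polynomial.evalRingHom 0
        (Tw (Polynomial.C (1/2)) Polynomial.X u (fun i j => Polynomial.C (f i j)) i j) := by
    intro u i j
    have := Tw_map (Polynomial.evalRingHom (0 : ℚ)) (Polynomial.C (1/2)) Polynomial.X u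
      (fun i j => Polynomial.C (f i j))
    have := congrFun (congrFun this i) j
    rw [this]
    simp
  intro i j hij hj
  have e := h1 (fun i j => (algebraMap ℚ ℂ (f i j))) i j hij hj
  rw [m1, m1] at e
  rw [m2, m2, (transcendental_iff_injective.1 ht) e]

theorem Zr_congr {M : ℕ} {w w' : List (Fin M)} (h : wd w = wd w') {f : ℕ → ℕ → ℚ}
    (hz : Zr w f) : Zr w' f := by
  obtain ⟨t, ht⟩ := exists_transcendental
  have ht0 : t ≠ 0 := by simpa using trans_ne ht 0
  exact (transfer ht (ht0 := ht0) (by rw [h]) f).symm.trans hz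

/-- Key lemma: right divisors can be read off at `t = 0`. -/
theorem key {M : ℕ} (l : ℕ) : ∀ (w : List (Fin M)) (s : Fin M), w.length = l →
    Zr w (dl s (s+1)) → ∃ w' : List (Fin M), wd w = wd w' * sB M s ∧ w.length = w'.length + 1 := by
  induction l using Nat.strong_induction_on with
  | _ l ih =>
    intro w s hl hz
    rcases List.eq_nil_or_concat' w with rfl | ⟨w, r, rfl⟩
    · exact absurd hz (not_Zr_nil (by omega) (by omega))
    have hl' : w.length < l := by simp at hl; omega
    by_cases hrs : r = s
    · subst hrs
      exact ⟨w, wd_concat _ _, by simp⟩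
    have hrs' : (r : ℕ) ≠ s := fun h => hrs (Fin.ext h)
    have hb := sB_BR M
    by_cases hfar : (r : ℕ) + 2 ≤ s ∨ (s : ℕ) + 2 ≤ r
    · have z1 := Zr_step w r hz (mv_far (by omega) (by omega) (by omega) (by omega) (by omega))
      obtain ⟨w', e1, e2⟩ := ih _ hl' w s rfl z1
      refine ⟨w' ++ [r], ?_, by simp [e2]⟩
      rw [wd_concat, wd_concat, e1, mul_assoc, mul_assoc,
        (hb.commute hfar r.2 s.2).eq]
    have adj : (r : ℕ) = s + 1 ∨ (s : ℕ) = r + 1 := by omega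
    -- in both cases
    have main : (∃ a b : ℕ, Zr w (dl s (s+1)) ∧ Zr w (dl a b) ∧
        1/2 ≤ TT (1/2 : ℚ) 0 s (dl a b) r (r+1)) ∧
        sB M r * sB M s * sB M r = sB M s * sB M r * sB M s := by
      rcases adj with h | h
      · refine ⟨⟨s, s+2, ?_, ?_, ?_⟩, ?_⟩
        · refine Zr_step w r hz ?_
          have := mv1 (k := r) (a := s) (by omega)
          rwa [h] at this ⊢
        · refine Zr_step w r hz ?_
          have := mv2 (k := r) (a := s) (by omega)
          rwa [h] at this ⊢
        · have := mv6 (k := s) (b := s+2) (by omega)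
          rwa [h]
        · rw [h]; exact (hb.braid s (by omega)).symm
      · refine ⟨⟨r, r+2, ?_, ?_, ?_⟩, ?_⟩
        · refine Zr_step w r hz ?_
          have := mv4 (k := r) (b := r+2) (by omega)
          rwa [h]
        · refine Zr_step w r hz ?_
          have := mv5 (k := r) (b := r+2) (by omega)
          rwa [h]
        · have := mv3 (k := s) (a := r) (by omega)
          rwa [h] at this ⊢
        · rw [h]; exact (hb.braid r (by omega))
    obtain ⟨⟨a, b, z1, z2, z3⟩, hbr⟩ := main
    obtain ⟨w1, e1, e2⟩ := ih _ hl' w s rfl z1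
    have z4 := Zr_congr (e1.trans (wd_concat w1 s).symm) z2
    have z5 := Zr_step w1 s z4 z3
    obtain ⟨w2, e3, e4⟩ := ih _ (by omega) w1 r rfl z5
    refine ⟨w2 ++ [s] ++ [r], ?_, ?_⟩
    · rw [wd_concat, wd_concat, wd_concat, e1, e3]
      rw [mul_assoc, mul_assoc, ← mul_assoc (sB M r), hbr]
      group
    · simp; omega

theorem faithful_words {t : ℂ} (ht : Transcendental ℚ t) {ht0 : t ≠ 0} {M : ℕ}
    (w w' : List (Fin M)) (h : rep ht0 M (wd w) = rep ht0 M (wd w')) : wd w = wd w' := by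
  generalize hl : w.length = l
  induction l generalizing w w' with
  | zero =>
    obtain rfl := List.length_eq_zero_iff.1 hl
    rcases List.eq_nil_or_concat' w' with rfl | ⟨w', r, rfl⟩
    · rfl
    · have z := (transfer ht h (dl r (r+1))).trans (Zr_end w' r)
      exact absurd z (not_Zr_nil (by omega) (by omega))
  | succ l ih =>
    rcases List.eq_nil_or_concat' w with rfl | ⟨w, r, rfl⟩
    · simp at hl
    have z : Zr w' (dl r (r+1)) := (transfer ht h (dl r (r+1))).symm.trans (Zr_end w r)
    obtain ⟨w1, e1, -⟩ := key _ w' r rfl z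
    rw [wd_concat, e1, map_mul, map_mul] at h
    rw [wd_concat, e1, ih w w1 (mul_right_cancel h) (by simpa using hl)]

theorem del_eq_wd {M k : ℕ} (hk : k ≤ M) : ∃ w : List (Fin M), del (sB M) k = wd w ∧
    ∀ i : Fin M, (i : ℕ) < k → i ∈ w := by
  induction k with
  | zero => exact ⟨[], rfl, fun i hi => by omega⟩
  | succ k ih =>
    obtain ⟨w, e, hw⟩ := ih (by omega)
    refine ⟨w ++ [⟨k, hk⟩], ?_, ?_⟩
    · rw [wd_concat, ← e]; rfl
    · intro i hi
      rcases Nat.lt_or_ge i k with h | h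
      · simp [hw i h]
      · have : i = ⟨k, hk⟩ := Fin.ext (by simp; omega)
        simp [this]

theorem pow_wd {M : ℕ} (w : List (Fin M)) (k : ℕ) : ∃ w', wd w ^ k = wd w' := by
  induction k with
  | zero => exact ⟨[], by simp [wd_nil]⟩
  | succ k ih =>
    obtain ⟨w', e⟩ := ih
    exact ⟨w' ++ w, by rw [pow_succ, e, wd_append]⟩

theorem comm_all {M : ℕ} {x : PB M} (h : ∀ i < M, Commute (sB M i) x) (g : PB M) :
    Commute g x := by
  have hg : g ∈ Subgroup.closure (Set.range (PresentedGroup.of (rels := braidRelsSet M))) := by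
    rw [PresentedGroup.closure_range_of]; trivial
  induction hg using Subgroup.closure_induction with
  | mem y hy => obtain ⟨i, rfl⟩ := hy; rw [← sB_of]; exact h i i.2
  | one => exact Commute.one_left _
  | mul a b _ _ ha hb => exact ha.mul_left hb
  | inv a _ ha => exact ha.inv_left

/-- The full twist in the braid group. -/
def zz (M : ℕ) : PB M := tw (sB M) M

theorem zz_central {M : ℕ} (g : PB M) : Commute g (zz M) :=
  comm_all (fun _ hi => (sB_BR M).comm_tw hi le_rfl) g

theorem zz_div {M : ℕ} (i : Fin M) : ∃ w, zz M = wd w * sB M i := by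
  obtain ⟨w, e, hw⟩ := del_eq_wd (le_refl M)
  obtain ⟨a, b, rfl⟩ := List.append_of_mem (hw i i.2)
  obtain ⟨w', e'⟩ := pow_wd (a ++ i :: b) M
  refine ⟨b ++ w' ++ a, ?_⟩
  have h1 : zz M = wd w' * wd a * sB M i * wd b := by
    rw [← e']
    unfold zz tw
    rw [e, pow_succ, wd_append, wd_cons]
    group
  have h2 := (zz_central (wd b)).eq
  have : zz M = wd b * zz M * (wd b)⁻¹ := by rw [h2]; group
  rw [this, h1, wd_append, wd_append]
  group

theorem pos_form {M : ℕ} (g : PB M) : ∃ (k : ℕ) (w : List (Fin M)), zz M ^ k * g = wd w := by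
  have hg : g ∈ Subgroup.closure (Set.range (PresentedGroup.of (rels := braidRelsSet M))) := by
    rw [PresentedGroup.closure_range_of]; trivial
  induction hg using Subgroup.closure_induction_right with
  | one => exact ⟨0, [], by simp [wd_nil]⟩
  | mul_right x hx y hy ih =>
    obtain ⟨i, rfl⟩ := hy
    obtain ⟨k, w, e⟩ := ih
    exact ⟨k, w ++ [i], by rw [wd_concat, ← e, sB_of]; group⟩
  | mul_inv_cancel x hx y hy ih =>
    obtain ⟨i, rfl⟩ := hy
    obtain ⟨k, w, e⟩ := ih
    obtain ⟨u, hu⟩ := zz_div i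
    refine ⟨k+1, w ++ u, ?_⟩
    have c := (zz_central x).eq
    have : wd u = zz M * (sB M i)⁻¹ := by rw [hu]; group
    rw [wd_append, ← e, this, ← sB_of, pow_succ, mul_assoc, mul_assoc,
      ← mul_assoc (zz M) x, ← c, mul_assoc x]

theorem faithful {t : ℂ} (ht : Transcendental ℚ t) {ht0 : t ≠ 0} {M : ℕ} {g g' : PB M}
    (h : rep ht0 M g = rep ht0 M g') : g = g' := by
  obtain ⟨k, w, e⟩ := pos_form (g'⁻¹ * g)
  have hz : ∃ u, zz M ^ k = wd u := by
    obtain ⟨w, e, -⟩ := del_eq_wd (le_refl M)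
    unfold zz tw
    rw [e, ← pow_mul]
    exact pow_wd _ _
  obtain ⟨u, hu⟩ := hz
  have h1 : rep ht0 M (wd w) = rep ht0 M (wd u) := by
    rw [← e, ← hu, map_mul, map_mul, map_inv, h]; group
  have h2 := faithful_words ht _ _ h1
  rw [← e, ← hu] at h2
  have h3 : g'⁻¹ * g = 1 := mul_eq_left.1 h2
  exact (inv_mul_eq_one.1 h3).symm

/- stripping the half twist -/
theorem strip_rev {M m : ℕ} (hm : m + 1 ≤ M) (w : List (Fin M))
    (hz : ∀ i j, i < j → j ≤ m + 1 → Zr w (dl i j)) (k : ℕ) (hk : k ≤ m + 1) :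
    ∃ w' : List (Fin M), wd w = wd w' * rev (sB M) k ∧ w'.length + k = w.length ∧
      ∀ i j, i < j → j ≤ m + 1 → j ≠ k → Zr w' (dl i j) := by
  induction k with
  | zero => exact ⟨w, by simp [rev], rfl, fun i j h1 h2 _ => hz i j h1 h2⟩
  | succ k ih =>
    obtain ⟨w1, e1, e2, h1⟩ := ih (by omega)
    let K : Fin M := ⟨k, by omega⟩
    obtain ⟨w2, e3, e4⟩ := key _ w1 K rfl (h1 k (k+1) (by omega) (by omega) (by omega))
    refine ⟨w2, ?_, by omega, ?_⟩
    · rw [e1, e3, mul_assoc]; rfl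
    have st : ∀ a b a' b', a < b → b ≤ m+1 → b ≠ k → 1/2 ≤ TT (1/2 : ℚ) 0 k (dl a b) a' b' →
        Zr w2 (dl a' b') := fun a b a' b' ha hb hc hd =>
      Zr_step w2 K (Zr_congr (e3.trans (wd_concat w2 K).symm) (h1 a b ha hb hc)) hd
    intro i j hij hj hjk
    by_cases c1 : j = k
    · subst c1
      exact st i (j+1) i j (by omega) (by omega) (by omega) (mv3 hij)
    by_cases c2 : i = k
    · subst c2
      exact st (i+1) j i j (by omega) (by omega) (by omega) (mv5 (by omega))
    by_cases c3 : i = k+1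
    · subst c3
      exact st k j (k+1) j (by omega) (by omega) (by omega) (mv6 (by omega))
    exact st i j i j hij hj c1 (mv_far hij c2 c3 c1 hjk)

theorem strip_Dl {M m : ℕ} (hm : m ≤ M) (w : List (Fin M))
    (hz : ∀ i j, i < j → j ≤ m → Zr w (dl i j)) :
    ∃ w' : List (Fin M), wd w = wd w' * Dl (sB M) m ∧ w'.length + m ≤ w.length := by
  induction m generalizing w with
  | zero => exact ⟨w, by simp [Dl], by simp⟩
  | succ m ih =>
    obtain ⟨w1, e1, e2, h1⟩ := strip_rev hm w hz (m+1) le_rfl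
    obtain ⟨w2, e3, e4⟩ := ih (by omega) w1 (fun i j a b => h1 i j a (by omega) (by omega))
    refine ⟨w2, ?_, by omega⟩
    rw [e1, e3, mul_assoc]; rfl

theorem quasi_all {M : ℕ} (w : List (Fin M))
    (hq : ∀ r < M, ∃ r' < M, wd w * sB M r = sB M r' * wd w)
    (hw : w ≠ []) : ∀ i j, i < j → j ≤ M → Zr w (dl i j) := by
  have st : ∀ k < M, ∀ a b a' b', Zr w (dl a b) → 1/2 ≤ TT (1/2 : ℚ) 0 k (dl a b) a' b' →
      Zr w (dl a' b') := by
    intro k hk a b a' b' h1 h2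
    obtain ⟨r', hr', e⟩ := hq k hk
    refine Zr_step w ⟨k, hk⟩ (Zr_congr (w := ⟨r', hr'⟩ :: w) ?_ ?_) h2
    · rw [wd_cons, wd_concat, e]
    · unfold Zr
      rw [Tw_cons]
      have := TT_local (1/2) 0 hr' h1
      refine this.trans ?_
      have h0 := Tw_zero (1/2 : ℚ) 0 [(⟨r', hr'⟩ : Fin M)]
      rw [Tw_cons] at h0
      intro i j _ _
      exact congrFun (congrFun h0 i) j
  have down : ∀ a, ∀ b, a < b → b ≤ M → Zr w (dl a b) → Zr w (dl 0 b) := by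
    intro a
    induction a with
    | zero => intro b _ _ h; exact h
    | succ a ih =>
      intro b h1 h2 h3
      exact ih b (by omega) h2 (st a (by omega) _ _ _ _ h3 (mv5 h1))
  have down2 : ∀ b, 0 < b → b ≤ M → Zr w (dl 0 b) → Zr w (dl 0 1) := by
    intro b
    induction b with
    | zero => omega
    | succ b ih =>
      intro h1 h2 h3
      rcases Nat.eq_zero_or_pos b with rfl | hb
      · exact h3
      · exact ih hb (by omega) (st b (by omega) _ _ _ _ h3 (mv3 hb))
  have h01 : Zr w (dl 0 1) := by
    rcases List.eq_nil_or_concat' w with rfl | ⟨w', r, rfl⟩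
    · exact absurd rfl hw
    · exact down2 _ (by omega) (by omega) (down r (r+1) (by omega) (by omega) (Zr_end w' r))
  have up : ∀ b, 0 < b → b ≤ M → Zr w (dl 0 b) := by
    intro b
    induction b with
    | zero => omega
    | succ b ih =>
      intro h1 h2
      rcases Nat.eq_zero_or_pos b with rfl | hb
      · exact h01
      · exact st b (by omega) _ _ _ _ (ih hb (by omega)) (mv2 hb)
  intro i
  induction i with
  | zero => exact up
  | succ i ih =>
    intro j h1 h2
    exact st i (by omega) _ _ _ _ (ih j (by omega) h2) (mv6 h1)

theorem sB_ne {M : ℕ} (hM : 2 ≤ M) : sB M 0 ≠ sB M (M-1) := by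
  intro h
  have z : Zr ([] ++ [(⟨0, by omega⟩ : Fin M)]) (dl 0 1) := Zr_end [] (⟨0, by omega⟩ : Fin M)
  have z2 : Zr ([] ++ [(⟨M-1, by omega⟩ : Fin M)]) (dl 0 1) := by
    refine Zr_congr ?_ z
    rw [wd_concat, wd_concat]
    simp only [h]
  refine not_Zr_nil (M := M) (a := 0) (b := 1) (by omega) (by omega) (Zr_step _ _ z2 ?_)
  rcases Nat.lt_or_ge 2 M with h1 | h1
  · exact mv_far (by omega) (by simp; omega) (by simp) (by simp; omega) (by simp; omega)
  · obtain rfl : M = 2 := by omega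
    show (1/2:ℚ) ≤ TT (1/2) 0 1 (dl 0 1) 0 1
    exact mv1 (by omega)

theorem center_words {M : ℕ} (hM : 2 ≤ M) (l : ℕ) : ∀ w : List (Fin M), w.length = l →
    (∀ r < M, wd w * sB M r = sB M r * wd w) → wd w ∈ Subgroup.zpowers (zz M) := by
  induction l using Nat.strong_induction_on with
  | _ l ih =>
    intro w hl hc
    have hb := sB_BR M
    by_cases hw : w = []
    · rw [hw, wd_nil]; exact one_mem _
    obtain ⟨w1, e1, l1⟩ := strip_Dl le_rfl w (quasi_all w (fun r hr => ⟨r, hr, hc r hr⟩) hw)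
    have q1 : ∀ r < M, wd w1 * sB M (M-1-r) = sB M r * wd w1 := by
      intro r hr
      have h1 := hc r hr
      rw [e1, mul_assoc, hb.Dl_shift hr le_rfl, ← mul_assoc, ← mul_assoc] at h1
      exact mul_right_cancel h1
    have q1' : ∀ r < M, wd w1 * sB M r = sB M (M-1-r) * wd w1 := by
      intro r hr
      have := q1 (M-1-r) (by omega)
      rwa [show M - 1 - (M-1-r) = r by omega] at this
    by_cases hw1 : w1 = []
    · have := q1 0 (by omega)
      rw [hw1, wd_nil, one_mul, mul_one, Nat.sub_zero] at this
      exact absurd this.symm (sB_ne hM)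
    obtain ⟨w2, e2, l2⟩ := strip_Dl le_rfl w1
      (quasi_all w1 (fun r hr => ⟨M-1-r, by omega, q1' r hr⟩) hw1)
    have q2 : ∀ r < M, wd w2 * sB M r = sB M r * wd w2 := by
      intro r hr
      have h1 := q1 r hr
      rw [e2, mul_assoc, hb.Dl_shift (by omega) le_rfl,
        show M - 1 - (M-1-r) = r by omega, ← mul_assoc, ← mul_assoc] at h1
      exact mul_right_cancel h1
    have e3 : wd w = wd w2 * zz M := by
      rw [e1, e2, mul_assoc, hb.Dl_sq le_rfl]; rfl
    rw [e3]
    exact mul_mem (ih _ (by omega) w2 rfl q2) (Subgroup.mem_zpowers _)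

theorem center_zz {M : ℕ} (hM : 2 ≤ M) {g : PB M} (hg : ∀ r < M, Commute (sB M r) g) :
    g ∈ Subgroup.zpowers (zz M) := by
  obtain ⟨k, w, e⟩ := pos_form g
  have h1 := center_words hM _ w rfl (fun r hr => by
    rw [← e]
    exact (((zz_central (sB M r)).pow_right k).mul_right (hg r hr)).eq.symm)
  have : g = (zz M ^ k)⁻¹ * wd w := by rw [← e]; group
  rw [this]
  exact mul_mem (inv_mem (pow_mem (Subgroup.mem_zpowers _) _)) h1

/-- Central elements act by scalars. -/
theorem scalar_of_central {t : ℂ} (ht : Transcendental ℚ t) {ht0 : t ≠ 0} {M : ℕ} (hM : 1 ≤ M)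
    {x : PB M} (hx : ∀ r < M, Commute (sB M r) x) :
    ∃ c : ℂ, ∀ v, rep ht0 M x v = c • v := by
  have cm : ∀ k < M, ∀ v, rep ht0 M x (Le t ht0 k v) = Le t ht0 k (rep ht0 M x v) := by
    intro k hk v
    have := congrArg (rep ht0 M) (hx k hk).eq
    rw [map_mul, map_mul, rep_sB ht0 hk] at this
    exact (congrArg (fun e : V M ≃ₗ[ℂ] V M => e v) this).symm
  have root : ∀ v, ext (rep ht0 M x (Le t ht0 0 v)) 0 1 =
      t * (1/2)^2 * ext (rep ht0 M x v) 0 1 := by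
    intro v
    rw [cm 0 hM, ext_Le ht0 hM _ 0 1 (by omega) hM, TT_root _ _ 0]
  -- vectors with vanishing (0,1) coordinate
  have van : ∀ v : V M, ext v 0 1 = 0 → ext (rep ht0 M x v) 0 1 = 0 := by
    intro v hv
    have quad : Le t ht0 0 (Le t ht0 0 v) = (1/2 : ℂ) • Le t ht0 0 v + (1/2 : ℂ) • v := by
      apply ext_inj
      rw [ext_add, ext_smul, ext_smul]
      have a := ext_Le ht0 (k := 0) (M := M) hM v
      have b := (ext_Le ht0 (k := 0) (M := M) hM (Le t ht0 0 v)).trans (TT_local _ _ hM a)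
      refine b.trans ?_
      intro i j hij hj
      simp only [Pi.add_apply, Pi.smul_apply, smul_eq_mul]
      rw [a i j hij hj]
      rcases i with _ | _ | i
      · rcases Nat.lt_or_ge 1 j with h1 | h1
        · rw [TT_k _ _ 0 _ h1, TT_k _ _ 0 _ h1, TT_k1 _ _ 0 _ h1, TT_root _ _ 0]
          simp only [zero_add, hv]
          ring
        · obtain rfl : j = 1 := by omega
          rw [TT_root _ _ 0, TT_root _ _ 0]
          simp only [zero_add, hv]
          ring
      · rw [TT_k1 _ _ 0 _ hij, TT_k1 _ _ 0 _ hij, TT_k _ _ 0 _ hij]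
        simp only [zero_add, hv]
        ring
      · rw [TT_right _ _ 0 _ (by omega), TT_right _ _ 0 _ (by omega)]
        ring
    have e1 := root (Le t ht0 0 v)
    rw [quad, root v, map_add, map_smul, map_smul, ext_add, ext_smul, ext_smul] at e1
    simp only [Pi.add_apply, Pi.smul_apply, smul_eq_mul, root v] at e1
    have e2 : (t - 4) * (t + 2) * ext (rep ht0 M x v) 0 1 = 0 := by
      linear_combination (-16) * e1
    have n1 : t - 4 ≠ 0 := sub_ne_zero.2 (by simpa using trans_ne ht 4)
    have n2 : t + 2 ≠ 0 := by
      intro h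
      exact trans_ne ht (-2) (by push_cast; linear_combination h)
    simpa [n1, n2] using e2
  let e : V M := res (fun i j => if i = 0 ∧ j = 1 then 1 else 0)
  have he : ext e 0 1 = 1 := by
    rw [ext_res _ 0 1 (by omega) hM]; simp
  refine ⟨ext (rep ht0 M x e) 0 1, ?_⟩
  set c := ext (rep ht0 M x e) 0 1 with hc
  have h01 : ∀ v, ext (rep ht0 M x v) 0 1 = c * ext v 0 1 := by
    intro v
    have h1 : v = ext v 0 1 • e + (v - ext v 0 1 • e) := by abel
    have h2 : ext v 0 1 = ext v 0 1 * 1 + ext (v - ext v 0 1 • e) 0 1 := by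
      conv_lhs => rw [h1, ext_add, ext_smul]
      simp [he]
    have h3 := van (v - ext v 0 1 • e) (by linear_combination -h2)
    conv_lhs => rw [h1, map_add, map_smul, ext_add, ext_smul]
    simp only [Pi.add_apply, Pi.smul_apply, smul_eq_mul, h3, ← hc]
    ring
  have mv : ∀ k < M, ∀ i j, i < j → j ≤ M →
      (∀ v, ext (rep ht0 M x v) i j = c * ext v i j) → ∀ v,
      TT (1/2) t k (ext (rep ht0 M x v)) i j = c * TT (1/2) t k (ext v) i j := by
    intro k hk i j hij hj h v
    have := h (Le t ht0 k v)
    rw [cm k hk, ext_Le ht0 hk _ i j hij hj, ext_Le ht0 hk _ i j hij hj] at this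
    exact this
  have h0 : ∀ j, 0 < j → j ≤ M → ∀ v, ext (rep ht0 M x v) 0 j = c * ext v 0 j := by
    intro j
    induction j with
    | zero => omega
    | succ j ih =>
      intro h1 h2
      rcases Nat.eq_zero_or_pos j with rfl | hj
      · exact h01
      · intro v
        have a := ih hj (by omega)
        have b := mv j (by omega) 0 j hj (by omega) a v
        rw [TT_jk _ _ _ _ hj, TT_jk _ _ _ _ hj] at b
        linear_combination 2 * b - a v
  have hall : ∀ i j, i < j → j ≤ M → ∀ v, ext (rep ht0 M x v) i j = c * ext v i j := by
    intro i
    induction i with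
    | zero => exact h0
    | succ i ih =>
      intro j h1 h2 v
      have a := ih (i+1) (by omega) (by omega) v
      have b := mv i (by omega) i j (by omega) h2 (ih j (by omega) h2) v
      rw [TT_k _ _ _ _ h1, TT_k _ _ _ _ h1] at b
      linear_combination b - t * (1/2) * (1/2 - 1) * a
  intro v
  apply ext_inj
  rw [ext_smul]
  intro i j hij hj
  exact hall i j hij hj v

theorem scalar_mem {t : ℂ} (ht : Transcendental ℚ t) {ht0 : t ≠ 0} {M : ℕ} (hM : 2 ≤ M)
    {x : PB M} {c : ℂ} (h : ∀ v, rep ht0 M x v = c • v) : x ∈ Subgroup.zpowers (zz M) := by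
  apply center_zz hM
  intro r hr
  apply faithful ht (ht0 := ht0)
  rw [map_mul, map_mul]
  ext1 v
  rw [LinearEquiv.mul_apply, LinearEquiv.mul_apply, h, h, map_smul]
end group
end LK

set_option linter.unusedSectionVars false
namespace LK
section spherical
variable {G : Type*} [Group G]

/-- The elements `a_j`. -/
def aa (s : ℕ → G) (M : ℕ) : ℕ → G
  | 0 => (del s M * rev s M)⁻¹
  | j+1 => s j * aa s M j * (s j)⁻¹

theorem map_aa {H K : Type*} [Group H] [Group K] (φ : H →* K) {s : ℕ → H} {s' : ℕ → K} {M : ℕ}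
    (hs : ∀ i < M, φ (s i) = s' i) {k : ℕ} (hk : k ≤ M) : φ (aa s M k) = aa s' M k := by
  induction k with
  | zero => simp only [aa, map_inv, map_mul, map_del φ hs (le_refl M), map_rev φ hs (le_refl M)]
  | succ k ih => simp only [aa, map_mul, map_inv, ih (by omega), hs k (by omega)]

theorem aa_conj (s : ℕ → G) (M : ℕ) (j : ℕ) : aa s M j * rev s j = rev s j * aa s M 0 := by
  induction j with
  | zero => simp [rev]
  | succ j ih =>
    simp only [rev]
    rw [mul_assoc (s j), ← ih]
    show s j * aa s M j * (s j)⁻¹ * _ = _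
    group

theorem aa_comm {s : ℕ → G} {M : ℕ} (h : BR s M) {i m : ℕ} (hi : i ≤ M) (hm : m < M) (h1 : m ≠ i)
    (h2 : m + 1 ≠ i) : Commute (s m) (aa s M i) := by
  have h0 : ∀ m, m + 1 < M → Commute (s (m+1)) (aa s M 0) := fun m hm =>
    (h.comm_X hm (le_refl M)).inv_right
  have e : aa s M i = rev s i * aa s M 0 * (rev s i)⁻¹ := by rw [← aa_conj]; group
  rw [e]
  rcases Nat.lt_or_ge m i with h3 | h3
  · have e2 := h.rev_shift (k := i) (i := m) (by omega) hi
    have e3 : s m = rev s i * s (m+1) * (rev s i)⁻¹ := by rw [e2]; group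
    have e4 := h0 m (by omega)
    rw [e3]
    exact (Commute.conj_iff _).2 e4
  · have e2 := h.comm_rev (k := i) (j := m) (by omega) hm
    obtain ⟨m, rfl⟩ : ∃ m', m = m' + 1 := ⟨m - 1, by omega⟩
    exact (e2.mul_right (h0 m hm)).mul_right e2.inv_right

theorem aa_quad {s : ℕ → G} {M : ℕ} (h : BR s M) {i : ℕ} (hi : i < M) :
    aa s M i * s i * aa s M i * s i = s i * aa s M i * s i * aa s M i := by
  induction i with
  | zero =>
    have h0 : ∀ m, m + 1 < M → Commute (s (m+1)) (aa s M 0) := fun m hm =>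
      (h.comm_X hm (le_refl M)).inv_right
    have c1 : ∀ k, k + 1 ≤ M → Commute ((s 0)⁻¹ * del s (k+1)) (aa s M 0) := by
      intro k
      induction k with
      | zero => intro _; simp [del]
      | succ k ih =>
        intro hk
        have := (ih (by omega)).mul_left (h0 k (by omega))
        rw [mul_assoc] at this
        exact this
    have c2 : ∀ k, k + 1 ≤ M → Commute (rev s (k+1) * (s 0)⁻¹) (aa s M 0) := by
      intro k
      induction k with
      | zero => intro _; simp [rev]
      | succ k ih =>
        intro hk
        have := (h0 k (by omega)).mul_left (ih (by omega))
        rw [← mul_assoc] at this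
        exact this
    obtain ⟨k, rfl⟩ : ∃ k, M = k + 1 := ⟨M - 1, by omega⟩
    have c3 := ((c1 k le_rfl).mul_left (c2 k le_rfl)).inv_left
    have e : ((s 0)⁻¹ * del s (k+1) * (rev s (k+1) * (s 0)⁻¹))⁻¹ = s 0 * aa s (k+1) 0 * s 0 := by
      simp only [aa]; group
    rw [e] at c3
    have := c3.eq
    rw [this]; group
  | succ i ih =>
    have e := ih (by omega)
    have c := (aa_comm h (i := i) (m := i+1) (by omega) hi (by omega) (by omega)).eq
    have b := h.braid i hi
    have e1 : aa s M (i+1) = (s i * s (i+1)) * aa s M i * (s i * s (i+1))⁻¹ := by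
      rw [mul_assoc (s i), c]
      show s i * aa s M i * (s i)⁻¹ = _
      group
    have e2 : s (i+1) = (s i * s (i+1)) * s i * (s i * s (i+1))⁻¹ := by
      rw [b]; group
    generalize s i * s (i+1) = u at e1 e2
    rw [e1, e2]
    calc _ = u * (aa s M i * s i * aa s M i * s i) * u⁻¹ := by group
      _ = u * (s i * aa s M i * s i * aa s M i) * u⁻¹ := by rw [e]
      _ = _ := by group

theorem aa_pair {s : ℕ → G} {M : ℕ} (h : BR s M) {i : ℕ} (hi : i < M) :
    Commute (s i) (aa s M i * aa s M (i+1)) := by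
  have := aa_quad h hi
  show s i * (aa s M i * (s i * aa s M i * (s i)⁻¹)) = aa s M i * (s i * aa s M i * (s i)⁻¹) * s i
  calc _ = s i * aa s M i * s i * aa s M i * (s i)⁻¹ := by group
    _ = _ := by rw [← this]; group

theorem aa_central {s : ℕ → G} {M : ℕ} (h : BR s M) {m : ℕ} (hm : m < M) :
    Commute (s m) (del (aa s M) (M+1)) := by
  have c1 : ∀ k, k ≤ m → Commute (s m) (del (aa s M) k) := by
    intro k
    induction k with
    | zero => intro _; exact Commute.one_right _
    | succ k ih =>
      intro hk
      exact (ih (by omega)).mul_right (aa_comm h (by omega) hm (by omega) (by omega))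
  have c2 : ∀ r, m + 2 + r ≤ M + 1 → Commute (s m) (del (aa s M) (m + 2 + r)) := by
    intro r
    induction r with
    | zero =>
      intro _
      have := (c1 m le_rfl).mul_right (aa_pair h hm)
      rw [← mul_assoc] at this
      exact this
    | succ r ih =>
      intro hr
      exact (ih (by omega)).mul_right (aa_comm (i := m + 2 + r) h (by omega) hm (by omega) (by omega))
  have := c2 (M - 1 - m) (by omega)
  rwa [show m + 2 + (M - 1 - m) = M + 1 by omega] at this
end spherical

section sphgroup
variable {H : Type*} [Group H]

/-- `t_M ⋯ t_j` -/
def tau (t : ℕ → H) (M j : ℕ) : H := rev t (M+1) * (rev t j)⁻¹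

/-- the coset action on points -/
def pt (i j : ℕ) : ℕ := if j = i then i + 1 else if j = i + 1 then i else j
/-- the coset cocycle -/
def gg {G : Type*} [Group G] (s : ℕ → G) (M i j : ℕ) : G :=
  if i + 1 < j then s i else if i + 1 = j then 1 else if i = j then aa s M j else s (i-1)

theorem BR.mono {s : ℕ → H} {M N : ℕ} (h : BR s N) (hM : M ≤ N) : BR s M :=
  ⟨fun i j hij hj => h.comm i j hij (by omega), fun i hi => h.braid i (by omega)⟩

theorem tau_base {t : ℕ → H} {M : ℕ} (h : BR t (M+1)) (h1 : del t (M+1) * rev t (M+1) = 1)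
    (h2 : del t (M+1) ^ (M+2) = 1) : rev t (M+1) * (t 0 * t 0) = aa t M 0 * rev t (M+1) := by
  have e := h.del_pow_shift (k := M+1) (i := 0) (m := M) (by omega) le_rfl
  have hr : rev t (M+1) = (del t (M+1))⁻¹ := eq_inv_of_mul_eq_one_right h1
  have ha : aa t M 0 = del t (M+1) * (t M * t M) * (del t (M+1))⁻¹ := by
    have e1 : del t M = del t (M+1) * (t M)⁻¹ := by simp [del]
    have e2 : rev t M = (t M)⁻¹ * rev t (M+1) := by simp [rev]
    simp only [aa]
    rw [e1, e2, hr]; simp only [mul_inv_rev, inv_inv, mul_assoc]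
  rw [ha, hr]
  set d := del t (M+1)
  rw [zero_add] at e
  have e5 : d ^ M = (d * d)⁻¹ := by
    rw [pow_add] at h2
    rw [eq_inv_iff_mul_eq_one, ← h2, pow_two]
  rw [e5] at e
  have e6 : t M = (d*d)⁻¹ * t 0 * (d*d) := by rw [e]; group
  rw [e6]; group

theorem tau_diag {t : ℕ → H} {M : ℕ} (h : BR t (M+1)) (h1 : del t (M+1) * rev t (M+1) = 1)
    (h2 : del t (M+1) ^ (M+2) = 1) {j : ℕ} (hj : j ≤ M) :
    rev t (M+1) * ((rev t j)⁻¹ * (t j * t j) * rev t j) = aa t M j * rev t (M+1) := by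
  induction j with
  | zero => simpa [rev] using tau_base h h1 h2
  | succ j ih =>
    have e := ih (by omega)
    have b := h.braid j (by omega)
    have c := (h.comm_rev (k := j) (j := j+1) (by omega) (by omega))
    have sh := h.rev_shift (k := M+1) (i := j) (by omega) le_rfl
    have e1 : (t j)⁻¹ * (t (j+1) * t (j+1)) * t j = t (j+1) * (t j * t j) * (t (j+1))⁻¹ := by
      have b2 : (t j)⁻¹ * t (j+1) * t j = t (j+1) * t j * (t (j+1))⁻¹ := by
        calc _ = (t j)⁻¹ * (t (j+1) * t j * t (j+1)) * (t (j+1))⁻¹ := by group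
          _ = _ := by rw [← b]; group
      calc _ = ((t j)⁻¹ * t (j+1) * t j) * ((t j)⁻¹ * t (j+1) * t j) := by group
        _ = _ := by rw [b2]; group
    have e2 : (rev t j)⁻¹ * (t (j+1) * (t j * t j) * (t (j+1))⁻¹) * rev t j =
        t (j+1) * ((rev t j)⁻¹ * (t j * t j) * rev t j) * (t (j+1))⁻¹ := by
      have c1 := c.inv_right.eq
      have c2 := c.inv_left.eq
      calc _ = ((rev t j)⁻¹ * t (j+1)) * (t j * t j) * ((t (j+1))⁻¹ * rev t j) := by group
        _ = _ := by rw [← c1, c2]; group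
    calc rev t (M+1) * ((rev t (j+1))⁻¹ * (t (j+1) * t (j+1)) * rev t (j+1))
        = rev t (M+1) * ((rev t j)⁻¹ * ((t j)⁻¹ * (t (j+1) * t (j+1)) * t j) * rev t j) := by
          simp only [rev]; group
      _ = (rev t (M+1) * t (j+1)) * ((rev t j)⁻¹ * (t j * t j) * rev t j) * (t (j+1))⁻¹ := by
          rw [e1, e2]; group
      _ = t j * (rev t (M+1) * ((rev t j)⁻¹ * (t j * t j) * rev t j)) * (t (j+1))⁻¹ := by
          rw [sh]; group
      _ = t j * aa t M j * (rev t (M+1) * (t (j+1))⁻¹) := by rw [e]; group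
      _ = _ := by
        have : rev t (M+1) * (t (j+1))⁻¹ = (t j)⁻¹ * rev t (M+1) := by
          rw [mul_inv_eq_iff_eq_mul, mul_assoc, sh]; group
        rw [this]; simp only [aa]; group

theorem tau_step {t : ℕ → H} {M : ℕ} (h : BR t (M+1)) (h1 : del t (M+1) * rev t (M+1) = 1)
    (h2 : del t (M+1) ^ (M+2) = 1) {i j : ℕ} (hi : i ≤ M) (hj : j ≤ M + 1) :
    tau t M j * t i = gg t M i j * tau t M (pt i j) := by
  unfold tau
  rcases Nat.lt_trichotomy (i+1) j with h3 | h3 | h3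
  · have e1 := h.rev_shift h3 hj
    have e2 := h.rev_shift (k := M+1) (i := i) (by omega) le_rfl
    rw [gg, if_pos h3, pt, if_neg (by omega), if_neg (by omega)]
    calc _ = rev t (M+1) * ((rev t j)⁻¹ * (t i * rev t j)) * (rev t j)⁻¹ := by group
      _ = (rev t (M+1) * t (i+1)) * (rev t j)⁻¹ := by rw [← e1]; group
      _ = _ := by rw [e2]; group
  · subst h3
    rw [gg, if_neg (by omega), if_pos rfl, pt, if_neg (by omega), if_pos rfl]
    simp only [rev]; group
  · rcases Nat.lt_or_ge j i with h4 | h4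
    · obtain ⟨i, rfl⟩ : ∃ k, i = k + 1 := ⟨i - 1, by omega⟩
      rw [gg, if_neg (by omega), if_neg (by omega), if_neg (by omega), pt, if_neg (by omega),
        if_neg (by omega), Nat.add_sub_cancel]
      have c := (h.comm_rev (k := j) (j := i+1) (by omega) (by omega)).inv_right.eq
      have e2 := h.rev_shift (k := M+1) (i := i) (by omega) le_rfl
      rw [mul_assoc, ← c, ← mul_assoc, e2, mul_assoc]
    · obtain rfl : i = j := by omega
      rw [gg, if_neg (by omega), if_neg (by omega), if_pos rfl, pt, if_pos rfl]
      have := tau_diag h h1 h2 hi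
      calc _ = rev t (M+1) * ((rev t i)⁻¹ * (t i * t i) * rev t i) * (rev t (i+1))⁻¹ := by
            simp only [rev]; group
        _ = _ := by rw [this]; group
end sphgroup
end LK

set_option linter.unusedSectionVars false
namespace LK
theorem pt_pt (i j : ℕ) : pt i (pt i j) = j := by
  unfold pt; split_ifs <;> omega
theorem pt_lt {M i j : ℕ} (hi : i ≤ M) (hj : j < M + 2) : pt i j < M + 2 := by
  unfold pt; split_ifs <;> omega

section ops
variable {G : Type*} [Group G] {W : Type*} [AddCommGroup W] [Module ℂ W]

/-- permutation of the points -/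
def pf (M i : ℕ) (j : Fin (M+2)) : Fin (M+2) :=
  if h : i ≤ M then ⟨pt i j, pt_lt h j.2⟩ else j

theorem pf_pf (M i : ℕ) (j : Fin (M+2)) : pf M i (pf M i j) = j := by
  unfold pf
  split_ifs with h
  · ext; simp [pt_pt]
  · rfl

/-- the monomial operators -/
def Sop (s : ℕ → G) (M : ℕ) (ρ : G →* (W ≃ₗ[ℂ] W)) (i : ℕ) :
    (Fin (M+2) → W) ≃ₗ[ℂ] (Fin (M+2) → W) where
  toFun F j := ρ (gg s M i j) (F (pf M i j))
  invFun F j := (ρ (gg s M i (pf M i j)))⁻¹ (F (pf M i j))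
  map_add' F F' := by ext j; simp
  map_smul' c F := by ext j; simp
  left_inv F := by
    ext j
    simp only [pf_pf]
    rw [← LinearEquiv.mul_apply, inv_mul_cancel]; rfl
  right_inv F := by
    ext j
    simp only [pf_pf]
    rw [← LinearEquiv.mul_apply, mul_inv_cancel]; rfl

/-- extension by zero -/
def eF {M : ℕ} (F : Fin (M+2) → W) (j : ℕ) : W := if h : j < M + 2 then F ⟨j, h⟩ else 0

theorem eF_ext {M : ℕ} {F F' : Fin (M+2) → W} (h : ∀ j < M+2, eF F j = eF F' j) : F = F' := by
  ext j
  have := h j j.2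
  simpa [eF] using this

variable {s : ℕ → G} {M : ℕ} {ρ : G →* (W ≃ₗ[ℂ] W)}

theorem eF_Sop {i j : ℕ} (hi : i ≤ M) (hj : j < M+2) (F : Fin (M+2) → W) :
    eF (Sop s M ρ i F) j = ρ (gg s M i j) (eF F (pt i j)) := by
  have h1 := pt_lt hi hj
  simp [eF, Sop, hj, h1, pf, hi]

theorem S_hi {i j : ℕ} (hij : i + 1 < j) (hj : j < M+2) (F : Fin (M+2) → W) :
    eF (Sop s M ρ i F) j = ρ (s i) (eF F j) := by
  rw [eF_Sop (by omega) hj, gg, if_pos hij, pt, if_neg (by omega), if_neg (by omega)]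

theorem S_dn {i : ℕ} (hj : i + 1 < M+2) (F : Fin (M+2) → W) :
    eF (Sop s M ρ i F) (i+1) = eF F i := by
  rw [eF_Sop (by omega) hj, gg, if_neg (by omega), if_pos rfl, pt, if_neg (by omega), if_pos rfl,
    map_one]; rfl

theorem S_up {i : ℕ} (hj : i + 1 < M+2) (F : Fin (M+2) → W) :
    eF (Sop s M ρ i F) i = ρ (aa s M i) (eF F (i+1)) := by
  rw [eF_Sop (by omega) (by omega), gg, if_neg (by omega), if_neg (by omega), if_pos rfl, pt,
    if_pos rfl]

theorem S_lo {i j : ℕ} (hij : j < i + 1) (hi : i + 2 < M+2) (F : Fin (M+2) → W) :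
    eF (Sop s M ρ (i+1) F) j = ρ (s i) (eF F j) := by
  rw [eF_Sop (by omega) (by omega), gg, if_neg (by omega), if_neg (by omega), if_neg (by omega), pt,
    if_neg (by omega), if_neg (by omega), Nat.add_sub_cancel]

theorem ρ_mul (x y : G) (v : W) : ρ x (ρ y v) = ρ (x * y) v := by
  rw [map_mul]; rfl

theorem Sop_BR (h : BR s M) : BR (Sop s M ρ) (M+1) := by
  constructor
  · intro i j hij hj
    ext1 F
    apply eF_ext
    intro k hk
    simp only [LinearEquiv.mul_apply]
    obtain ⟨j, rfl⟩ : ∃ j', j = j' + 1 := ⟨j - 1, by omega⟩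
    rcases Nat.lt_trichotomy k i with h1 | rfl | h1
    · obtain ⟨i, rfl⟩ : ∃ j', i = j' + 1 := ⟨i - 1, by omega⟩
      rw [S_lo (by omega) (by omega), S_lo (by omega) (by omega), S_lo (by omega) (by omega),
        S_lo (by omega) (by omega), ρ_mul, ρ_mul, h.comm i j (by omega) (by omega)]
    · rw [S_up (by omega), S_lo (by omega) (by omega), S_lo (by omega) (by omega), S_up (by omega),
        ρ_mul, ρ_mul, (aa_comm h (i := k) (m := j) (by omega) (by omega) (by omega) (by omega)).eq]
    rcases Nat.lt_trichotomy k (i+1) with h2 | rfl | h2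
    · omega
    · rw [S_dn (by omega), S_lo (by omega) (by omega), S_lo (by omega) (by omega), S_dn (by omega)]
    rcases Nat.lt_trichotomy k (j+1) with h3 | rfl | h3
    · rw [S_hi (by omega) (by omega), S_lo (by omega) (by omega), S_lo (by omega) (by omega),
        S_hi (by omega) (by omega), ρ_mul, ρ_mul, h.comm i j (by omega) (by omega)]
    · rw [S_hi (by omega) (by omega), S_up (by omega), S_up (by omega),
        S_hi (by omega) (by omega), ρ_mul, ρ_mul,
        (aa_comm h (i := j+1) (m := i) (by omega) (by omega) (by omega) (by omega)).eq]
    rcases Nat.lt_trichotomy k (j+2) with h4 | rfl | h4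
    · omega
    · rw [S_hi (by omega) (by omega), S_dn (by omega), S_dn (by omega), S_hi (by omega) (by omega)]
    · rw [S_hi (by omega) (by omega), S_hi (by omega) (by omega), S_hi (by omega) (by omega),
        S_hi (by omega) (by omega), ρ_mul, ρ_mul, h.comm i (j+1) (by omega) (by omega)]
  · intro i hi
    ext1 F
    apply eF_ext
    intro k hk
    simp only [LinearEquiv.mul_apply]
    rcases Nat.lt_trichotomy k i with h1 | rfl | h1
    · obtain ⟨i, rfl⟩ : ∃ j', i = j' + 1 := ⟨i - 1, by omega⟩
      have b := h.braid i (by omega)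
      simp only [S_lo (s := s) (ρ := ρ) (M := M) (i := i) (j := k) (by omega) (by omega),
        S_lo (s := s) (ρ := ρ) (M := M) (i := i+1) (j := k) (by omega) (by omega), ρ_mul,
        ← mul_assoc, b]
    · have b := (aa_pair h (i := k) (by omega)).eq
      rw [S_up (by omega), S_up (by omega), S_hi (by omega) (by omega), S_lo (by omega) (by omega),
        S_up (by omega), S_up (by omega), ρ_mul, ρ_mul, ρ_mul, ρ_mul, ← b, mul_assoc]
    rcases Nat.lt_trichotomy k (i+1) with h2 | rfl | h2
    · omega
    · rw [S_dn (by omega), S_lo (by omega) (by omega), S_up (by omega), S_up (by omega),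
        S_hi (by omega) (by omega), S_dn (by omega), ρ_mul, ρ_mul]
      congr 2
      simp [aa]
    rcases Nat.lt_trichotomy k (i+2) with h3 | rfl | h3
    · omega
    · rw [S_hi (by omega) (by omega), S_dn (by omega), S_dn (by omega), S_dn (by omega),
        S_dn (by omega), S_lo (by omega) (by omega)]
    · have b := h.braid i (by omega)
      simp only [S_hi (s := s) (ρ := ρ) (M := M) (i := i) (j := k) (by omega) (by omega),
        S_hi (s := s) (ρ := ρ) (M := M) (i := i+1) (j := k) (by omega) (by omega), ρ_mul,
        ← mul_assoc, b]

theorem del_zero {k : ℕ} (hk : k ≤ M + 1) (F : Fin (M+2) → W) :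
    eF (del (Sop s M ρ) k F) 0 = ρ (del (aa s M) k) (eF F k) := by
  induction k generalizing F with
  | zero => simp [del]
  | succ k ih =>
    simp only [del, LinearEquiv.mul_apply]
    rw [ih (by omega), S_up (by omega), ρ_mul]

theorem del_lt {j k : ℕ} (hk : k + 1 ≤ j) (hj : j < M+2) (F : Fin (M+2) → W) :
    eF (del (Sop s M ρ) k F) j = ρ (del s k) (eF F j) := by
  induction k generalizing F with
  | zero => simp [del]
  | succ k ih =>
    simp only [del, LinearEquiv.mul_apply]
    rw [ih (by omega), S_hi (by omega) (by omega), ρ_mul]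

theorem del_ge {j m : ℕ} (hj : j + 1 + m < M+2) (F : Fin (M+2) → W) :
    eF (del (Sop s M ρ) (j+1+m) F) (j+1) = ρ (del s (j+m)) (eF F j) := by
  induction m generalizing F with
  | zero =>
    simp only [del, LinearEquiv.mul_apply, add_zero]
    rw [del_lt le_rfl (by omega), S_dn (by omega)]
  | succ m ih =>
    rw [← add_assoc, ← add_assoc]
    simp only [del, LinearEquiv.mul_apply]
    rw [ih (by omega), show j + 1 + m = j + m + 1 by omega, S_lo (by omega) (by omega), ρ_mul]

theorem rev_eq {k : ℕ} (hk : k < M+2) (F : Fin (M+2) → W) :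
    eF (rev (Sop s M ρ) k F) k = eF F 0 := by
  induction k with
  | zero => simp [rev]
  | succ k ih =>
    simp only [rev, LinearEquiv.mul_apply]
    rw [S_dn (by omega), ih (by omega)]

theorem rev_gt {j k : ℕ} (hk : k + 1 ≤ j) (hj : j < M+2) (F : Fin (M+2) → W) :
    eF (rev (Sop s M ρ) k F) j = ρ (rev s k) (eF F j) := by
  induction k with
  | zero => simp [rev]
  | succ k ih =>
    simp only [rev, LinearEquiv.mul_apply]
    rw [S_hi (by omega) (by omega), ih (by omega), ρ_mul]

theorem rev_lt {j m : ℕ} (hj : j + 1 + m < M+2) (F : Fin (M+2) → W) :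
    eF (rev (Sop s M ρ) (j+1+m) F) j = ρ (rev s (j+m) * aa s M 0) (eF F (j+1)) := by
  induction m with
  | zero =>
    simp only [rev, LinearEquiv.mul_apply, add_zero]
    rw [S_up (by omega), rev_gt le_rfl (by omega), ρ_mul, aa_conj]
  | succ m ih =>
    rw [← add_assoc, ← add_assoc]
    simp only [rev, LinearEquiv.mul_apply]
    rw [show j + 1 + m = j + m + 1 by omega] at *
    rw [S_lo (by omega) (by omega), ih (by omega), ρ_mul, mul_assoc]

theorem sphere_rel (hw : ρ (del (aa s M) (M+1)) = 1) :
    del (Sop s M ρ) (M+1) * rev (Sop s M ρ) (M+1) = 1 := by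
  ext1 F
  apply eF_ext
  intro j hj
  rw [LinearEquiv.mul_apply]
  rcases j with _ | j
  · rw [del_zero le_rfl, rev_eq (by omega), hw]; rfl
  · have e1 := del_ge (s := s) (ρ := ρ) (M := M) (j := j) (m := M - j) (by omega)
    have e2 := rev_lt (s := s) (ρ := ρ) (M := M) (j := j) (m := M - j) (by omega)
    rw [show j + 1 + (M - j) = M + 1 by omega, show j + (M - j) = M by omega] at e1 e2
    rw [e1, e2, ρ_mul, ← mul_assoc]
    simp [aa]

theorem D_pow {j m : ℕ} (hj : j + m < M+2) (F : Fin (M+2) → W) :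
    eF ((del (Sop s M ρ) (M+1) ^ m) F) (j + m) = ρ (del s M ^ m) (eF F j) := by
  induction m with
  | zero => simp
  | succ m ih =>
    have e1 := del_ge (s := s) (ρ := ρ) (M := M) (j := j+m) (m := M - (j+m)) (by omega)
    rw [show j + m + 1 + (M - (j+m)) = M + 1 by omega, show j + m + (M - (j+m)) = M by omega] at e1
    rw [pow_succ', LinearEquiv.mul_apply, ← add_assoc, e1, ih (by omega), ρ_mul, pow_succ']

theorem power_rel (hw : ρ (del (aa s M) (M+1)) = 1) (hz : ρ (tw s M) = 1) :
    del (Sop s M ρ) (M+1) ^ (M+2) = 1 := by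
  ext1 F
  apply eF_ext
  intro j hj
  have e : del (Sop s M ρ) (M+1) ^ (M+2) = del (Sop s M ρ) (M+1) ^ j *
      (del (Sop s M ρ) (M+1) * del (Sop s M ρ) (M+1) ^ (M+1-j)) := by
    rw [← pow_succ', ← pow_add]; congr 1; omega
  rw [e, LinearEquiv.mul_apply, LinearEquiv.mul_apply]
  have e1 := D_pow (s := s) (ρ := ρ) (M := M) (j := 0) (m := j) (by omega)
  have e2 := D_pow (s := s) (ρ := ρ) (M := M) (j := j) (m := M+1-j) (by omega)
  rw [zero_add] at e1
  rw [show j + (M+1-j) = M+1 by omega] at e2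
  rw [e1, del_zero le_rfl, hw, LinearEquiv.coe_one, id, e2, ρ_mul, ← pow_add,
    show j + (M+1-j) = M+1 by omega]
  unfold tw at hz
  rw [hz]; rfl

/-- abstract embedding: kernel computation -/
theorem eF_tau {j : ℕ} (hj : j < M+2) (F : Fin (M+2) → W) :
    eF (tau (Sop s M ρ) M j F) (M+1) = eF F j := by
  unfold tau
  rw [LinearEquiv.mul_apply, rev_eq (by omega), ← rev_eq (s := s) (ρ := ρ) hj,
    ← LinearEquiv.mul_apply, mul_inv_cancel]; rfl
end ops
end LK

set_option linter.unusedSectionVars false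
namespace LK
section words
variable {H : Type*} [Group H]
theorem ofFn_del (s : ℕ → H) (K : ℕ) : (List.ofFn fun i : Fin K => s i).prod = del s K := by
  induction K with
  | zero => simp [del]
  | succ K ih => rw [List.ofFn_succ', List.concat_eq_append, List.prod_append]; simp [del, ih]

theorem ofFn_rev (s : ℕ → H) (K : ℕ) :
    (List.ofFn fun i : Fin K => s i).reverse.prod = rev s K := by
  induction K with
  | zero => simp [rev]
  | succ K ih =>
    rw [List.ofFn_succ', List.concat_eq_append, List.reverse_append, List.prod_append]
    simp [rev, ih]

theorem map_braidWord {K : ℕ} (φ : FreeGroup (Fin K) →* H) (s : ℕ → H)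
    (hs : ∀ i : Fin K, φ (FreeGroup.of i) = s i) : φ (braidWord K) = del s K := by
  rw [braidWord, map_list_prod, List.map_ofFn, ← ofFn_del]
  congr 2
  ext i; exact hs i

theorem map_psWord {K : ℕ} (φ : FreeGroup (Fin K) →* H) (s : ℕ → H)
    (hs : ∀ i : Fin K, φ (FreeGroup.of i) = s i) :
    φ (puncturedSphereWord K) = del s K * rev s K := by
  rw [puncturedSphereWord, map_mul, map_braidWord φ s hs, map_list_prod, List.map_reverse,
    List.map_ofFn, ← ofFn_rev]
  congr 4
  ext i; exact hs i
end words

/-- the sphere relators -/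
abbrev sr (M : ℕ) : Set (FreeGroup (Fin (M+1))) :=
  braidRelsSet (M+1) ∪ {puncturedSphereWord (M+1), (braidWord (M+1)) ^ (M+2)}
/-- the sphere group -/
abbrev SM (M : ℕ) := PresentedGroup (sr M)

/-- generators of the sphere group, extended by `1` -/
def tS (M i : ℕ) : SM M := if h : i < M+1 then PresentedGroup.of ⟨i, h⟩ else 1

theorem tS_of {M : ℕ} (i : Fin (M+1)) : tS M i = PresentedGroup.of i := by
  rw [tS, dif_pos i.2]

theorem tS_BR (M : ℕ) : BR (tS M) (M+1) := of_BR (M := M+1) Set.subset_union_left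

theorem tS_sphere (M : ℕ) : del (tS M) (M+1) * rev (tS M) (M+1) = 1 := by
  rw [← map_psWord (PresentedGroup.mk (sr M)) (tS M) (fun i => (tS_of i).symm)]
  exact PresentedGroup.one_of_mem (by simp)

theorem tS_pow (M : ℕ) : del (tS M) (M+1) ^ (M+2) = 1 := by
  rw [← map_braidWord (PresentedGroup.mk (sr M)) (tS M) (fun i => (tS_of i).symm), ← map_pow]
  exact PresentedGroup.one_of_mem (by simp)

/-- The inclusion of the braid group. -/
def io (M : ℕ) : PB M →* SM M := bhom ((tS_BR M).mono (Nat.le_succ M))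

theorem io_sB {M i : ℕ} (hi : i < M) : io M (sB M i) = tS M i := bhom_sB _ hi

theorem io_zz (M : ℕ) : io M (zz M) = 1 := by
  have h := (tS_BR M).tw_succ (k := M) le_rfl
  have e : io M (zz M) = tw (tS M) M := by
    unfold zz tw
    rw [map_pow, map_del (io M) (fun i hi => io_sB hi) le_rfl]
  rw [e]
  unfold tw at *
  rw [tS_pow, mul_eq_one_comm.1 (tS_sphere M), mul_one] at h
  exact h.symm

theorem io_gg {M i j : ℕ} (hi : i ≤ M) (hj : j ≤ M + 1) :
    io M (gg (sB M) M i j) = gg (tS M) M i j := by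
  unfold gg
  split_ifs with h1 h2 h3
  · exact io_sB (by omega)
  · exact map_one _
  · exact map_aa (io M) (fun i hi => io_sB hi) (by omega)
  · exact io_sB (by omega)

theorem normal_form {M : ℕ} (g : SM M) : ∃ (k : PB M) (j : ℕ), j < M + 2 ∧
    g = io M k * tau (tS M) M j := by
  have hg : g ∈ Subgroup.closure (Set.range (PresentedGroup.of (rels := sr M))) := by
    rw [PresentedGroup.closure_range_of]; trivial
  have st : ∀ i ≤ M, ∀ j < M + 2, tau (tS M) M j * tS M i =
      io M (gg (sB M) M i j) * tau (tS M) M (pt i j) := by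
    intro i hi j hj
    rw [io_gg hi (by omega)]
    exact tau_step (tS_BR M) (tS_sphere M) (tS_pow M) hi (by omega)
  induction hg using Subgroup.closure_induction_right with
  | one => exact ⟨1, M+1, by omega, by simp [tau]⟩
  | mul_right x hx y hy ih =>
    obtain ⟨i, rfl⟩ := hy
    obtain ⟨k, j, hj, rfl⟩ := ih
    have hi : (i : ℕ) ≤ M := by omega
    refine ⟨k * gg (sB M) M i j, pt i j, pt_lt hi hj, ?_⟩
    rw [← tS_of, mul_assoc, st i hi j hj, map_mul, mul_assoc]
  | mul_inv_cancel x hx y hy ih =>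
    obtain ⟨i, rfl⟩ := hy
    obtain ⟨k, j, hj, rfl⟩ := ih
    have hi : (i : ℕ) ≤ M := by omega
    refine ⟨k * (gg (sB M) M i (pt i j))⁻¹, pt i j, pt_lt hi hj, ?_⟩
    have := st i hi _ (pt_lt hi hj)
    rw [pt_pt] at this
    rw [← tS_of, mul_inv_eq_iff_eq_mul, mul_assoc, this, map_mul, map_inv]
    group

section main
variable {W : Type*} [AddCommGroup W] [Module ℂ W] {M : ℕ} {ρ : PB M →* (W ≃ₗ[ℂ] W)}

theorem S_rels (hw : ρ (del (aa (sB M) M) (M+1)) = 1) (hz : ρ (zz M) = 1) :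
    ∀ r ∈ sr M, FreeGroup.lift (fun i : Fin (M+1) => Sop (sB M) M ρ i) r = 1 := by
  have hs : ∀ i : Fin (M+1), FreeGroup.lift (fun i : Fin (M+1) => Sop (sB M) M ρ i)
      (FreeGroup.of i) = Sop (sB M) M ρ i := fun i => FreeGroup.lift_apply_of
  rintro r (hr | rfl | rfl)
  · exact BR_rels (Sop_BR (sB_BR M)) r hr
  · rw [map_psWord _ _ hs, sphere_rel hw]
  · rw [map_pow, map_braidWord _ _ hs, power_rel hw hz]

/-- the induced representation -/
def Th (hw : ρ (del (aa (sB M) M) (M+1)) = 1) (hz : ρ (zz M) = 1) :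
    SM M →* ((Fin (M+2) → W) ≃ₗ[ℂ] (Fin (M+2) → W)) := PresentedGroup.toGroup (S_rels hw hz)

theorem Th_tS (hw : ρ (del (aa (sB M) M) (M+1)) = 1) (hz : ρ (zz M) = 1) {i : ℕ} (hi : i < M+1) :
    Th hw hz (tS M i) = Sop (sB M) M ρ i := by
  rw [tS_of ⟨i, hi⟩]; exact PresentedGroup.toGroup.of _

theorem Th_tau (hw : ρ (del (aa (sB M) M) (M+1)) = 1) (hz : ρ (zz M) = 1) {j : ℕ} (hj : j < M+2) :
    Th hw hz (tau (tS M) M j) = tau (Sop (sB M) M ρ) M j := by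
  unfold tau
  rw [map_mul, map_inv, map_rev _ (fun i hi => Th_tS hw hz hi) le_rfl,
    map_rev _ (fun i hi => Th_tS hw hz hi) (by omega)]

theorem Th_io (hw : ρ (del (aa (sB M) M) (M+1)) = 1) (hz : ρ (zz M) = 1) (k : PB M)
    (F : Fin (M+2) → W) : eF (Th hw hz (io M k) F) (M+1) = ρ k (eF F (M+1)) := by
  have hg : k ∈ Subgroup.closure (Set.range (PresentedGroup.of (rels := braidRelsSet M))) := by
    rw [PresentedGroup.closure_range_of]; trivial
  induction hg using Subgroup.closure_induction generalizing F with
  | one => simp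
  | mem x hx =>
    obtain ⟨i, rfl⟩ := hx
    rw [← sB_of, io_sB i.2, Th_tS hw hz (by omega), S_hi (by omega) (by omega)]
  | mul x y _ _ hx hy => rw [map_mul, map_mul, LinearEquiv.mul_apply, hx, hy, ρ_mul]
  | inv x _ hx =>
    have := hx ((Th hw hz (io M x))⁻¹ F)
    rw [← LinearEquiv.mul_apply, mul_inv_cancel, LinearEquiv.coe_one, id] at this
    rw [map_inv, map_inv, this, ρ_mul, inv_mul_cancel, map_one]; rfl

theorem Th_inj [Nontrivial W] (hw : ρ (del (aa (sB M) M) (M+1)) = 1) (hz : ρ (zz M) = 1)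
    (hk : ∀ k, ρ k = 1 → k ∈ Subgroup.zpowers (zz M)) : Function.Injective (Th hw hz) := by
  rw [injective_iff_map_eq_one]
  intro g hg
  obtain ⟨k, j, hj, rfl⟩ := normal_form g
  have key : ∀ F : Fin (M+2) → W, ρ k (eF F j) = eF F (M+1) := by
    intro F
    rw [← eF_tau (s := sB M) (ρ := ρ) hj, ← Th_tau hw hz hj, ← Th_io hw hz, ← LinearEquiv.mul_apply,
      ← map_mul, hg]; rfl
  obtain rfl : j = M + 1 := by
    by_contra hne
    obtain ⟨v, hv⟩ := exists_ne (0 : W)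
    have := key (Pi.single ⟨M+1, by omega⟩ v)
    simp [eF, hj, hne] at this
    exact hv this.symm
  have h1 : ρ k = 1 := by
    ext v
    have := key (fun _ => v)
    simpa [eF] using this
  obtain ⟨m, rfl⟩ := hk k h1
  simp [io_zz, tau]
end main

theorem V_nontrivial {M : ℕ} (hM : 1 ≤ M) : Nontrivial (V M) := by
  have : Nonempty {p : Fin (M+1) × Fin (M+1) // p.1 < p.2} :=
    ⟨⟨(⟨0, by omega⟩, ⟨1, by omega⟩), by simp [Fin.lt_def]⟩⟩
  unfold V
  infer_instance

theorem exists_twist {M : ℕ} (hM : 2 ≤ M) : ∃ ρ : PB M →* (V M ≃ₗ[ℂ] V M), ρ (zz M) = 1 ∧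
    ∀ k, ρ k = 1 → k ∈ Subgroup.zpowers (zz M) := by
  obtain ⟨t, ht⟩ := exists_transcendental
  have ht0 : t ≠ 0 := by simpa using trans_ne ht 0
  obtain ⟨c, hc⟩ := scalar_of_central ht (ht0 := ht0) (M := M) (by omega)
    (x := zz M) (fun r _ => zz_central _)
  have := V_nontrivial (M := M) (by omega)
  have hc0 : c ≠ 0 := by
    rintro rfl
    obtain ⟨v, hv⟩ := exists_ne (0 : V M)
    have := hc v
    rw [zero_smul] at this
    exact hv ((LinearEquiv.map_eq_zero_iff _).1 this)
  obtain ⟨l, hl⟩ := IsAlgClosed.exists_pow_nat_eq (c⁻¹) (n := M * (M+1)) (by positivity)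
  have hl0 : l ≠ 0 := by
    rintro rfl
    rw [zero_pow (by positivity)] at hl
    exact inv_ne_zero hc0 hl.symm
  let u : ℂˣ := Units.mk0 l hl0
  have hb : BR (fun _ : ℕ => u) M := ⟨fun _ _ _ _ => rfl, fun _ _ => rfl⟩
  let χ : PB M →* ℂˣ := bhom hb
  have hχ : χ (zz M) = u ^ (M * (M+1)) := by
    have : ∀ k, del (fun _ : ℕ => u) k = u ^ k := by
      intro k
      induction k with
      | zero => rfl
      | succ k ih => rw [del, ih, pow_succ]
    unfold zz tw
    rw [map_pow, map_del χ (fun i hi => bhom_sB hb hi) le_rfl, this, pow_mul]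
  let sc : ℂˣ →* (V M ≃ₗ[ℂ] V M) := DistribMulAction.toModuleAut ℂ (V M)
  have hsc : ∀ (x : ℂˣ) (v : V M), sc x v = (x : ℂ) • v := fun x v => rfl
  let ρ : PB M →* (V M ≃ₗ[ℂ] V M) := MonoidHom.mk' (fun g => sc (χ g) * rep ht0 M g) (by
    intro x y
    ext1 v
    simp only [map_mul, LinearEquiv.mul_apply, hsc, map_smul]
    exact smul_comm _ _ _)
  have hρ : ∀ g v, ρ g v = (χ g : ℂ) • rep ht0 M g v := fun g v => rfl
  refine ⟨ρ, ?_, ?_⟩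
  · ext1 v
    rw [hρ, hc, hχ, smul_smul]
    show (((u ^ (M * (M+1)) : ℂˣ) : ℂ) * c) • v = v
    have : ((u ^ (M * (M+1)) : ℂˣ) : ℂ) = c⁻¹ := by rw [← hl]; simp [u]
    rw [this, inv_mul_cancel₀ hc0, one_smul]
  · intro k hk
    refine scalar_mem ht (ht0 := ht0) hM (c := ((χ k)⁻¹ : ℂˣ)) ?_
    intro v
    have := hρ k v
    rw [hk] at this
    change v = _ at this
    conv_rhs => rw [this]
    rw [smul_smul, Units.inv_mul, one_smul]

theorem card_pairs (N : ℕ) : Fintype.card {p : Fin N × Fin N // p.1 < p.2} = N.choose 2 := by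
  let e : {p : Fin N × Fin N // p.1 < p.2} ≃ (Σ j : Fin N, Fin j) :=
    { toFun := fun p => ⟨p.1.2, ⟨p.1.1, p.2⟩⟩
      invFun := fun x => ⟨(⟨x.2, x.2.2.trans x.1.2⟩, x.1), x.2.2⟩
      left_inv := fun p => rfl
      right_inv := fun x => rfl }
  rw [Fintype.card_congr e, Fintype.card_sigma]
  simp only [Fintype.card_fin]
  rw [Fin.sum_univ_eq_sum_range (fun i => i) N, Finset.sum_range_id, Nat.choose_two_right]

theorem main_exists {M : ℕ} (hM : 2 ≤ M) : ∃ φ : SM M →*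
    ((Fin (M+2) → V M) ≃ₗ[ℂ] (Fin (M+2) → V M)), Function.Injective φ := by
  obtain ⟨ρ, hz, hk⟩ := exists_twist hM
  have := V_nontrivial (M := M) (by omega)
  have hw : ρ (del (aa (sB M) M) (M+1)) = 1 := by
    obtain ⟨m, hm⟩ := center_zz hM (g := del (aa (sB M) M) (M+1))
      (fun r hr => aa_central (sB_BR M) hr)
    rw [← hm]
    simp [hz]
  exact ⟨Th hw hz, Th_inj hw hz hk⟩

theorem final {M : ℕ} (hM : 2 ≤ M) :
    ∃ φ : SM M →* Matrix.GeneralLinearGroup (Fin ((M+2) * ((M+1).choose 2))) ℂ,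
      Function.Injective φ := by
  obtain ⟨φ, hφ⟩ := main_exists hM
  have hd : Module.finrank ℂ (Fin (M+2) → V M) = (M+2) * (M+1).choose 2 := by
    unfold V
    rw [Module.finrank_pi_fintype]
    simp [card_pairs]
  have : FiniteDimensional ℂ (Fin (M+2) → V M) := by unfold V; infer_instance
  let b := Module.finBasisOfFinrankEq ℂ (Fin (M+2) → V M) hd
  let e1 := (LinearMap.GeneralLinearGroup.generalLinearEquiv ℂ (Fin (M+2) → V M)).symm
  let e2 := Units.mapEquiv (LinearMap.toMatrixAlgEquiv b).toMulEquiv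
  exact ⟨(e2.toMonoidHom.comp e1.toMonoidHom).comp φ,
    (e2.injective.comp e1.injective).comp hφ⟩
end LK
/-- For `n ≥ 4`, the mapping class group of the `n`-times punctured sphere
embeds into `GL(n·C(n−1,2), ℂ)`; in particular it is linear. -/
theorem sphereMCG_linear (n : ℕ) (hn : 4 ≤ n) :
    ∃ ρ : SphereMCG n →* Matrix.GeneralLinearGroup (Fin (n * ((n - 1).choose 2))) ℂ,
      Function.Injective ρ := by
  obtain ⟨M, rfl⟩ : ∃ M, n = M + 2 := ⟨n - 2, by omega⟩
  exact LK.final (M := M) (by omega)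
end

section
/- In M_n with n ≥ 4 (the mapping class group of the n-times punctured sphere, via its standard presentation), the subgroup S generated by σ₁, …, σ_{n−2} has index n in M_n, and the group homomorphism from the braid group B_{n−1} to M_n sending each generator σᵢ of B_{n−1} to the generator σᵢ of M_n (i = 1, …, n−2) has image S and kernel equal to the center of B_{n−1}, namely the cyclic subgroup generated by the full twist Δ² = (σ₁σ₂⋯σ_{n−2})^{n−1}. In particular there is a short exact sequence 0 → ℤ → B_{n−1} → S → 0 in which the image of ℤ in B_{n−1} is the center of B_{n−1}. -/
namespace BraidProof

set_option linter.all false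

abbrev Br (m : ℕ) := PresentedGroup (braidRelsSet m)
abbrev F := FreeGroup ℕ
abbrev X (i : ℕ) : F := FreeGroup.of i

/-- generators indexed by all naturals, trivial out of range -/
def sg (m i : ℕ) : Br m := if h : i < m then PresentedGroup.of ⟨i, h⟩ else 1

lemma sg_of_lt {m i : ℕ} (h : i < m) : sg m i = PresentedGroup.of ⟨i, h⟩ := dif_pos h

lemma sg_comm (m i j : ℕ) (h : i + 2 ≤ j) : sg m i * sg m j = sg m j * sg m i := by
  by_cases hj : j < m
  · have hi : i < m := by omega
    rw [sg_of_lt hi, sg_of_lt hj]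
    have : (PresentedGroup.mk (braidRelsSet m)) (FreeGroup.of ⟨i, hi⟩ * FreeGroup.of ⟨j, hj⟩ *
        (FreeGroup.of ⟨i, hi⟩)⁻¹ * (FreeGroup.of ⟨j, hj⟩)⁻¹) = 1 :=
      PresentedGroup.one_of_mem ⟨⟨i, hi⟩, ⟨j, hj⟩, Or.inl ⟨Or.inl h, rfl⟩⟩
    simp only [map_mul, map_inv] at this
    rw [mul_inv_eq_one, mul_inv_eq_iff_eq_mul] at this
    exact this
  · have : sg m j = 1 := dif_neg hj
    simp [this]

lemma sg_braid (m i : ℕ) (h : i + 1 < m) :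
    sg m i * sg m (i+1) * sg m i = sg m (i+1) * sg m i * sg m (i+1) := by
  have hi : i < m := by omega
  rw [sg_of_lt hi, sg_of_lt h]
  have : (PresentedGroup.mk (braidRelsSet m)) (FreeGroup.of ⟨i, hi⟩ * FreeGroup.of ⟨i+1, h⟩ *
      FreeGroup.of ⟨i, hi⟩ * (FreeGroup.of ⟨i+1, h⟩ * FreeGroup.of ⟨i, hi⟩ *
      FreeGroup.of ⟨i+1, h⟩)⁻¹) = 1 :=
    PresentedGroup.one_of_mem ⟨⟨i, hi⟩, ⟨i+1, h⟩, Or.inr ⟨Or.inl rfl, rfl⟩⟩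
  rw [map_mul, map_inv, mul_inv_eq_one] at this
  simp only [map_mul] at this
  exact this

/-- braid-like sequences -/
structure IsBraid {G : Type*} [Group G] (m : ℕ) (t : ℕ → G) : Prop where
  comm : ∀ i j, i + 2 ≤ j → j < m → t i * t j = t j * t i
  braid : ∀ i, i + 1 < m → t i * t (i+1) * t i = t (i+1) * t i * t (i+1)

lemma isBraid_rels {G : Type*} [Group G] {m : ℕ} {t : ℕ → G} (h : IsBraid m t) :
    ∀ r ∈ braidRelsSet m, FreeGroup.lift (fun i : Fin m => t i) r = 1 := by
  rintro r ⟨i, j, ⟨hij, rfl⟩ | ⟨hij, rfl⟩⟩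
  · simp only [map_mul, map_inv, FreeGroup.lift_apply_of]
    rw [mul_inv_eq_one, mul_inv_eq_iff_eq_mul]
    rcases hij with hij | hij
    · exact h.comm _ _ hij j.2
    · exact (h.comm _ _ hij i.2).symm
  · simp only [map_mul, map_inv, FreeGroup.lift_apply_of]
    rw [mul_inv_eq_one]
    rcases hij with hij | hij
    · rw [← hij]; exact h.braid _ (by omega)
    · rw [← hij]; exact (h.braid _ (by omega)).symm

def brLift {G : Type*} [Group G] {m : ℕ} {t : ℕ → G} (h : IsBraid m t) : Br m →* G :=
  PresentedGroup.toGroup (f := fun i : Fin m => t i) (isBraid_rels h)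

lemma brLift_sg {G : Type*} [Group G] {m : ℕ} {t : ℕ → G} (h : IsBraid m t) {i : ℕ} (hi : i < m) :
    brLift h (sg m i) = t i := by
  rw [sg_of_lt hi]; exact PresentedGroup.toGroup.of _

lemma sg_isBraid (m k : ℕ) (h : k ≤ m) : IsBraid k (sg m) :=
  ⟨fun i j hij _ => sg_comm m i j hij, fun i hi => sg_braid m i (by omega)⟩

def io (m : ℕ) : Br m →* Br (m+1) := brLift (sg_isBraid (m+1) m (by omega))

lemma io_sg {m i : ℕ} (h : i < m) : io m (sg m i) = sg (m+1) i := brLift_sg _ h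

lemma br_induction {m : ℕ} {p : Br m → Prop} (h1 : p 1)
    (h2 : ∀ b i, i < m → p b → p (b * sg m i))
    (h3 : ∀ b i, i < m → p b → p (b * (sg m i)⁻¹)) (b : Br m) : p b := by
  have hb : b ∈ Subgroup.closure (Set.range (PresentedGroup.of (rels := braidRelsSet m))) := by
    rw [PresentedGroup.closure_range_of]; trivial
  induction hb using Subgroup.closure_induction_right with
  | one => exact h1
  | mul_right x _ y hy ih =>
    obtain ⟨i, rfl⟩ := hy
    have := h2 x i i.2 ih
    rwa [sg_of_lt i.2] at this
  | mul_inv_cancel x _ y hy ih =>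
    obtain ⟨i, rfl⟩ := hy
    have := h3 x i i.2 ih
    rwa [sg_of_lt i.2] at this

lemma br_hom_ext {G : Type*} [Group G] {m : ℕ} {f g : Br m →* G}
    (h : ∀ i, i < m → f (sg m i) = g (sg m i)) : f = g := by
  apply PresentedGroup.ext
  intro i
  have := h i i.2
  rwa [sg_of_lt i.2] at this

/-! Artin action -/
def artF (i : ℕ) : F →* F := FreeGroup.lift fun j =>
  if j = i then X i * X (i+1) * (X i)⁻¹ else if j = i + 1 then X i else X j
def artG (i : ℕ) : F →* F := FreeGroup.lift fun j =>
  if j = i then X (i+1) else if j = i + 1 then (X (i+1))⁻¹ * X i * X (i+1) else X j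

def art (i : ℕ) : MulAut F := MonoidHom.toMulEquiv (artF i) (artG i)
  (by
    ext j
    by_cases h : j = i
    · subst h; simp [artF, artG, mul_assoc]
    · by_cases h' : j = i + 1
      · subst h'; simp [artF, artG]
      · simp [artF, artG, h, h'])
  (by
    ext j
    by_cases h : j = i
    · subst h; simp [artF, artG, mul_assoc]
    · by_cases h' : j = i + 1
      · subst h'; simp [artF, artG, mul_assoc]
      · simp [artF, artG, h, h'])

lemma art_self (i : ℕ) : art i (X i) = X i * X (i+1) * (X i)⁻¹ := by
  change artF i (X i) = _
  simp [artF]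
lemma art_succ (i : ℕ) : art i (X (i+1)) = X i := by
  change artF i (X (i+1)) = _
  simp [artF]
lemma art_ne {i j : ℕ} (h : j ≠ i) (h' : j ≠ i+1) : art i (X j) = X j := by
  change artF i (X j) = _
  simp [artF, h, h']

lemma aut_ext {f g : MulAut F} (h : ∀ j, f (X j) = g (X j)) : f = g := by
  have : f.toMonoidHom = g.toMonoidHom := by
    ext j; exact h j
  ext x
  exact DFunLike.congr_fun this x

lemma art_inv_of {i : ℕ} {x y : F} (h : art i x = y) : (art i)⁻¹ y = x := by
  rw [← h]; exact (art i).symm_apply_apply x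

lemma art_isBraid (m : ℕ) : IsBraid m art := by
  constructor
  · intro i j hij _
    apply aut_ext
    intro k
    simp only [MulAut.mul_apply]
    by_cases h1 : k = i
    · subst h1
      rw [art_self, art_ne (i := j) (by omega) (by omega), map_mul, map_mul, map_inv,
        art_ne (i := j) (by omega) (by omega), art_ne (i := j) (by omega) (by omega), art_self]
    by_cases h2 : k = i+1
    · subst h2
      rw [art_succ, art_ne (i := j) (by omega) (by omega),
        art_ne (i := j) (by omega) (by omega), art_succ]
    rw [art_ne h1 h2]
    by_cases h3 : k = j
    · subst h3
      rw [art_self, map_mul, map_mul, map_inv, art_ne h1 h2, art_ne (by omega) (by omega)]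
    by_cases h4 : k = j + 1
    · subst h4
      rw [art_succ, art_ne (by omega) (by omega)]
    rw [art_ne h3 h4, art_ne h1 h2]
  · intro i _
    apply aut_ext
    intro k
    have e1 : art i (X (i+1+1)) = X (i+1+1) := art_ne (by omega) (by omega)
    have e2 : art (i+1) (X i) = X i := art_ne (by omega) (by omega)
    simp only [MulAut.mul_apply]
    by_cases h1 : k = i
    · subst h1
      simp only [art_self, art_succ, e1, e2, map_mul, map_inv]
      group
    by_cases h2 : k = i+1
    · subst h2
      simp only [art_self, art_succ, e1, e2, map_mul, map_inv]
    by_cases h3 : k = i+1+1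
    · subst h3
      simp only [art_self, art_succ, e1, e2, map_mul, map_inv]
    simp only [art_ne h1 h2, art_ne h2 h3]

def rho (m : ℕ) : Br m →* MulAut F := brLift (art_isBraid m)
lemma rho_sg {m i : ℕ} (h : i < m) : rho m (sg m i) = art i := brLift_sg _ h

lemma rho_io (m : ℕ) (b : Br m) : rho (m+1) (io m b) = rho m b := by
  have : (rho (m+1)).comp (io m) = rho m := by
    apply br_hom_ext
    intro i hi
    simp [io_sg hi, rho_sg hi, rho_sg (show i < m+1 by omega)]
  exact DFunLike.congr_fun this b

lemma swap_isBraid (m : ℕ) : IsBraid m (fun i => Equiv.swap i (i+1)) := by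
  constructor
  · intro i j hij _
    ext k
    simp only [Equiv.Perm.mul_apply, Equiv.swap_apply_def]
    grind
  · intro i _
    ext k
    simp only [Equiv.Perm.mul_apply, Equiv.swap_apply_def]
    grind

def pe (m : ℕ) : Br m →* Equiv.Perm ℕ := brLift (swap_isBraid m)
lemma pe_sg {m i : ℕ} (h : i < m) : pe m (sg m i) = Equiv.swap i (i+1) := brLift_sg _ h

lemma pe_io (m : ℕ) (b : Br m) : pe (m+1) (io m b) = pe m b := by
  have : (pe (m+1)).comp (io m) = pe m := by
    apply br_hom_ext
    intro i hi
    simp [io_sg hi, pe_sg hi, pe_sg (show i < m+1 by omega)]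
  exact DFunLike.congr_fun this b

def dg (m : ℕ) : Br m →* Multiplicative ℤ :=
  brLift (t := fun _ => Multiplicative.ofAdd (1 : ℤ)) ⟨fun _ _ _ _ => rfl, fun _ _ => rfl⟩
lemma dg_sg {m i : ℕ} (h : i < m) : dg m (sg m i) = Multiplicative.ofAdd (1 : ℤ) := brLift_sg _ h
lemma dg_io (m : ℕ) (b : Br m) : dg (m+1) (io m b) = dg m b := by
  have : (dg (m+1)).comp (io m) = dg m := by
    apply br_hom_ext
    intro i hi
    simp [io_sg hi, dg_sg hi, dg_sg (show i < m+1 by omega)]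
  exact DFunLike.congr_fun this b

/-- product `x₀⋯x_{k-1}` -/
def P : ℕ → F
  | 0 => 1
  | k+1 => P k * X k

lemma art_P_le {i k : ℕ} (h : k ≤ i) : art i (P k) = P k := by
  induction k with
  | zero => simp [P]
  | succ k ih => rw [P, map_mul, ih (by omega), art_ne (by omega) (by omega)]

lemma art_P {i k : ℕ} (h : k ≠ i + 1) : art i (P k) = P k := by
  induction k with
  | zero => simp [P]
  | succ k ih =>
    by_cases hk : k = i + 1
    · subst hk
      rw [P, P, map_mul, map_mul, art_P_le le_rfl, art_self, art_succ]
      group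
    · rw [P, map_mul, ih hk, art_ne (by omega) (by omega)]

lemma rho_P (m : ℕ) (b : Br m) {k : ℕ} (hk : m < k) : rho m b (P k) = P k := by
  induction b using br_induction with
  | h1 => simp
  | h2 b i hi ih => rw [map_mul, MulAut.mul_apply, rho_sg hi, art_P (by omega), ih]
  | h3 b i hi ih =>
    rw [map_mul, MulAut.mul_apply, map_inv, rho_sg hi, art_inv_of (art_P (by omega)), ih]

lemma rho_fix (m : ℕ) (b : Br m) {k : ℕ} (hk : m < k) : rho m b (X k) = X k := by
  induction b using br_induction with
  | h1 => simp
  | h2 b i hi ih => rw [map_mul, MulAut.mul_apply, rho_sg hi, art_ne (by omega) (by omega), ih]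
  | h3 b i hi ih =>
    rw [map_mul, MulAut.mul_apply, map_inv, rho_sg hi,
      art_inv_of (art_ne (by omega) (by omega)), ih]

/-- kill the generators `x_j`, `j ≥ k` -/
def kil (k : ℕ) : F →* F := FreeGroup.lift fun j => if j < k then X j else 1

lemma kil_lt {k j : ℕ} (h : j < k) : kil k (X j) = X j := by simp [kil, h]
lemma kil_ge {k j : ℕ} (h : k ≤ j) : kil k (X j) = 1 := by
  simp [kil, not_lt.2 h]

lemma kil_kil (k : ℕ) (x : F) : kil k (kil k x) = kil k x := by
  have : (kil k).comp (kil k) = kil k := by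
    ext j
    by_cases h : j < k
    · simp [kil_lt h]
    · simp [kil_ge (not_lt.1 h)]
  exact DFunLike.congr_fun this x

lemma art_kil {i k : ℕ} (h : i + 1 < k) (x : F) : art i (kil k x) = kil k (art i x) := by
  have : (art i).toMonoidHom.comp (kil k) = (kil k).comp (art i).toMonoidHom := by
    ext j
    simp only [MonoidHom.comp_apply, MulEquiv.coe_toMonoidHom]
    by_cases h1 : j = i
    · subst h1
      simp only [kil_lt (show j < k by omega), art_self, map_mul, map_inv, kil_lt h]
    by_cases h2 : j = i + 1
    · subst h2
      simp only [kil_lt h, art_succ, kil_lt (show i < k by omega)]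
    rw [art_ne h1 h2]
    by_cases h3 : j < k
    · rw [kil_lt h3, art_ne h1 h2]
    · rw [kil_ge (not_lt.1 h3), map_one]
  exact DFunLike.congr_fun this x

lemma rho_kil (m : ℕ) (b : Br m) {k : ℕ} (hk : m < k) (x : F) :
    rho m b (kil k x) = kil k (rho m b x) := by
  induction b using br_induction generalizing x with
  | h1 => simp
  | h2 b i hi ih => rw [map_mul, MulAut.mul_apply, MulAut.mul_apply, rho_sg hi,
      art_kil (by omega), ih]
  | h3 b i hi ih =>
    have : (art i)⁻¹ (kil k x) = kil k ((art i)⁻¹ x) := by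
      apply art_inv_of
      rw [art_kil (by omega)]
      congr 1
      exact (art i).apply_symm_apply x
    rw [map_mul, MulAut.mul_apply, MulAut.mul_apply, map_inv, rho_sg hi, this, ih]

lemma art_conj (i j : ℕ) : ∃ u : F, art i (X j) = u * X (Equiv.swap i (i+1) j) * u⁻¹ := by
  by_cases h1 : j = i
  · subst h1; exact ⟨X j, by rw [art_self, Equiv.swap_apply_left]⟩
  by_cases h2 : j = i + 1
  · subst h2; exact ⟨1, by rw [art_succ, Equiv.swap_apply_right]; simp⟩
  exact ⟨1, by rw [art_ne h1 h2, Equiv.swap_apply_of_ne_of_ne h1 h2]; simp⟩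

lemma rho_conj (m : ℕ) (b : Br m) (j : ℕ) : ∃ u : F, rho m b (X j) = u * X (pe m b j) * u⁻¹ := by
  induction b using br_induction generalizing j with
  | h1 => exact ⟨1, by simp⟩
  | h2 b i hi ih =>
    obtain ⟨u, hu⟩ := art_conj i j
    obtain ⟨v, hv⟩ := ih (Equiv.swap i (i+1) j)
    refine ⟨rho m b u * v, ?_⟩
    rw [map_mul, MulAut.mul_apply, rho_sg hi, hu, map_mul, map_mul, hv, map_inv, map_mul, pe_sg hi,
      Equiv.Perm.mul_apply]
    group
  | h3 b i hi ih =>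
    obtain ⟨u, hu⟩ := art_conj i (Equiv.swap i (i+1) j)
    rw [Equiv.swap_apply_self] at hu
    obtain ⟨v, hv⟩ := ih (Equiv.swap i (i+1) j)
    have e : (art i)⁻¹ (X j) = (art i)⁻¹ u⁻¹ * X (Equiv.swap i (i+1) j) * (art i)⁻¹ u := by
      have := art_inv_of hu
      rw [← this]
      simp only [map_mul, map_inv]
      group
    refine ⟨rho m b ((art i)⁻¹ u)⁻¹ * v, ?_⟩
    rw [map_mul, MulAut.mul_apply, map_inv, rho_sg hi, e, map_mul, map_mul, hv, map_mul, map_inv (pe m),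
      pe_sg hi, Equiv.Perm.mul_apply, Equiv.swap_inv]
    simp only [map_inv]
    group

lemma X_conj_inj {i j : ℕ} {u v : F} (h : u * X i * u⁻¹ = v * X j * v⁻¹) : i = j := by
  let f : F →* Multiplicative ℤ := FreeGroup.lift fun k => if k = i then Multiplicative.ofAdd 1 else 1
  have := congrArg f h
  by_contra hij
  simp [f, Ne.symm hij] at this

lemma pe_eq_of_rho {m : ℕ} {b : Br m} {j k : ℕ} {u : F} (h : rho m b (X j) = u * X k * u⁻¹) :
    pe m b j = k := by
  obtain ⟨v, hv⟩ := rho_conj m b j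
  exact X_conj_inj (hv.symm.trans h)

/-! group lemmas -/
section grp
variable {G : Type*} [Group G]

lemma g0 {a b : G} (h : a * b * a = b * a * b) : b⁻¹ * (a * a) * b = a * (b * b) * a⁻¹ := by
  rw [eq_mul_inv_iff_mul_eq, mul_assoc, mul_assoc, inv_mul_eq_iff_eq_mul]
  calc a * a * (b * a) = a * (a * b * a) := by group
    _ = a * (b * a * b) := by rw [h]
    _ = (a * b * a) * b := by group
    _ = b * (a * (b * b)) := by rw [h]; group

lemma g0' {a b : G} (h : a * b * a = b * a * b) : b⁻¹ * a⁻¹ * b = a * b⁻¹ * a⁻¹ := by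
  rw [eq_mul_inv_iff_mul_eq, eq_mul_inv_iff_mul_eq, mul_assoc, mul_assoc, mul_assoc,
    inv_mul_eq_iff_eq_mul, inv_mul_eq_iff_eq_mul]
  simp only [← mul_assoc]
  exact h.symm

lemma g1 {a b y : G} (h : a * b * a = b * a * b) (hy : y * a = a * y) :
    y * b⁻¹ * (a * a) * (y * b⁻¹)⁻¹ = a * (y * (b * b) * y⁻¹) * a⁻¹ := by
  calc y * b⁻¹ * (a * a) * (y * b⁻¹)⁻¹ = y * (b⁻¹ * (a * a) * b) * y⁻¹ := by group
    _ = (y * a) * (b * b) * (y * a)⁻¹ := by rw [g0 h]; group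
    _ = _ := by rw [hy]; group

lemma g2 {a b y : G} (h : a * b * a = b * a * b) (hy : y * a = a * y) :
    a * (y * (b * b) * y⁻¹ * (y * b⁻¹ * (a * a) * (y * b⁻¹)⁻¹)) =
    (y * (b * b) * y⁻¹ * (y * b⁻¹ * (a * a) * (y * b⁻¹)⁻¹)) * a := by
  have e : y * (b * b) * y⁻¹ * (y * b⁻¹ * (a * a) * (y * b⁻¹)⁻¹) = y * (b * a * a * b) * y⁻¹ := by
    group
  have hy' : y⁻¹ * a = a * y⁻¹ := by
    rw [inv_mul_eq_iff_eq_mul, ← mul_assoc, hy, mul_inv_cancel_right]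
  have c : a * (b * a * a * b) = (b * a * a * b) * a := by
    calc a * (b * a * a * b) = (a * b * a) * (a * b) := by group
      _ = b * a * (b * a * b) := by rw [h]; group
      _ = (b * a * a * b) * a := by rw [← h]; group
  rw [e]
  calc a * (y * (b * a * a * b) * y⁻¹) = (a * y) * (b * a * a * b) * y⁻¹ := by group
    _ = y * (a * (b * a * a * b)) * y⁻¹ := by rw [← hy]; group
    _ = y * (b * a * a * b) * (a * y⁻¹) := by rw [c]; group
    _ = _ := by rw [← hy']; group

end grp

def Yaux {G : Type*} [Group G] (s : ℕ → G) : ℕ → ℕ → G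
  | _, 0 => 1
  | k, d+1 => Yaux s (k+1) d * (s k)⁻¹

def Y (m k : ℕ) : Br (m+1) := Yaux (sg (m+1)) k (m+1-k)

lemma Y_top (m : ℕ) : Y m (m+1) = 1 := by simp [Y, Yaux]
lemma Y_step {m k : ℕ} (h : k ≤ m) : Y m k = Y m (k+1) * (sg (m+1) k)⁻¹ := by
  have : m + 1 - k = (m + 1 - (k+1)) + 1 := by omega
  rw [Y, this, Yaux, Y]

lemma Y_down {m : ℕ} {p : ℕ → Prop} (h0 : p (m+1)) (h : ∀ k, k ≤ m → p (k+1) → p k) :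
    ∀ k, k ≤ m+1 → p k := by
  have : ∀ d k, k + d = m + 1 → p k := by
    intro d
    induction d with
    | zero => intro k hk; obtain rfl : k = m+1 := by omega
              exact h0
    | succ d ih => intro k hk; exact h k (by omega) (ih (k+1) (by omega))
  intro k hk
  exact this (m+1-k) k (by omega)

lemma comm_inv {G : Type*} [Group G] {a b : G} (h : a * b = b * a) : a⁻¹ * b = b * a⁻¹ :=
  (Commute.inv_left (show Commute a b from h)).eq

lemma Y_comm {m : ℕ} (k : ℕ) (hk : k ≤ m+1) : ∀ j, j + 1 < k →
    Y m k * sg (m+1) j = sg (m+1) j * Y m k := by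
  refine Y_down (p := fun k => ∀ j, j + 1 < k →
    Y m k * sg (m+1) j = sg (m+1) j * Y m k) ?_ ?_ k hk
  · intro j _; simp [Y_top]
  · intro k hk ih j hj
    rw [Y_step hk, mul_assoc, comm_inv (sg_comm (m+1) j k (by omega)).symm, ← mul_assoc,
      ih j (by omega), mul_assoc]

lemma Y_shift {m : ℕ} (k : ℕ) (hk : k ≤ m+1) : ∀ j, k ≤ j → j < m →
    Y m k * sg (m+1) (j+1) = sg (m+1) j * Y m k := by
  refine Y_down (p := fun k => ∀ j, k ≤ j → j < m →
    Y m k * sg (m+1) (j+1) = sg (m+1) j * Y m k) ?_ ?_ k hk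
  · intro j _ _; omega
  · intro k hk ih j hj hjm
    by_cases hjk : j = k
    · subst hjk
      have e := g0' (sg_braid (m+1) j (by omega))
      rw [Y_step hk, Y_step (k := j+1) (by omega)]
      calc _ = Y m (j+1+1) * ((sg (m+1) (j+1))⁻¹ * (sg (m+1) j)⁻¹ * sg (m+1) (j+1)) := by group
        _ = (Y m (j+1+1) * sg (m+1) j) * (sg (m+1) (j+1))⁻¹ * (sg (m+1) j)⁻¹ := by rw [e]; group
        _ = _ := by rw [Y_comm (j+1+1) (by omega) j (by omega)]; group
    · rw [Y_step hk, mul_assoc, comm_inv (sg_comm (m+1) k (j+1) (by omega)), ← mul_assoc,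
        ih j (by omega) hjm, mul_assoc]

def A (m k : ℕ) : Br (m+1) :=
  Y m (k+1) * (sg (m+1) k * sg (m+1) k) * (Y m (k+1))⁻¹

lemma A_step {m k : ℕ} (h : k < m) : A m k = sg (m+1) k * A m (k+1) * (sg (m+1) k)⁻¹ := by
  rw [A, A, Y_step (k := k+1) (by omega)]
  exact g1 (sg_braid (m+1) k (by omega)) (Y_comm _ (by omega) _ (by omega))

lemma A_prod {m k : ℕ} (h : k < m) :
    sg (m+1) k * (A m (k+1) * A m k) = (A m (k+1) * A m k) * sg (m+1) k := by
  rw [A, A, Y_step (k := k+1) (by omega)]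
  exact g2 (sg_braid (m+1) k (by omega)) (Y_comm _ (by omega) _ (by omega))

lemma A_top (m : ℕ) : A m m = sg (m+1) m * sg (m+1) m := by
  simp [A, Y_top]

lemma A_comm {m k j : ℕ} (hk : k ≤ m) (hj : j < m) (h1 : j ≠ k) (h2 : j + 1 ≠ k) :
    sg (m+1) j * A m k = A m k * sg (m+1) j := by
  rcases lt_or_gt_of_ne h1 with h | h
  · have e1 : Commute (sg (m+1) j) (Y m (k+1)) := (Y_comm _ (by omega) _ (by omega)).symm
    have e2 : Commute (sg (m+1) j) (sg (m+1) k) := sg_comm _ _ _ (by omega)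
    exact ((e1.mul_right (e2.mul_right e2)).mul_right e1.inv_right).eq
  · have e1 := Y_shift (m := m) (k+1) (by omega) j (by omega) (by omega)
    have e2 : Commute (sg (m+1) k) (sg (m+1) (j+1)) := sg_comm _ _ _ (by omega)
    have e3 := (e2.mul_left e2).eq
    have e4 : (Y m (k+1))⁻¹ * sg (m+1) j = sg (m+1) (j+1) * (Y m (k+1))⁻¹ := by
      rw [inv_mul_eq_iff_eq_mul, ← mul_assoc, e1, mul_inv_cancel_right]
    rw [A]
    simp only [← mul_assoc]
    rw [← e1, mul_assoc _ _ (sg (m+1) j), e4]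
    simp only [← mul_assoc] at e3 ⊢
    congr 1
    simp only [mul_assoc] at e3 ⊢
    rw [e3]

def al (m : ℕ) : F →* Br (m+1) := FreeGroup.lift fun k => if k ≤ m then (A m k)⁻¹ else 1
lemma al_le {m k : ℕ} (h : k ≤ m) : al m (X k) = (A m k)⁻¹ := by simp [al, h]
lemma al_gt {m k : ℕ} (h : m < k) : al m (X k) = 1 := by simp [al, not_le.2 h]

lemma al_art {m j : ℕ} (hj : j < m) (x : F) :
    al m (art j x) = sg (m+1) j * al m x * (sg (m+1) j)⁻¹ := by
  have : (al m).comp (art j).toMonoidHom =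
      (MulAut.conj (sg (m+1) j)).toMonoidHom.comp (al m) := by
    ext k
    simp only [MonoidHom.comp_apply, MulEquiv.coe_toMonoidHom, MulAut.conj_apply]
    by_cases h1 : k = j
    · subst h1
      rw [art_self, map_mul, map_mul, map_inv, al_le (by omega), al_le (by omega)]
      have e := A_prod hj
      have e' := A_step hj
      have : A m (k+1) = (sg (m+1) k)⁻¹ * A m k * sg (m+1) k := by rw [e']; group
      have e2 : (A m k)⁻¹ * A m (k+1) * A m k = sg (m+1) k * A m k * (sg (m+1) k)⁻¹ := by
        rw [eq_mul_inv_iff_mul_eq, mul_assoc, mul_assoc, inv_mul_eq_iff_eq_mul, ← mul_assoc, ← e]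
        nth_rw 2 [e']
        group
      have := congrArg (·⁻¹) e2
      simp only [mul_inv_rev, inv_inv] at this ⊢
      simp only [← mul_assoc] at this ⊢
      exact this
    by_cases h2 : k = j + 1
    · subst h2
      rw [art_succ, al_le (by omega), al_le (by omega), A_step hj]
      group
    rw [art_ne h1 h2]
    by_cases h3 : k ≤ m
    · rw [al_le h3, eq_mul_inv_iff_mul_eq]
      exact comm_inv (A_comm h3 hj (Ne.symm h1) (Ne.symm h2)).symm
    · rw [al_gt (by omega)]; simp
  exact DFunLike.congr_fun this x

lemma al_rho {m : ℕ} (c : Br m) (x : F) :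
    al m (rho m c x) = io m c * al m x * (io m c)⁻¹ := by
  induction c using br_induction generalizing x with
  | h1 => simp
  | h2 b i hi ih =>
    rw [map_mul, MulAut.mul_apply, ih, rho_sg hi, al_art hi, map_mul, io_sg hi]; group
  | h3 b i hi ih =>
    have : al m ((art i)⁻¹ x) = (sg (m+1) i)⁻¹ * al m x * sg (m+1) i := by
      have := al_art hi ((art i)⁻¹ x)
      rw [show art i ((art i)⁻¹ x) = x from (art i).apply_symm_apply x] at this
      rw [this]; group
    rw [map_mul, MulAut.mul_apply, ih, map_inv, rho_sg hi, this, map_mul, map_inv, io_sg hi]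
    group

lemma al_kil (m : ℕ) (x : F) : al m (kil (m+1) x) = al m x := by
  have : (al m).comp (kil (m+1)) = al m := by
    ext j
    by_cases h : j < m+1
    · simp [kil_lt h]
    · simp [kil_ge (not_lt.1 h), al_gt (show m < j by omega)]
  exact DFunLike.congr_fun this x

/-- coset decomposition -/
lemma decomp0 {m : ℕ} (b : Br (m+1)) : ∃ (w : F) (c : Br m) (k : ℕ), k ≤ m+1 ∧
    b = al m w * io m c * Y m k := by
  have hal : ∀ (w : F) (c : Br m) (v : F), al m w * io m c * al m v =
      al m (w * rho m c v) * io m c := by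
    intro w c v
    rw [map_mul, al_rho]; group
  induction b using br_induction with
  | h1 => exact ⟨1, 1, m+1, le_rfl, by simp [Y_top]⟩
  | h2 b i hi ih =>
    obtain ⟨w, c, k, hk, rfl⟩ := ih
    by_cases h1 : i = k
    · subst h1
      exact ⟨w, c, i+1, by omega, by rw [Y_step (by omega)]; group⟩
    by_cases h2 : i + 1 = k
    · subst h2
      refine ⟨w * rho m c (X i)⁻¹, c, i, by omega, ?_⟩
      rw [← hal, map_inv, al_le (by omega), inv_inv, A, Y_step (k := i) (by omega)]
      group
    by_cases h3 : i < k
    · refine ⟨w, c * sg m i, k, hk, ?_⟩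
      rw [map_mul, io_sg (by omega), mul_assoc, Y_comm k hk i (by omega)]
      group
    · obtain ⟨j, rfl⟩ : ∃ j, i = j + 1 := ⟨i-1, by omega⟩
      refine ⟨w, c * sg m j, k, hk, ?_⟩
      rw [map_mul, io_sg (by omega), mul_assoc, Y_shift k hk j (by omega) (by omega)]
      group
  | h3 b i hi ih =>
    obtain ⟨w, c, k, hk, rfl⟩ := ih
    by_cases h1 : i = k
    · subst h1
      refine ⟨w * rho m c (X i), c, i+1, by omega, ?_⟩
      rw [← hal, al_le (by omega), A, Y_step (k := i) (by omega)]
      group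
    by_cases h2 : i + 1 = k
    · subst h2
      exact ⟨w, c, i, by omega, by rw [Y_step (k := i) (by omega)]; group⟩
    by_cases h3 : i < k
    · refine ⟨w, c * (sg m i)⁻¹, k, hk, ?_⟩
      rw [map_mul, map_inv, io_sg (by omega), mul_assoc,
        ← comm_inv (Y_comm k hk i (by omega)).symm]
      group
    · obtain ⟨j, rfl⟩ : ∃ j, i = j + 1 := ⟨i-1, by omega⟩
      refine ⟨w, c * (sg m j)⁻¹, k, hk, ?_⟩
      have e := Y_shift k hk j (by omega) (by omega)
      have : Y m k * (sg (m+1) (j+1))⁻¹ = (sg (m+1) j)⁻¹ * Y m k := by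
        rw [mul_inv_eq_iff_eq_mul, mul_assoc, e, inv_mul_cancel_left]
      rw [map_mul, map_inv, io_sg (by omega), mul_assoc, this]
      group

lemma rho_Y_top {m : ℕ} (k : ℕ) (hk : k ≤ m+1) : rho (m+1) (Y m k) (X k) = X (m+1) := by
  refine Y_down (p := fun k => rho (m+1) (Y m k) (X k) = X (m+1)) (by simp [Y_top]) ?_ k hk
  intro k hk ih
  rw [Y_step hk, map_mul, MulAut.mul_apply, map_inv, rho_sg (by omega), art_inv_of (art_succ k), ih]

lemma rho_Y_lt {m : ℕ} (k : ℕ) (hk : k ≤ m+1) : ∀ j, j < k → rho (m+1) (Y m k) (X j) = X j := by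
  refine Y_down (p := fun k => ∀ j, j < k → rho (m+1) (Y m k) (X j) = X j) (by simp [Y_top]) ?_ k hk
  intro k hk ih j hj
  rw [Y_step hk, map_mul, MulAut.mul_apply, map_inv, rho_sg (by omega),
    art_inv_of (art_ne (by omega) (by omega)), ih j (by omega)]

lemma pe_Y {m : ℕ} (k : ℕ) (hk : k ≤ m+1) : pe (m+1) (Y m k) k = m+1 :=
  pe_eq_of_rho (u := 1) (by rw [rho_Y_top k hk]; simp)

lemma art_sq_kill {i : ℕ} {G : Type*} [Group G] (f : F →* G) (h : f (X (i+1)) = 1) (x : F) :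
    f (art i (art i x)) = f x := by
  have : f.comp ((art i).toMonoidHom.comp (art i).toMonoidHom) = f := by
    ext k
    simp only [MonoidHom.comp_apply, MulEquiv.coe_toMonoidHom]
    by_cases h1 : k = i
    · subst h1
      simp [art_self, art_succ, h]
    by_cases h2 : k = i + 1
    · subst h2
      simp [art_self, art_succ, h]
    simp [art_ne h1 h2]
  exact DFunLike.congr_fun this x

lemma kil_A {m k : ℕ} (hk : k ≤ m) (x : F) : kil (m+1) (rho (m+1) (A m k) x) = kil (m+1) x := by
  have := art_sq_kill (i := k) ((kil (m+1)).comp (rho (m+1) (Y m (k+1))).toMonoidHom)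
    (by simp [rho_Y_top (k+1) (show k+1 ≤ m+1 by omega), kil_ge]) ((rho (m+1) (Y m (k+1)))⁻¹ x)
  simp only [MonoidHom.comp_apply, MulEquiv.coe_toMonoidHom] at this
  rw [show (rho (m+1) (Y m (k+1))) ((rho (m+1) (Y m (k+1)))⁻¹ x) = x from
    (rho (m+1) (Y m (k+1))).apply_symm_apply x] at this
  rw [← this, A]
  simp [rho_sg (show k < m+1 by omega)]

lemma kil_al {m : ℕ} (w x : F) : kil (m+1) (rho (m+1) (al m w) x) = kil (m+1) x := by
  induction w using FreeGroup.induction_on generalizing x with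
  | C1 => simp
  | of k =>
    change kil (m+1) (rho (m+1) (al m (X k)) x) = _
    by_cases hk : k ≤ m
    · rw [al_le hk, ← kil_A hk, ← MulAut.mul_apply, ← map_mul]; simp
    · rw [al_gt (by omega)]; simp
  | inv_of k ih =>
    rw [← ih, ← MulAut.mul_apply, ← map_mul, ← map_mul]
    simp
  | mul v w hv hw => rw [map_mul, map_mul, MulAut.mul_apply, hv, hw]

lemma rho_A_top {m k : ℕ} (hk : k ≤ m) :
    rho (m+1) (A m k) (X (m+1)) = X k * X (m+1) * (X k)⁻¹ := by
  have e := rho_Y_top (m := m) (k+1) (by omega)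
  have e2 := rho_Y_lt (m := m) (k+1) (by omega) k (by omega)
  have e3 : (rho (m+1) (Y m (k+1)))⁻¹ (X (m+1)) = X (k+1) := by
    rw [← e]; exact (rho (m+1) (Y m (k+1))).symm_apply_apply _
  rw [A]
  simp only [map_mul, map_inv, MulAut.mul_apply, e3, rho_sg (show k < m+1 by omega), art_succ,
    art_self, e, e2]

lemma al_u {m : ℕ} (w : F) : ∃ u : F, rho (m+1) (al m w) (X (m+1)) = u * X (m+1) * u⁻¹ ∧
    kil (m+1) u = (kil (m+1) w)⁻¹ := by
  have hA : ∀ k, ∃ u : F, rho (m+1) (al m (X k)⁻¹) (X (m+1)) = u * X (m+1) * u⁻¹ ∧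
    kil (m+1) u = (kil (m+1) (X k)⁻¹)⁻¹ := by
    intro k
    by_cases hk : k ≤ m
    · exact ⟨X k, by rw [map_inv, al_le hk, inv_inv, rho_A_top hk], by simp⟩
    · exact ⟨1, by rw [map_inv, al_gt (by omega)]; simp, by simp [kil_ge (show m+1 ≤ k by omega)]⟩
  have hinv : ∀ v : F, (∃ u : F, rho (m+1) (al m v) (X (m+1)) = u * X (m+1) * u⁻¹ ∧
    kil (m+1) u = (kil (m+1) v)⁻¹) → (∃ u : F, rho (m+1) (al m v⁻¹) (X (m+1)) = u * X (m+1) * u⁻¹ ∧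
    kil (m+1) u = (kil (m+1) v⁻¹)⁻¹) := by
    rintro v ⟨u, h1, h2⟩
    refine ⟨rho (m+1) (al m v⁻¹) u⁻¹, ?_, ?_⟩
    · have : X (m+1) = rho (m+1) (al m v⁻¹) (u * X (m+1) * u⁻¹) := by
        rw [← h1, ← MulAut.mul_apply, ← map_mul, ← map_mul]; simp
      simp only [map_mul] at this
      simp only [map_inv] at this ⊢
      nth_rw 2 [this]
      group
    · rw [kil_al, map_inv, h2, map_inv]
  induction w using FreeGroup.induction_on with
  | C1 => exact ⟨1, by simp, by simp⟩
  | of k =>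
    have := hinv _ (hA k)
    rwa [inv_inv] at this
  | inv_of k _ => exact hA k
  | mul v w hv hw =>
    obtain ⟨u1, h1, h2⟩ := hv
    obtain ⟨u2, h3, h4⟩ := hw
    refine ⟨rho (m+1) (al m v) u2 * u1, ?_, ?_⟩
    · rw [map_mul, map_mul, MulAut.mul_apply, h3, map_mul, map_mul, h1, map_inv]; group
    · rw [map_mul, kil_al, h2, h4, map_mul, mul_inv_rev]

/-- action detecting the centralizer of `x_M` -/
def thG (M j : ℕ) : Equiv.Perm (F × Bool) :=
  if j < M then Equiv.prodCongr (Equiv.mulLeft (X j)) (Equiv.refl _)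
  else if j = M then Equiv.swap (1, false) (1, true) else 1
def th (M : ℕ) : F →* Equiv.Perm (F × Bool) := FreeGroup.lift (thG M)

lemma th_top (M : ℕ) : th M (X M) = Equiv.swap (1, false) (1, true) := by
  simp [th, thG]

lemma th_fst (M : ℕ) (u : F) (q : F × Bool) : (th M u q).1 = kil M u * q.1 := by
  have h1 : ∀ k (q : F × Bool), (th M (X k) q).1 = kil M (X k) * q.1 := by
    intro k q
    rcases lt_trichotomy k M with h | h | h
    · rw [kil_lt h]; simp [th, thG, h]
    · subst h
      rw [th_top, kil_ge le_rfl, one_mul, Equiv.swap_apply_def]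
      split_ifs with h1 h2
      · rw [h1]
      · rw [h2]
      · rfl
    · rw [kil_ge h.le]; simp [th, thG, not_lt.2 h.le, h.ne']
  induction u using FreeGroup.induction_on generalizing q with
  | C1 => simp
  | of k => exact h1 k q
  | inv_of k ih =>
    have := ih ((th M (FreeGroup.of k)⁻¹) q)
    have e : th M (FreeGroup.of k) ((th M (FreeGroup.of k)⁻¹) q) = q := by
      rw [← Equiv.Perm.mul_apply, ← map_mul]; simp
    rw [e] at this
    rw [this, map_inv]; simp
  | mul v w hv hw => rw [map_mul, Equiv.Perm.mul_apply, hv, hw, map_mul, mul_assoc]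

lemma kil_of_comm {M : ℕ} {u : F} (h : u * X M * u⁻¹ = X M) : kil M u = 1 := by
  have h' : u * X M = X M * u := by rw [← mul_inv_eq_iff_eq_mul]; exact h
  have := congrArg (fun z => th M z (1, false)) h'
  simp only [map_mul, Equiv.Perm.mul_apply, th_top, Equiv.swap_apply_left] at this
  by_contra hne
  have hf := th_fst M u (1, false)
  rw [Equiv.swap_apply_of_ne_of_ne] at this
  · have := (th M u).injective this
    simp at this
  · intro e; rw [e] at hf; simp at hf; exact hne hf.symm
  · intro e; rw [e] at hf; simp at hf; exact hne hf.symm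

lemma al_inj {m : ℕ} {w : F} (h : al m w = 1) : kil (m+1) w = 1 := by
  obtain ⟨u, h1, h2⟩ := al_u (m := m) w
  rw [h, map_one, MulAut.one_apply] at h1
  rw [kil_of_comm h1.symm] at h2
  simpa using h2.symm

lemma pe_last {m : ℕ} (w : F) (c : Br m) : pe (m+1) (al m w * io m c) (m+1) = m+1 := by
  have h1 : pe (m+1) (io m c) (m+1) = m+1 :=
    pe_eq_of_rho (u := 1) (by rw [rho_io, rho_fix m c (by omega)]; simp)
  rw [map_mul, Equiv.Perm.mul_apply, h1]
  obtain ⟨u, hu, _⟩ := al_u (m := m) w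
  exact pe_eq_of_rho hu

lemma decomp {m : ℕ} (b : Br (m+1)) (hb : pe (m+1) b (m+1) = m+1) : ∃ (w : F) (c : Br m),
    kil (m+1) w = w ∧ b = al m w * io m c := by
  obtain ⟨w, c, k, hk, rfl⟩ := decomp0 b
  have h1 := pe_last w c
  have : k = m+1 := by
    apply (pe (m+1) (al m w * io m c * Y m k)).injective
    rw [hb, map_mul, Equiv.Perm.mul_apply, pe_Y k hk, h1]
  subst this
  exact ⟨kil (m+1) w, c, kil_kil _ _, by rw [al_kil, Y_top, mul_one]⟩

theorem faithful (m : ℕ) : ∀ b : Br m, (∀ j, j ≤ m → rho m b (X j) = X j) → b = 1 := by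
  induction m with
  | zero =>
    intro b _
    induction b using br_induction with
    | h1 => rfl
    | h2 b i hi => omega
    | h3 b i hi => omega
  | succ m ih =>
    intro b hb
    obtain ⟨w, c, hw, rfl⟩ := decomp b (pe_eq_of_rho (u := 1) (by rw [hb _ le_rfl]; simp))
    have hc : c = 1 := by
      apply ih
      intro j hj
      have := congrArg (kil (m+1)) (hb j (by omega))
      rw [map_mul, MulAut.mul_apply, kil_al, rho_io, ← rho_kil m c (by omega),
        kil_lt (by omega)] at this
      exact this
    subst hc
    obtain ⟨u, h1, h2⟩ := al_u (m := m) w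
    have := hb (m+1) le_rfl
    rw [map_one, mul_one, h1] at this
    rw [kil_of_comm this, hw] at h2
    have : w = 1 := by simpa using h2.symm
    simp [this]

lemma centralizer_X (a : ℕ) : ∀ (d : ℕ) (w : F), w.toWord.length ≤ d → w * X a = X a * w →
    ∃ i : ℤ, w = X a ^ i := by
  intro d
  induction d with
  | zero =>
    intro w hw _
    have : w.toWord = [] := List.length_eq_zero_iff.1 (by omega)
    rw [FreeGroup.toWord_eq_nil_iff] at this
    exact ⟨0, by simp [this]⟩
  | succ d ih =>
    intro w hw hc
    rcases hL : w.toWord with _ | ⟨⟨b, e⟩, L⟩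
    · rw [FreeGroup.toWord_eq_nil_iff] at hL
      exact ⟨0, by simp [hL]⟩
    have hw' : w = FreeGroup.mk [(b, e)] * FreeGroup.mk L := by
      rw [FreeGroup.mul_mk, List.singleton_append, ← hL, FreeGroup.mk_toWord]
    by_cases hb : b = a
    · subst hb
      have hlen : (FreeGroup.mk L).toWord.length ≤ d := by
        have := FreeGroup.norm_mk_le (L₁ := L)
        rw [hL] at hw
        simp only [List.length_cons] at hw
        exact this.trans (by omega)
      obtain ⟨s, hs⟩ : ∃ s : ℤ, (FreeGroup.mk [(b, e)] : F) = X b ^ s := by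
        cases e
        · exact ⟨-1, by rw [zpow_neg_one]; rfl⟩
        · exact ⟨1, by rw [zpow_one]; rfl⟩
      rw [hs] at hw'
      have hc' : FreeGroup.mk L * X b = X b * FreeGroup.mk L := by
        have e : FreeGroup.mk L = (X b ^ s)⁻¹ * w := by rw [hw']; group
        rw [e, mul_assoc, hc]; group
      obtain ⟨i, hi⟩ := ih _ hlen hc'
      exact ⟨s + i, by rw [hw', hi, zpow_add]⟩
    · exfalso
      have h1 : (X a * w).toWord = (a, true) :: w.toWord := by
        rw [FreeGroup.toWord_mul, FreeGroup.toWord_of, List.singleton_append, FreeGroup.reduce.cons,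
          FreeGroup.reduce_toWord, hL]
        simp [Ne.symm hb]
      have h2 := FreeGroup.toWord_mul_sublist w (X a)
      rw [hc, h1, FreeGroup.toWord_of] at h2
      have h3 := h2.eq_of_length (by simp)
      rw [hL] at h3
      simp at h3
      exact hb h3.1.1.symm

lemma centralizer_P (k : ℕ) (w : F) (h : w * P (k+1) = P (k+1) * w) : ∃ i : ℤ, w = P (k+1) ^ i := by
  let t : F →* F := FreeGroup.lift fun j => if j = k then (P k)⁻¹ * X k else X j
  let t' : F →* F := FreeGroup.lift fun j => if j = k then P k * X k else X j
  have ht : ∀ j, j ≤ k → t (P j) = P j ∧ t' (P j) = P j := by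
    intro j
    induction j with
    | zero => intro _; simp [P]
    | succ j ih =>
      intro hj
      obtain ⟨h1, h2⟩ := ih (by omega)
      have hne : j ≠ k := by omega
      constructor
      · rw [P, map_mul, h1]; simp [t, hne]
      · rw [P, map_mul, h2]; simp [t', hne]
  have e1 : t (P (k+1)) = X k := by
    rw [P, map_mul, (ht k le_rfl).1]; simp [t]
  have e2 : ∀ x, t' (t x) = x := by
    intro x
    have : t'.comp t = MonoidHom.id F := by
      ext j
      by_cases hj : j = k
      · subst hj
        have : t (FreeGroup.of j) = (P j)⁻¹ * X j := by simp [t]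
        rw [MonoidHom.comp_apply, this, map_mul, map_inv, (ht j le_rfl).2]; simp [t']
      · simp [t, t', hj]
    exact DFunLike.congr_fun this x
  obtain ⟨i, hi⟩ := centralizer_X k _ (t w) le_rfl (by rw [← e1, ← map_mul, h, map_mul])
  refine ⟨i, ?_⟩
  rw [← e2 w, hi, map_zpow, ← e1, e2]

/-! products -/
def pr {G : Type*} [Group G] (t : ℕ → G) : ℕ → G
  | 0 => 1
  | k+1 => pr t k * t k
def pl {G : Type*} [Group G] (t : ℕ → G) : ℕ → G
  | 0 => 1
  | k+1 => t k * pl t k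

lemma pr_ofFn {G : Type*} [Group G] (t : ℕ → G) (k : ℕ) :
    (List.ofFn fun i : Fin k => t i).prod = pr t k := by
  induction k with
  | zero => simp [pr]
  | succ k ih => rw [List.ofFn_succ', List.concat_eq_append, List.prod_append, pr, ← ih]; simp
lemma pl_ofFn {G : Type*} [Group G] (t : ℕ → G) (k : ℕ) :
    (List.ofFn fun i : Fin k => t i).reverse.prod = pl t k := by
  induction k with
  | zero => simp [pl]
  | succ k ih =>
    rw [List.ofFn_succ', List.concat_eq_append, List.reverse_append, List.prod_append, pl, ← ih]
    simp

lemma pr_map {G H : Type*} [Group G] [Group H] (f : G →* H) {t : ℕ → G} {u : ℕ → H} {k : ℕ}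
    (h : ∀ i, i < k → f (t i) = u i) : f (pr t k) = pr u k := by
  induction k with
  | zero => simp [pr]
  | succ k ih => rw [pr, pr, map_mul, ih (fun i hi => h i (by omega)), h k (by omega)]
lemma pl_map {G H : Type*} [Group G] [Group H] (f : G →* H) {t : ℕ → G} {u : ℕ → H} {k : ℕ}
    (h : ∀ i, i < k → f (t i) = u i) : f (pl t k) = pl u k := by
  induction k with
  | zero => simp [pl]
  | succ k ih => rw [pl, pl, map_mul, ih (fun i hi => h i (by omega)), h k (by omega)]

lemma D_gt (k : ℕ) {j : ℕ} (h : k < j) : pr art k (X j) = X j := by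
  induction k with
  | zero => simp [pr]
  | succ k ih => rw [pr, MulAut.mul_apply, art_ne (by omega) (by omega), ih (by omega)]
lemma D_top (k : ℕ) : pr art k (X k) = X 0 := by
  induction k with
  | zero => simp [pr]
  | succ k ih => rw [pr, MulAut.mul_apply, art_succ, ih]
lemma D_lt (k : ℕ) {j : ℕ} (h : j < k) : pr art k (X j) = X 0 * X (j+1) * (X 0)⁻¹ := by
  induction k with
  | zero => omega
  | succ k ih =>
    rw [pr, MulAut.mul_apply]
    by_cases hj : j = k
    · subst hj
      rw [art_self, map_mul, map_mul, map_inv, D_top, D_gt _ (by omega)]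
    · rw [art_ne (by omega) (by omega), ih (by omega)]
lemma E_gt (k : ℕ) {j : ℕ} (h : k < j) : pl art k (X j) = X j := by
  induction k with
  | zero => simp [pl]
  | succ k ih => rw [pl, MulAut.mul_apply, ih (by omega), art_ne (by omega) (by omega)]
lemma E_zero (k : ℕ) : pl art k (X 0) = P k * X k * (P k)⁻¹ := by
  induction k with
  | zero => simp [pl, P]
  | succ k ih =>
    rw [pl, MulAut.mul_apply, ih, map_mul, map_mul, map_inv, art_P (by omega), art_self, P]
    group
lemma E_succ (k : ℕ) {j : ℕ} (h : j < k) : pl art k (X (j+1)) = X j := by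
  induction k with
  | zero => omega
  | succ k ih =>
    rw [pl, MulAut.mul_apply]
    by_cases hj : j = k
    · subst hj
      rw [E_gt _ (by omega), art_succ]
    · rw [ih (by omega), art_ne (by omega) (by omega)]

lemma rho_pr (m : ℕ) : rho m (pr (sg m) m) = pr art m := pr_map _ (fun i hi => rho_sg hi)
lemma rho_pl (m : ℕ) : rho m (pl (sg m) m) = pl art m := pl_map _ (fun i hi => rho_sg hi)

lemma D_pow (m i : ℕ) (hi : i ≤ m+1) : ∀ j, j ≤ m → (pr art m ^ i) (X j) =
    P i * X ((j+i) % (m+1)) * (P i)⁻¹ := by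
  induction i with
  | zero => intro j hj; simp [P, Nat.mod_eq_of_lt (show j < m+1 by omega)]
  | succ i ih =>
    intro j hj
    have e0 : pr art m (X j) = X 0 * X ((j+1) % (m+1)) * (X 0)⁻¹ := by
      by_cases h : j = m
      · subst h; rw [D_top]; simp
      · rw [D_lt m (by omega), Nat.mod_eq_of_lt (by omega)]
    have e1 := ih (by omega) 0 (by omega)
    rw [zero_add, Nat.mod_eq_of_lt (by omega)] at e1
    have e2 := ih (by omega) ((j+1) % (m+1)) (Nat.lt_succ_iff.1 (Nat.mod_lt _ (by omega)))
    rw [Nat.mod_add_mod, show j + 1 + i = j + (i+1) by ring] at e2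
    rw [pow_succ, MulAut.mul_apply, e0, map_mul, map_mul, map_inv, e1, e2, P]
    group

/-- full twist -/
def ft (m : ℕ) : Br m := pr (sg m) m ^ (m+1)

lemma rho_ft (m : ℕ) {j : ℕ} (hj : j ≤ m) :
    rho m (ft m) (X j) = P (m+1) * X j * (P (m+1))⁻¹ := by
  rw [ft, map_pow, rho_pr, D_pow m _ le_rfl j hj, Nat.add_mod_right, Nat.mod_eq_of_lt (by omega)]

lemma rho_ft_kil (m : ℕ) (x : F) :
    rho m (ft m) (kil (m+1) x) = P (m+1) * kil (m+1) x * (P (m+1))⁻¹ := by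
  have : (rho m (ft m)).toMonoidHom.comp (kil (m+1)) =
      (MulAut.conj (P (m+1))).toMonoidHom.comp (kil (m+1)) := by
    ext j
    simp only [MonoidHom.comp_apply, MulEquiv.coe_toMonoidHom, MulAut.conj_apply]
    by_cases h : j < m+1
    · rw [kil_lt h, rho_ft m (by omega)]
    · rw [kil_ge (not_lt.1 h)]; simp
  exact DFunLike.congr_fun this x

lemma faithful' {m : ℕ} {a b : Br m} (h : ∀ j, j ≤ m → rho m a (X j) = rho m b (X j)) : a = b := by
  rw [← inv_mul_eq_one]
  apply faithful
  intro j hj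
  rw [map_mul, MulAut.mul_apply, ← h j hj, ← MulAut.mul_apply, ← map_mul]
  simp

lemma ft_comm {m : ℕ} (b : Br m) : ft m * b = b * ft m := by
  apply faithful'
  intro j hj
  rw [map_mul, map_mul, MulAut.mul_apply, MulAut.mul_apply, rho_ft m hj]
  have : rho m b (X j) = kil (m+1) (rho m b (X j)) := by
    rw [← rho_kil m b (by omega), kil_lt (by omega)]
  rw [this, rho_ft_kil, ← this, map_mul, map_mul, map_inv, rho_P m b (by omega)]

lemma rho_ft_zpow (m : ℕ) {j : ℕ} (hj : j ≤ m) (i : ℤ) :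
    rho m (ft m ^ i) (X j) = P (m+1) ^ i * X j * (P (m+1) ^ i)⁻¹ := by
  induction i using Int.induction_on with
  | zero => simp
  | succ i ih =>
    rw [zpow_add_one, map_mul, MulAut.mul_apply, rho_ft m hj, map_mul, map_mul, map_inv, ih,
      rho_P m _ (by omega)]
    group
  | pred i ih =>
    have e : rho m (ft m)⁻¹ (X j) = (P (m+1))⁻¹ * X j * P (m+1) := by
      have h1 : rho m (ft m)⁻¹ (rho m (ft m) (X j)) = X j := by
        rw [← MulAut.mul_apply, ← map_mul]; simp
      rw [rho_ft m hj, map_mul, map_mul, map_inv _ (P (m+1)), rho_P m _ (by omega)] at h1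
      nth_rw 2 [← h1]
      group
    rw [zpow_sub_one, map_mul, MulAut.mul_apply, e, map_mul, map_mul, map_inv _ (P (m+1)), ih,
      rho_P m _ (by omega)]
    group

lemma inner_pow {m : ℕ} {c : Br m} {w : F} (h : ∀ j, j ≤ m → rho m c (X j) = w⁻¹ * X j * w) :
    ∃ i : ℤ, w = P (m+1) ^ i ∧ c = ft m ^ (-i) := by
  have hP : ∀ k, k ≤ m + 1 → rho m c (P k) = w⁻¹ * P k * w := by
    intro k
    induction k with
    | zero => intro _; simp [P]
    | succ k ih => intro hk; rw [P, map_mul, ih (by omega), h k (by omega)]; group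
  have h1 := hP (m+1) le_rfl
  rw [rho_P m c (by omega)] at h1
  obtain ⟨i, hi⟩ := centralizer_P m w (by nth_rw 1 [h1]; group)
  refine ⟨i, hi, ?_⟩
  apply faithful'
  intro j hj
  rw [h j hj, rho_ft_zpow m hj, hi]
  group

lemma dg_pr (m : ℕ) {k : ℕ} (hk : k ≤ m) : dg m (pr (sg m) k) = Multiplicative.ofAdd (k : ℤ) := by
  induction k with
  | zero => simp [pr]
  | succ k ih => rw [pr, map_mul, ih (by omega), dg_sg (by omega), ← ofAdd_add]; simp

lemma dg_ft (m : ℕ) : dg m (ft m) = Multiplicative.ofAdd (((m+1) * m : ℕ) : ℤ) := by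
  rw [ft, map_pow, dg_pr m le_rfl, ← ofAdd_nsmul]; simp

lemma dg_al_P (m : ℕ) {k : ℕ} (hk : k ≤ m+1) :
    dg (m+1) (al m (P k)) = Multiplicative.ofAdd (-(2 * k : ℤ)) := by
  induction k with
  | zero => simp [P]
  | succ k ih =>
    rw [P, map_mul, map_mul, ih (by omega), al_le (by omega), A]
    simp only [map_inv, map_mul, dg_sg (show k < m+1 by omega)]
    rw [mul_inv_cancel_comm, ← ofAdd_add, ← ofAdd_neg, ← ofAdd_add]
    congr 1
    push_cast; ring

theorem center_eq {m : ℕ} (hm : 1 ≤ m) :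
    Subgroup.center (Br (m+1)) = Subgroup.zpowers (ft (m+1)) := by
  let z : Br (m+1) := al m (P (m+1)) * (io m (ft m))⁻¹
  have hzc : Commute (al m (P (m+1))) (io m (ft m))⁻¹ := by
    apply Commute.inv_right
    have := al_rho (ft m) (P (m+1))
    rw [rho_P m _ (by omega), eq_mul_inv_iff_mul_eq] at this
    exact this
  have key : ∀ b : Br (m+1), b ∈ Subgroup.center (Br (m+1)) → ∃ i : ℤ, b = z ^ i := by
    intro b hb
    rw [Subgroup.mem_center_iff] at hb
    have hperm : pe (m+1) b (m+1) = m+1 := by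
      have c1 : ∀ i, i < m+1 → ∀ x, Equiv.swap i (i+1) (pe (m+1) b x) =
          pe (m+1) b (Equiv.swap i (i+1) x) := by
        intro i hi x
        rw [← pe_sg hi, ← Equiv.Perm.mul_apply, ← Equiv.Perm.mul_apply, ← map_mul, ← map_mul,
          hb]
      obtain ⟨n, rfl⟩ : ∃ n, m = n + 1 := ⟨m-1, by omega⟩
      have a1 := c1 (n+1) (by omega) (n+1)
      have a2 := c1 n (by omega) (n+1)
      have a3 := c1 n (by omega) (n+1+1)
      have inj : ∀ x y, pe (n+1+1) b x = pe (n+1+1) b y → x = y :=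
        fun x y h => (pe (n+1+1) b).injective h
      have i1 := inj n (n+1)
      have i2 := inj n (n+1+1)
      have i3 := inj (n+1) (n+1+1)
      have a4 := c1 (n+1) (by omega) n
      simp only [Equiv.swap_apply_def] at a1 a2 a3 a4
      grind
    obtain ⟨w, c, hw, rfl⟩ := decomp b hperm
    have hc : ∀ j, j ≤ m → rho m c (X j) = w⁻¹ * X j * w := by
      intro j hj
      have h1 := hb (al m (X j))
      have h2 : al m ((X j * w) * (w * rho m c (X j))⁻¹) = 1 := by
        rw [map_mul, map_inv, mul_inv_eq_one, map_mul, map_mul, al_rho]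
        calc _ = (al m (X j) * (al m w * io m c)) * (io m c)⁻¹ := by group
          _ = _ := by rw [h1]; group
      have h3 := al_inj h2
      rw [map_mul, map_inv, mul_inv_eq_one, map_mul, map_mul, hw, ← rho_kil m c (by omega),
        kil_lt (by omega)] at h3
      rw [mul_assoc, h3]; group
    obtain ⟨i, hi, hci⟩ := inner_pow hc
    refine ⟨i, ?_⟩
    rw [hzc.mul_zpow, hi, hci]
    simp
  have hft : ft (m+1) ∈ Subgroup.center (Br (m+1)) := by
    rw [Subgroup.mem_center_iff]
    intro b
    exact (ft_comm b).symm
  obtain ⟨i, hi⟩ := key _ hft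
  have hdeg := congrArg (dg (m+1)) hi
  have hz : dg (m+1) z = Multiplicative.ofAdd (-((m+1)*(m+2) : ℤ)) := by
    simp only [z]
    rw [map_mul, map_inv, dg_io, dg_ft, dg_al_P m le_rfl, ← ofAdd_neg, ← ofAdd_add]
    congr 1
    push_cast; ring
  rw [map_zpow, hz, dg_ft, ← ofAdd_zsmul] at hdeg
  have hdeg' := Multiplicative.ofAdd.injective hdeg
  have hi1 : i = -1 := by
    push_cast at hdeg'
    simp only [smul_eq_mul] at hdeg'
    have : ((m+1)*(m+2) : ℤ) * (i + 1) = 0 := by linarith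
    rcases mul_eq_zero.1 this with h | h
    · exfalso; have : (0:ℤ) < (m+1)*(m+2) := by positivity
      omega
    · omega
  apply le_antisymm
  · intro b hb
    obtain ⟨j, hj⟩ := key b hb
    refine Subgroup.mem_zpowers_iff.2 ⟨-j, ?_⟩
    rw [hi, hi1, hj, ← zpow_mul]; simp
  · rwa [Subgroup.zpowers_le]

/-! ## The sphere relations -/

/-- the sphere word -/
def W (m : ℕ) : Br (m+1) := pr (sg (m+1)) (m+1) * pl (sg (m+1)) (m+1)

lemma D_P (k : ℕ) : pr art k (P k) = P (k+1) * (X 0)⁻¹ := by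
  have h1 : pr art k (P (k+1)) = P (k+1) := by rw [← rho_pr]; exact rho_P k _ (by omega)
  rw [P, map_mul, D_top] at h1
  rw [eq_mul_inv_iff_mul_eq, h1, P]

lemma rho_W_zero (m : ℕ) : rho (m+1) (W m) (X 0) = P (m+2) * X 0 * (P (m+2))⁻¹ := by
  rw [W, map_mul, MulAut.mul_apply, rho_pr, rho_pl, E_zero, map_mul, map_mul, map_inv, D_P, D_top]
  group

lemma rho_W_succ (m : ℕ) {j : ℕ} (h : j < m+1) :
    rho (m+1) (W m) (X (j+1)) = X 0 * X (j+1) * (X 0)⁻¹ := by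
  rw [W, map_mul, MulAut.mul_apply, rho_pr, rho_pl, E_succ _ h, D_lt _ h]

lemma pe_W (m : ℕ) : pe (m+1) (W m) = 1 := by
  ext j
  rw [Equiv.Perm.one_apply]
  rcases j with _ | j
  · exact pe_eq_of_rho (rho_W_zero m)
  · by_cases h : j < m+1
    · exact pe_eq_of_rho (rho_W_succ m h)
    · exact pe_eq_of_rho (u := 1) (by rw [rho_fix _ _ (by omega)]; simp)

lemma pe_ft (m : ℕ) : pe m (ft m) = 1 := by
  ext j
  rw [Equiv.Perm.one_apply]
  by_cases h : j ≤ m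
  · exact pe_eq_of_rho (rho_ft m h)
  · exact pe_eq_of_rho (u := 1) (by rw [rho_fix _ _ (by omega)]; simp)

lemma ft_rec (m : ℕ) :
    ft (m+1) = (pl (sg (m+1)) (m+1) * pr (sg (m+1)) (m+1)) * io m (ft m) := by
  have hlt : ∀ j, j < m+1 → rho (m+1) (pl (sg (m+1)) (m+1) * pr (sg (m+1)) (m+1)) (X j) =
      (P (m+1) * X (m+1) * (P (m+1))⁻¹) * X j * (P (m+1) * X (m+1) * (P (m+1))⁻¹)⁻¹ := by
    intro j hj
    rw [map_mul, MulAut.mul_apply, rho_pr, rho_pl, D_lt _ hj, map_mul, map_mul, map_inv, E_zero,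
      E_succ _ hj]
  have htop : rho (m+1) (pl (sg (m+1)) (m+1) * pr (sg (m+1)) (m+1)) (X (m+1)) =
      P (m+1) * X (m+1) * (P (m+1))⁻¹ := by
    rw [map_mul, MulAut.mul_apply, rho_pr, rho_pl, D_top, E_zero]
  have hP : rho (m+1) (pl (sg (m+1)) (m+1) * pr (sg (m+1)) (m+1)) (P (m+1)) =
      P (m+2) * (P (m+1) * X (m+1) * (P (m+1))⁻¹)⁻¹ := by
    have h1 := rho_P (m+1) (pl (sg (m+1)) (m+1) * pr (sg (m+1)) (m+1)) (show m+1 < m+2 by omega)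
    rw [P, map_mul, htop] at h1
    rw [eq_mul_inv_iff_mul_eq, h1, show P (m+2) = P (m+1) * X (m+1) from rfl]
  apply faithful'
  intro j hj
  rw [rho_ft _ hj, map_mul, MulAut.mul_apply, rho_io]
  by_cases h : j ≤ m
  · rw [rho_ft _ h, map_mul, map_mul, map_inv, hP, hlt j (by omega)]
    group
  · obtain rfl : j = m+1 := by omega
    rw [rho_fix _ _ (by omega), htop, show P (m+1+1) = P (m+1) * X (m+1) from rfl]
    group

/-- relators, with uniform indexing -/
def spRels (m : ℕ) : Set (FreeGroup (Fin (m+1))) :=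
  braidRelsSet (m+1) ∪ {puncturedSphereWord (m+1), (braidWord (m+1)) ^ (m+2)}
abbrev Sp (m : ℕ) := PresentedGroup (spRels m)

lemma lift_of {α : Type*} (R : Set (FreeGroup α)) :
    FreeGroup.lift (fun i => PresentedGroup.of (rels := R) i) = PresentedGroup.mk R := by
  ext i; simp [PresentedGroup.of]

def g (m : ℕ) : Br (m+1) →* Sp m :=
  PresentedGroup.toGroup (f := fun i => PresentedGroup.of i) (by
    intro r hr
    rw [lift_of]
    exact PresentedGroup.one_of_mem (Or.inl hr))

lemma g_mk (m : ℕ) (x : FreeGroup (Fin (m+1))) :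
    g m (PresentedGroup.mk _ x) = PresentedGroup.mk (spRels m) x := by
  rw [← lift_of (spRels m)]
  rfl

lemma g_surj (m : ℕ) : Function.Surjective (g m) := by
  intro y
  obtain ⟨x, rfl⟩ := PresentedGroup.mk_surjective _ y
  exact ⟨_, g_mk m x⟩

lemma mk_braidWord (m : ℕ) : PresentedGroup.mk (braidRelsSet m) (braidWord m) = pr (sg m) m := by
  rw [braidWord, map_list_prod, List.map_ofFn, ← pr_ofFn]
  congr 2
  funext i
  exact (sg_of_lt i.2).symm

lemma mk_sphereWord (m : ℕ) :
    PresentedGroup.mk (braidRelsSet (m+1)) (puncturedSphereWord (m+1)) = W m := by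
  rw [puncturedSphereWord, map_mul, mk_braidWord, W, map_list_prod, List.map_reverse,
    List.map_ofFn, ← pl_ofFn]
  congr 4
  funext i
  exact (sg_of_lt i.2).symm

lemma mk_full (m : ℕ) :
    PresentedGroup.mk (braidRelsSet (m+1)) (braidWord (m+1) ^ (m+2)) = ft (m+1) := by
  rw [map_pow, mk_braidWord, ft]

lemma g_W (m : ℕ) : g m (W m) = 1 := by
  rw [← mk_sphereWord, g_mk]
  exact PresentedGroup.one_of_mem (Or.inr (Or.inl rfl))
lemma g_ft (m : ℕ) : g m (ft (m+1)) = 1 := by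
  rw [← mk_full, g_mk]
  exact PresentedGroup.one_of_mem (Or.inr (Or.inr rfl))

lemma factor {H : Type*} [Group H] {m : ℕ} (φ : Br (m+1) →* H) (h1 : φ (W m) = 1)
    (h2 : φ (ft (m+1)) = 1) : ∃ ψ : Sp m →* H, ∀ b, ψ (g m b) = φ b := by
  have e : FreeGroup.lift (fun i => φ (PresentedGroup.of i)) =
      φ.comp (PresentedGroup.mk (braidRelsSet (m+1))) := by
    ext i; simp [PresentedGroup.of]
  have hr : ∀ r ∈ spRels m, FreeGroup.lift (fun i => φ (PresentedGroup.of i)) r = 1 := by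
    intro r hr
    rw [e, MonoidHom.comp_apply]
    rcases hr with hr | rfl | rfl
    · rw [PresentedGroup.one_of_mem hr, map_one]
    · rw [mk_sphereWord, h1]
    · rw [mk_full, h2]
  refine ⟨PresentedGroup.toGroup hr, ?_⟩
  intro b
  obtain ⟨x, rfl⟩ := PresentedGroup.mk_surjective _ b
  rw [g_mk]
  exact DFunLike.congr_fun e x

/-! ## The kernel -/

def qq (m : ℕ) : F →* F :=
  FreeGroup.lift fun j => if j ≤ m then X j else if j = m+1 then (P (m+1))⁻¹ else 1
lemma qq_le {m j : ℕ} (h : j ≤ m) : qq m (X j) = X j := by simp [qq, h]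
lemma qq_top (m : ℕ) : qq m (X (m+1)) = (P (m+1))⁻¹ := by simp [qq]
lemma qq_gt {m j : ℕ} (h : m + 1 < j) : qq m (X j) = 1 := by
  simp [qq, show ¬ j ≤ m by omega, show j ≠ m+1 by omega]
lemma qq_P {m k : ℕ} (h : k ≤ m+1) : qq m (P k) = P k := by
  induction k with
  | zero => simp [P]
  | succ k ih => rw [P, map_mul, ih (by omega), qq_le (by omega)]
lemma qq_PP (m : ℕ) : qq m (P (m+2)) = 1 := by
  rw [P, map_mul, qq_P le_rfl, qq_top, mul_inv_cancel]
lemma qq_kil (m : ℕ) (x : F) : qq m (kil (m+1) x) = kil (m+1) x := by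
  have : (qq m).comp (kil (m+1)) = kil (m+1) := by
    ext j
    by_cases h : j < m+1
    · simp [kil_lt h, qq_le (show j ≤ m by omega)]
    · simp [kil_ge (not_lt.1 h)]
  exact DFunLike.congr_fun this x
lemma qq_rho {m : ℕ} (b : Br (m+1)) (x : F) :
    qq m (rho (m+1) b (qq m x)) = qq m (rho (m+1) b x) := by
  have : ((qq m).comp (rho (m+1) b).toMonoidHom).comp (qq m) =
      (qq m).comp (rho (m+1) b).toMonoidHom := by
    ext j
    simp only [MonoidHom.comp_apply, MulEquiv.coe_toMonoidHom]
    rcases lt_trichotomy j (m+1) with h | h | h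
    · rw [qq_le (by omega)]
    · subst h
      rw [qq_top, map_inv, map_inv, inv_eq_iff_mul_eq_one, ← map_mul, ← map_mul]
      change qq m (rho (m+1) b (P (m+2))) = 1
      rw [rho_P _ _ (by omega), qq_PP]
    · rw [qq_gt h, rho_fix _ _ h, qq_gt h]; simp
  exact DFunLike.congr_fun this x

/-- braids acting by inner automorphisms on the sphere group -/
def T (m : ℕ) : Subgroup (Br (m+1)) where
  carrier := {b | ∃ u : F, ∀ x, qq m (rho (m+1) b x) = u * qq m x * u⁻¹}
  one_mem' := ⟨1, by simp⟩
  mul_mem' := by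
    rintro a b ⟨u, hu⟩ ⟨v, hv⟩
    refine ⟨u * v, fun x => ?_⟩
    rw [map_mul, MulAut.mul_apply, hu, hv]; group
  inv_mem' := by
    rintro a ⟨u, hu⟩
    refine ⟨u⁻¹, fun x => ?_⟩
    have := hu (rho (m+1) a⁻¹ x)
    rw [← MulAut.mul_apply, ← map_mul, mul_inv_cancel, map_one, MulAut.one_apply] at this
    rw [this]; group

instance T_normal (m : ℕ) : (T m).Normal := by
  constructor
  rintro a ⟨u, hu⟩ b
  refine ⟨qq m (rho (m+1) b u), fun x => ?_⟩
  have e : rho (m+1) b (rho (m+1) b⁻¹ x) = x := by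
    rw [← MulAut.mul_apply, ← map_mul, mul_inv_cancel, map_one, MulAut.one_apply]
  rw [map_mul, map_mul, MulAut.mul_apply, MulAut.mul_apply, ← qq_rho, hu]
  generalize rho (m+1) b⁻¹ x = y at e
  rw [map_mul, map_mul, map_mul, map_mul, qq_rho, e, map_inv, map_inv]

lemma hom_conj {f : F →* F} {h : F →* F} {u : F} (e : ∀ j, f (X j) = u * h (X j) * u⁻¹) (x : F) :
    f x = u * h x * u⁻¹ := by
  have : f = (MulAut.conj u).toMonoidHom.comp h := by
    ext j
    simpa using e j
  rw [this]; simp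

lemma W_mem (m : ℕ) : W m ∈ T m := by
  refine ⟨X 0, hom_conj (f := (qq m).comp (rho (m+1) (W m)).toMonoidHom) ?_⟩
  intro j
  simp only [MonoidHom.comp_apply, MulEquiv.coe_toMonoidHom]
  rcases j with _ | j
  · rw [rho_W_zero, map_mul, map_mul, map_inv, qq_PP, qq_le (by omega)]; group
  · by_cases h : j < m+1
    · rw [rho_W_succ m h, map_mul, map_mul, map_inv, qq_le (j := 0) (by omega)]
    · rw [rho_fix _ _ (by omega), qq_gt (by omega)]; group

lemma ft_mem (m : ℕ) : ft (m+1) ∈ T m := by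
  refine ⟨1, hom_conj (f := (qq m).comp (rho (m+1) (ft (m+1))).toMonoidHom) ?_⟩
  intro j
  simp only [MonoidHom.comp_apply, MulEquiv.coe_toMonoidHom]
  by_cases h : j ≤ m+1
  · rw [rho_ft _ h, map_mul, map_mul, map_inv]
    change qq m (P (m+2)) * _ * (qq m (P (m+2)))⁻¹ = _
    rw [qq_PP]
  · rw [rho_fix _ _ (by omega), qq_gt (by omega)]; group

lemma mem_T_of_g {m : ℕ} {b : Br (m+1)} (h : g m b = 1) : b ∈ T m := by
  obtain ⟨ψ, hψ⟩ := factor (QuotientGroup.mk' (T m))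
    ((QuotientGroup.eq_one_iff _).2 (W_mem m)) ((QuotientGroup.eq_one_iff _).2 (ft_mem m))
  have := hψ b
  rw [h, map_one] at this
  exact (QuotientGroup.eq_one_iff _).1 this.symm

def ff (m : ℕ) : Br m →* Sp m := (g m).comp (io m)

lemma ff_ft (m : ℕ) : ff m (ft m) = 1 := by
  have h1 := congrArg (g m) (ft_rec m)
  have h2 := g_W m
  rw [W, map_mul, mul_eq_one_iff_eq_inv] at h2
  rw [g_ft, map_mul, map_mul, h2, mul_inv_cancel, one_mul] at h1
  exact h1.symm

theorem ff_ker (m : ℕ) : (ff m).ker = Subgroup.zpowers (ft m) := by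
  apply le_antisymm
  · intro b hb
    obtain ⟨u, hu⟩ := mem_T_of_g (show g m (io m b) = 1 from hb)
    obtain ⟨i, _, hi⟩ := inner_pow (c := b) (w := u⁻¹) (by
      intro j hj
      have h1 := hu (X j)
      rw [rho_io, qq_le hj] at h1
      have : rho m b (X j) = kil (m+1) (rho m b (X j)) := by
        rw [← rho_kil m b (by omega), kil_lt (by omega)]
      rw [this, qq_kil, ← this] at h1
      rw [h1, inv_inv])
    exact Subgroup.mem_zpowers_iff.2 ⟨_, hi.symm⟩
  · rw [Subgroup.zpowers_le]; exact ff_ft m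

/-! ## The image and its index -/

def SS (m : ℕ) : Subgroup (Sp m) := (ff m).range

lemma g_sg_mem {m i : ℕ} (h : i < m) : g m (sg (m+1) i) ∈ SS m :=
  ⟨sg m i, by rw [ff, MonoidHom.comp_apply, io_sg h]⟩

lemma g_A_mem {m : ℕ} : ∀ k, k ≤ m → g m (A m k) ∈ SS m := by
  have h0 : g m (A m m) ∈ SS m := by
    have hr : ∀ k, k ≤ m → g m (pr (sg (m+1)) k) ∈ SS m := by
      intro k
      induction k with
      | zero => intro _; simp only [pr, map_one]; exact one_mem _
      | succ k ih => intro hk; rw [pr, map_mul]; exact mul_mem (ih (by omega)) (g_sg_mem (by omega))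
    have hl : ∀ k, k ≤ m → g m (pl (sg (m+1)) k) ∈ SS m := by
      intro k
      induction k with
      | zero => intro _; simp only [pl, map_one]; exact one_mem _
      | succ k ih => intro hk; rw [pl, map_mul]; exact mul_mem (g_sg_mem (by omega)) (ih (by omega))
    have h := g_W m
    rw [W, pr, pl] at h
    have e : g m (A m m) = (g m (pr (sg (m+1)) m))⁻¹ * (g m (pl (sg (m+1)) m))⁻¹ := by
      rw [A_top]
      simp only [map_mul] at h ⊢
      rw [eq_mul_inv_iff_mul_eq, eq_inv_iff_mul_eq_one, mul_eq_one_comm]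
      rw [← h]; group
    rw [e]
    exact mul_mem (inv_mem (hr m le_rfl)) (inv_mem (hl m le_rfl))
  have : ∀ d k, k + d = m → g m (A m k) ∈ SS m := by
    intro d
    induction d with
    | zero => intro k hk; obtain rfl : k = m := by omega
              exact h0
    | succ d ih =>
      intro k hk
      rw [A_step (by omega), map_mul, map_mul, map_inv]
      exact mul_mem (mul_mem (g_sg_mem (by omega)) (ih _ (by omega))) (inv_mem (g_sg_mem (by omega)))
  intro k hk
  exact this (m-k) k (by omega)

lemma g_al_mem {m : ℕ} (w : F) : g m (al m w) ∈ SS m := by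
  have h1 : ∀ k, g m (al m (X k)) ∈ SS m := by
    intro k
    by_cases hk : k ≤ m
    · rw [al_le hk, map_inv]; exact inv_mem (g_A_mem k hk)
    · rw [al_gt (by omega), map_one]; exact one_mem _
  induction w using FreeGroup.induction_on with
  | C1 => rw [map_one, map_one]; exact one_mem _
  | of k => exact h1 k
  | inv_of k ih => rw [map_inv, map_inv]; exact inv_mem (h1 k)
  | mul x y hx hy => rw [map_mul, map_mul]; exact mul_mem hx hy

theorem SS_index (m : ℕ) : (SS m).index = m + 2 := by
  obtain ⟨Q, hQ⟩ := factor (pe (m+1)) (pe_W m) (pe_ft (m+1))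
  letI : MulAction (Sp m) ℕ := MulAction.compHom ℕ Q
  have hact : ∀ (x : Sp m) (j : ℕ), x • j = Q x j := fun _ _ => rfl
  have hS : SS m = MulAction.stabilizer (Sp m) (m+1) := by
    apply le_antisymm
    · rintro _ ⟨b, rfl⟩
      rw [MulAction.mem_stabilizer_iff, hact]
      change Q (g m (io m b)) (m+1) = m+1
      rw [hQ]
      have := pe_last (m := m) 1 b
      rwa [map_one, one_mul] at this
    · intro y hy
      obtain ⟨b, rfl⟩ := g_surj m y
      rw [MulAction.mem_stabilizer_iff, hact, hQ] at hy
      obtain ⟨w, c, _, rfl⟩ := decomp b hy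
      rw [map_mul]
      exact mul_mem (g_al_mem w) ⟨c, rfl⟩
  have hO : MulAction.orbit (Sp m) (m+1) = Set.Iic (m+1) := by
    ext j
    rw [MulAction.mem_orbit_iff, Set.mem_Iic]
    constructor
    · rintro ⟨y, hy⟩
      obtain ⟨b, rfl⟩ := g_surj m y
      rw [hact, hQ] at hy
      by_contra hj
      have : pe (m+1) b j = j :=
        pe_eq_of_rho (u := 1) (by rw [rho_fix _ _ (by omega)]; simp)
      rw [← hy] at this
      have := (pe (m+1) b).injective this
      omega
    · intro hj
      refine ⟨g m (Y m j)⁻¹, ?_⟩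
      rw [hact, hQ, map_inv, Equiv.Perm.inv_eq_iff_eq, pe_Y j hj]
  rw [hS, MulAction.index_stabilizer, hO]
  simp

lemma ft_order {m : ℕ} (hm : 1 ≤ m) : ¬ IsOfFinOrder (ft m) := by
  rw [isOfFinOrder_iff_pow_eq_one]
  rintro ⟨n, hn, h⟩
  have := congrArg (dg m) h
  rw [map_pow, dg_ft, map_one, ← ofAdd_nsmul, ← ofAdd_zero] at this
  have := Multiplicative.ofAdd.injective this
  rw [nsmul_eq_mul] at this
  have h2 : n * ((m+1) * m) = 0 := by exact_mod_cast this
  have : 0 < n * ((m+1) * m) := by positivity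
  omega

lemma SS_closure (m : ℕ) : SS m = Subgroup.closure {x : Sp m |
    ∃ i : Fin (m+1), (i : ℕ) < m ∧ x = PresentedGroup.of i} := by
  apply le_antisymm
  · rintro _ ⟨b, rfl⟩
    have hg : ∀ i, i < m → ff m (sg m i) ∈ Subgroup.closure {x : Sp m |
        ∃ i : Fin (m+1), (i : ℕ) < m ∧ x = PresentedGroup.of i} := by
      intro i hi
      apply Subgroup.subset_closure
      refine ⟨⟨i, by omega⟩, hi, ?_⟩
      rw [ff, MonoidHom.comp_apply, io_sg hi, sg_of_lt (by omega)]
      exact PresentedGroup.toGroup.of _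
    induction b using br_induction with
    | h1 => rw [map_one]; exact one_mem _
    | h2 b i hi ih => rw [map_mul]; exact mul_mem ih (hg i hi)
    | h3 b i hi ih => rw [map_mul, map_inv]; exact mul_mem ih (inv_mem (hg i hi))
  · rw [Subgroup.closure_le]
    rintro _ ⟨i, hi, rfl⟩
    have := g_sg_mem hi
    rw [sg_of_lt i.2] at this
    have e : g m (PresentedGroup.of i) = PresentedGroup.of i := PresentedGroup.toGroup.of _
    rw [← e]
    exact this

theorem main (m : ℕ) (hm : 2 ≤ m) :
    (Subgroup.closure {x : Sp m |
      ∃ i : Fin (m+1), (i : ℕ) < m ∧ x = PresentedGroup.of i}).index = m + 2 ∧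
    ∃ f : Br m →* Sp m,
      (∀ i : Fin m, f (PresentedGroup.of i) = PresentedGroup.of (Fin.castLE (by omega) i)) ∧
      f.range = Subgroup.closure {x : Sp m |
        ∃ i : Fin (m+1), (i : ℕ) < m ∧ x = PresentedGroup.of i} ∧
      f.ker = Subgroup.center (Br m) ∧
      Subgroup.center (Br m) = Subgroup.zpowers (ft m) ∧
      ¬ IsOfFinOrder (ft m) := by
  have hc : Subgroup.center (Br m) = Subgroup.zpowers (ft m) := by
    obtain ⟨k, rfl⟩ : ∃ k, m = k + 1 := ⟨m-1, by omega⟩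
    exact center_eq (by omega)
  refine ⟨by rw [← SS_closure, SS_index], ff m, ?_, SS_closure m, by rw [ff_ker, hc], hc,
    ft_order (by omega)⟩
  intro i
  rw [← sg_of_lt i.2, ff, MonoidHom.comp_apply, io_sg i.2, sg_of_lt (by omega)]
  exact PresentedGroup.toGroup.of _

lemma fullTwist_eq (m : ℕ) : (fullTwist (m+1) : Br m) = ft m := by
  have h : (List.ofFn fun i : Fin m => (PresentedGroup.of i : Br m)).prod = pr (sg m) m := by
    rw [← pr_ofFn]
    congr 2
    funext i
    exact (sg_of_lt i.2).symm
  rw [ft, ← h]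
  rfl

end BraidProof

/-- For `n ≥ 4`: in `M_n`, the subgroup `S` generated by `σ₁, …, σ_{n−2}` has
index `n`, and the homomorphism `B_{n−1} → M_n` sending generators to
generators has image `S` and kernel exactly the center of `B_{n−1}`, which is
the infinite cyclic subgroup generated by the full twist `Δ²`. -/
theorem braid_to_sphereMCG (n : ℕ) (hn : 4 ≤ n) :
    (Subgroup.closure {x : SphereMCG n |
        ∃ i : Fin (n - 1), (i : ℕ) < n - 2 ∧ x = sphereGen n i}).index = n ∧
    ∃ f : BraidGroup (n - 1) →* SphereMCG n,
      (∀ i : Fin (n - 1 - 1),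
        f (braidGen (n - 1) i) = sphereGen n (Fin.castLE (by omega) i)) ∧
      f.range = Subgroup.closure {x : SphereMCG n |
        ∃ i : Fin (n - 1), (i : ℕ) < n - 2 ∧ x = sphereGen n i} ∧
      f.ker = Subgroup.center (BraidGroup (n - 1)) ∧
      Subgroup.center (BraidGroup (n - 1)) = Subgroup.zpowers (fullTwist (n - 1)) ∧
      ¬ IsOfFinOrder (fullTwist (n - 1)) := by
  obtain ⟨m, rfl⟩ : ∃ m, n = m + 2 := ⟨n - 2, by omega⟩
  have h := BraidProof.main m (by omega)
  rw [← BraidProof.fullTwist_eq] at h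
  exact h
end

section
/- Let G₂ be the mapping class group of the closed orientable genus-two surface, presented as below, and let ι denote the element ζ₁ζ₂ζ₃ζ₄ζ₅ζ₅ζ₄ζ₃ζ₂ζ₁ of G₂ (the hyperelliptic involution). Then ι ≠ 1 in G₂, and there is a surjective group homomorphism from G₂ onto M₆ (the mapping class group of the six-times punctured sphere, via its standard presentation) sending ζᵢ to σᵢ for i = 1, …, 5, whose kernel is exactly the two-element subgroup {1, ι}. In particular there is a short exact sequence 0 → ℤ/2 → G₂ → M₆ → 0 in which the generator of ℤ/2 is mapped to ι. -/
/-- The relators of the Birman–Hilden presentation of the mapping class group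
of the closed genus-two surface: the braid relators on five generators
`ζ₁, …, ζ₅`, together with `(ζ₁ζ₂ζ₃ζ₄ζ₅)⁶ = 1`, `ι² = 1` and `ιζᵢ = ζᵢι`,
where `ι = ζ₁ζ₂ζ₃ζ₄ζ₅ζ₅ζ₄ζ₃ζ₂ζ₁`. -/
def genus2RelsSet : Set (FreeGroup (Fin 5)) :=
  braidRelsSet 5 ∪ {(braidWord 5) ^ 6, (puncturedSphereWord 5) ^ 2} ∪
    {r | ∃ i : Fin 5,
      r = puncturedSphereWord 5 * FreeGroup.of i * (puncturedSphereWord 5)⁻¹ *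
        (FreeGroup.of i)⁻¹}

/-- The mapping class group of the closed orientable genus-two surface, via the
Birman–Hilden presentation. -/
abbrev Genus2MCG := PresentedGroup genus2RelsSet

/-- The generator `ζ_{i+1}` of the genus-two mapping class group. -/
def genus2Gen (i : Fin 5) : Genus2MCG := PresentedGroup.of i

/-- The hyperelliptic involution `ι = ζ₁ζ₂ζ₃ζ₄ζ₅ζ₅ζ₄ζ₃ζ₂ζ₁` in the genus-two
mapping class group. -/
def hyperelliptic : Genus2MCG :=
  (List.ofFn fun i : Fin 5 => genus2Gen i).prod *
    ((List.ofFn fun i : Fin 5 => genus2Gen i).reverse).prod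

/-- The unipotent part `x ↦ ω(cᵢ, x) cᵢ` of the symplectic transvection along the `i`-th curve of
the standard chain, in the basis given by the first four curves (the fifth is `-c₁-c₃`), mod 3. -/
def transvectionNil (i : Fin 5) : Matrix (Fin 4) (Fin 4) (ZMod 3) :=
  match i with
  | 0 => !![0, 1, 0, 0; 0, 0, 0, 0; 0, 0, 0, 0; 0, 0, 0, 0]
  | 1 => !![0, 0, 0, 0; -1, 0, 1, 0; 0, 0, 0, 0; 0, 0, 0, 0]
  | 2 => !![0, 0, 0, 0; 0, 0, 0, 0; 0, -1, 0, 1; 0, 0, 0, 0]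
  | 3 => !![0, 0, 0, 0; 0, 0, 0, 0; 0, 0, 0, 0; 0, 0, -1, 0]
  | 4 => !![0, 0, 0, 1; 0, 0, 0, 0; 0, 0, 0, 1; 0, 0, 0, 0]

lemma transvectionNil_sq (i : Fin 5) : transvectionNil i * transvectionNil i = 0 := by
  revert i; decide +kernel

/-- The symplectic transvections mod 3, as units. -/
def transv (i : Fin 5) : (Matrix (Fin 4) (Fin 4) (ZMod 3))ˣ where
  val := 1 + transvectionNil i
  inv := 1 - transvectionNil i
  val_inv := by
    have h := transvectionNil_sq i
    simp [mul_sub, add_mul, h]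
  inv_val := by
    have h := transvectionNil_sq i
    simp [mul_add, sub_mul, h]

lemma transv_comm (i j : Fin 5) (h : (i : ℕ) + 2 ≤ (j : ℕ) ∨ (j : ℕ) + 2 ≤ (i : ℕ)) :
    transv i * transv j = transv j * transv i := by
  apply Units.ext
  revert i j; decide +kernel

lemma transv_braid (i j : Fin 5) (h : (i : ℕ) + 1 = (j : ℕ) ∨ (j : ℕ) + 1 = (i : ℕ)) :
    transv i * transv j * transv i = transv j * transv i * transv j := by
  apply Units.ext
  revert i j; decide +kernel

lemma transv_iota : (transv 0 * (transv 1 * (transv 2 * (transv 3 * transv 4)))) *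
    (transv 4 * (transv 3 * (transv 2 * (transv 1 * transv 0)))) = -1 := by
  apply Units.ext
  decide +kernel

lemma transv_chain : (transv 0 * (transv 1 * (transv 2 * (transv 3 * transv 4)))) ^ 6 = 1 := by
  apply Units.ext
  decide +kernel

lemma lift_braidWord {G : Type*} [Group G] (f : Fin 5 → G) :
    FreeGroup.lift f (braidWord 5) = f 0 * (f 1 * (f 2 * (f 3 * f 4))) := by
  simp [braidWord, List.ofFn_succ]

lemma lift_sphereWord {G : Type*} [Group G] (f : Fin 5 → G) :
    FreeGroup.lift f (puncturedSphereWord 5) =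
      (f 0 * (f 1 * (f 2 * (f 3 * f 4)))) * (f 4 * (f 3 * (f 2 * (f 1 * f 0)))) := by
  rw [puncturedSphereWord, map_mul, lift_braidWord]
  simp [List.ofFn_succ, mul_assoc]

lemma transv_rels : ∀ r ∈ genus2RelsSet, FreeGroup.lift transv r = 1 := by
  rintro r ((⟨i, j, ⟨h, rfl⟩ | ⟨h, rfl⟩⟩ | rfl | rfl) | ⟨i, rfl⟩)
  · simp [transv_comm i j h]
  · simp only [map_mul, map_inv, FreeGroup.lift_apply_of]
    rw [transv_braid i j h, mul_inv_cancel]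
  · rw [map_pow, lift_braidWord, transv_chain]
  · rw [map_pow, lift_sphereWord, transv_iota]; simp
  · simp only [map_mul, map_inv, lift_sphereWord, transv_iota, FreeGroup.lift_apply_of]
    simp

lemma hyperelliptic_eq_mk : hyperelliptic = PresentedGroup.mk genus2RelsSet (puncturedSphereWord 5) := by
  simp [hyperelliptic, puncturedSphereWord, braidWord, List.ofFn_succ, genus2Gen,
    PresentedGroup.of]

lemma hyperelliptic_ne_one : hyperelliptic ≠ 1 := by
  intro h
  have h2 := congrArg (PresentedGroup.toGroup transv_rels) h
  rw [hyperelliptic_eq_mk, map_one] at h2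
  have h3 : FreeGroup.lift transv (puncturedSphereWord 5) = 1 := h2
  rw [lift_sphereWord, transv_iota] at h3
  have h4 := congrArg Units.val h3
  revert h4
  decide +kernel

lemma hyperelliptic_sq : hyperelliptic ^ 2 = 1 := by
  rw [hyperelliptic_eq_mk, ← map_pow]
  exact PresentedGroup.one_of_mem (Or.inl (Or.inr (Or.inr rfl)))

lemma hyperelliptic_comm (g : Genus2MCG) : hyperelliptic * g = g * hyperelliptic := by
  have hg : g ∈ Subgroup.centralizer {hyperelliptic} := by
    have : Subgroup.closure (Set.range (PresentedGroup.of (rels := genus2RelsSet))) ≤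
        Subgroup.centralizer {hyperelliptic} := by
      rw [Subgroup.closure_le]
      rintro _ ⟨i, rfl⟩
      have h : PresentedGroup.mk genus2RelsSet (puncturedSphereWord 5 * FreeGroup.of i *
          (puncturedSphereWord 5)⁻¹ * (FreeGroup.of i)⁻¹) = 1 :=
        PresentedGroup.one_of_mem (Or.inr ⟨i, rfl⟩)
      simp only [map_mul, map_inv, ← hyperelliptic_eq_mk] at h
      rw [SetLike.mem_coe, Subgroup.mem_centralizer_singleton_iff]
      exact (mul_inv_eq_iff_eq_mul.mp (mul_inv_eq_one.mp h)).symm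
    rw [PresentedGroup.closure_range_of] at this
    exact this trivial
  exact (Subgroup.mem_centralizer_singleton_iff.mp hg).symm

lemma sphere_rels : ∀ r ∈ genus2RelsSet,
    FreeGroup.lift (fun i : Fin 5 => sphereGen 6 i) r = 1 := by
  have key : ∀ r, FreeGroup.lift (fun i : Fin 5 => sphereGen 6 i) r =
      PresentedGroup.mk (sphereRelsSet 6) r := by
    intro r
    have : FreeGroup.lift (fun i : Fin 5 => sphereGen 6 i) =
      PresentedGroup.mk (sphereRelsSet 6) := by
      ext i; simp [sphereGen, PresentedGroup.of]
    rw [this]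
  have hw : PresentedGroup.mk (sphereRelsSet 6) (puncturedSphereWord 5) = 1 :=
    PresentedGroup.one_of_mem (Or.inr (Or.inl rfl))
  rintro r ((h | rfl | rfl) | ⟨i, rfl⟩) <;> rw [key]
  · exact PresentedGroup.one_of_mem (Or.inl h)
  · exact PresentedGroup.one_of_mem (Or.inr (Or.inr rfl))
  · rw [map_pow, hw, one_pow]
  · simp only [map_mul, map_inv, hw]
    simp

instance hyperelliptic_normal : (Subgroup.zpowers hyperelliptic).Normal := by
  constructor
  rintro n hn g
  obtain ⟨k, rfl⟩ := Subgroup.mem_zpowers_iff.mp hn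
  have : Commute hyperelliptic g := hyperelliptic_comm g
  rw [← (this.zpow_left k).eq, mul_inv_cancel_right]
  exact hn

lemma quot_rels : ∀ r ∈ sphereRelsSet 6,
    FreeGroup.lift (fun i : Fin 5 =>
      QuotientGroup.mk' (Subgroup.zpowers hyperelliptic) (genus2Gen i)) r = 1 := by
  have key : ∀ r, FreeGroup.lift (fun i : Fin 5 =>
      QuotientGroup.mk' (Subgroup.zpowers hyperelliptic) (genus2Gen i)) r =
      QuotientGroup.mk' (Subgroup.zpowers hyperelliptic) (PresentedGroup.mk genus2RelsSet r) := by
    intro r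
    have : FreeGroup.lift (fun i : Fin 5 =>
      QuotientGroup.mk' (Subgroup.zpowers hyperelliptic) (genus2Gen i)) =
      (QuotientGroup.mk' (Subgroup.zpowers hyperelliptic)).comp
        (PresentedGroup.mk genus2RelsSet) := by
      ext i; simp [genus2Gen, PresentedGroup.of]
    rw [this]; rfl
  rintro r (h | rfl | rfl)
  · refine (key r).trans ?_
    rw [PresentedGroup.one_of_mem (Or.inl (Or.inl h)), map_one]
  · refine (key (puncturedSphereWord 5)).trans ?_
    rw [← hyperelliptic_eq_mk]
    exact (QuotientGroup.eq_one_iff _).mpr (Subgroup.mem_zpowers _)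
  · refine (key (braidWord 5 ^ 6)).trans ?_
    rw [PresentedGroup.one_of_mem (Or.inl (Or.inr (Or.inl rfl))), map_one]

/-- The genus-two mapping class group is a `ℤ/2` central extension of the
mapping class group of the six-times punctured sphere: the hyperelliptic
involution `ι` is nontrivial, and the homomorphism `G₂ → M₆` sending `ζᵢ` to
`σᵢ` is surjective with kernel exactly `{1, ι}`. -/
theorem genus2_extension_of_sphereMCG :
    hyperelliptic ≠ 1 ∧
    ∃ φ : Genus2MCG →* SphereMCG 6,
      Function.Surjective φ ∧
      (∀ i : Fin 5, φ (genus2Gen i) = sphereGen 6 i) ∧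
      (∀ g : Genus2MCG, φ g = 1 ↔ g = 1 ∨ g = hyperelliptic) := by
  refine ⟨hyperelliptic_ne_one, PresentedGroup.toGroup sphere_rels, ?_, ?_, ?_⟩
  · rw [← MonoidHom.range_eq_top, eq_top_iff, ← PresentedGroup.closure_range_of,
      Subgroup.closure_le]
    rintro _ ⟨i, rfl⟩
    exact ⟨genus2Gen i, PresentedGroup.toGroup.of sphere_rels⟩
  · intro i
    exact PresentedGroup.toGroup.of sphere_rels
  · intro g
    constructor
    · intro h
      have hcomp : (PresentedGroup.toGroup quot_rels).comp (PresentedGroup.toGroup sphere_rels) =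
          QuotientGroup.mk' (Subgroup.zpowers hyperelliptic) := by
        apply PresentedGroup.ext
        intro i
        rw [MonoidHom.comp_apply, PresentedGroup.toGroup.of]
        exact PresentedGroup.toGroup.of quot_rels
      have h1 := DFunLike.congr_fun hcomp g
      rw [MonoidHom.comp_apply, h, map_one] at h1
      have h2 : g ∈ Subgroup.zpowers hyperelliptic := (QuotientGroup.eq_one_iff _).mp h1.symm
      obtain ⟨k, rfl⟩ := Subgroup.mem_zpowers_iff.mp h2
      have hsq : hyperelliptic ^ (2 : ℤ) = 1 := by exact_mod_cast hyperelliptic_sq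
      rcases Int.even_or_odd' k with ⟨m, rfl | rfl⟩
      · left; rw [zpow_mul, hsq, one_zpow]
      · right; rw [zpow_add, zpow_mul, hsq, one_zpow, one_mul, zpow_one]
    · rintro (rfl | rfl)
      · exact map_one _
      · have hw : PresentedGroup.mk (sphereRelsSet 6) (puncturedSphereWord 5) = 1 :=
          PresentedGroup.one_of_mem (Or.inr (Or.inl rfl))
        rw [hyperelliptic_eq_mk, ← hw]
        have : FreeGroup.lift (fun i : Fin 5 => sphereGen 6 i) =
            PresentedGroup.mk (sphereRelsSet 6) := by
          ext i; simp [sphereGen, PresentedGroup.of]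
        rw [← this]
        rfl
end
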